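/- arXiv:1905.04713 — 2 statements merged into one kernel-verified Lean document; each statement's English description precedes it below -/
import Mathlib

section
/- Let n ≥ 2, let k be an integer with 1 ≤ k ≤ n, let β > 1/k and α ≤ 1 − kβ, and let f : S^n → (0,∞) be smooth. Let u be a solution of the normalised anisotropic flow on S^n × [0,T). Then the functional J(u(·,t)) = ∫_{S^n} u σ_k (f u^{α−1} σ_k^β)^{−1/β} dμ is non-increasing in t; moreover, for a given time t its derivative vanishes if and only if f u^{α−1} σ_k^β is constant on S^n at time t, i.e. u(·,t) solves the elliptic equation f u^{α−1} σ_k^β = c for some positive constant c. -/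
open MeasureTheory Filter
open scoped RealInnerProductSpace Topology

noncomputable section

/-- Euclidean ambient space `ℝ^{n+1}`. -/
abbrev Eu (n : ℕ) : Type := EuclideanSpace ℝ (Fin (n + 1))

/-- The unit sphere `S^n ⊆ ℝ^{n+1}`. -/
def sph (n : ℕ) : Set (Eu n) := Metric.sphere (0 : Eu n) 1

/-- The 1-homogeneous extension `U(y) = |y|·u(y/|y|)` of a function on the sphere. -/
def homExt {n : ℕ} (u : Eu n → ℝ) (y : Eu n) : ℝ := ‖y‖ * u (‖y‖⁻¹ • y)

/-- The (Euclidean) Hessian of the 1-homogeneous extension, as an operator. -/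
def hessOp {n : ℕ} (u : Eu n → ℝ) (x : Eu n) : Eu n →L[ℝ] Eu n :=
  fderiv ℝ (gradient (homExt u)) x

/-- The `k`-th elementary symmetric function of the eigenvalues of an endomorphism of
`ℝ^{n+1}`, read off from the coefficients of the characteristic polynomial. -/
def esymmOp (n k : ℕ) (T : Eu n →ₗ[ℝ] Eu n) : ℝ :=
  (-1 : ℝ) ^ k * (LinearMap.charpoly T).coeff (n + 1 - k)

/-- `σ_k`, the `k`-th elementary symmetric function of the principal curvature radii,
i.e. of the eigenvalues of `W_u(x)`; since the Hessian of the 1-homogeneous extension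
kills the radial direction, this agrees with the `k`-th elementary symmetric function of
all its eigenvalues. -/
def sigmaK (n k : ℕ) (u : Eu n → ℝ) (x : Eu n) : ℝ :=
  esymmOp n k (hessOp u x).toLinearMap

/-- Smoothness on the sphere, expressed via the 1-homogeneous extension. -/
def SmoothOnSphere {n : ℕ} (u : Eu n → ℝ) : Prop :=
  ContDiffOn ℝ (⊤ : ℕ∞) (homExt u) {(0 : Eu n)}ᶜ

def PosOnSphere {n : ℕ} (u : Eu n → ℝ) : Prop := ∀ x ∈ sph n, 0 < u x

/-- Uniform convexity: `W_u(x)` is positive definite on the tangent hyperplane `x^⊥`. -/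
def UnifConvex {n : ℕ} (u : Eu n → ℝ) : Prop :=
  ∀ x ∈ sph n, ∀ v : Eu n, ⟪x, v⟫ = 0 → v ≠ 0 → 0 < ⟪v, hessOp u x v⟫

/-- `u` is the support function of a smooth, closed, uniformly convex hypersurface
enclosing the origin. -/
def GoodSph {n : ℕ} (u : Eu n → ℝ) : Prop :=
  SmoothOnSphere u ∧ PosOnSphere u ∧ UnifConvex u

/-- Integration over the sphere with respect to the surface (n-dimensional Hausdorff)
measure. -/
def sphInt (n : ℕ) (g : Eu n → ℝ) : ℝ :=
  ∫ x in sph n, g x ∂(Measure.hausdorffMeasure (n : ℝ))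

/-- `|S^n|`. -/
def sphVol (n : ℕ) : ℝ := (Measure.hausdorffMeasure (n : ℝ) (sph n)).toReal

/-- The spherical gradient `∇u(x) = DU(x) − u(x)·x`. -/
def sphGrad {n : ℕ} (u : Eu n → ℝ) (x : Eu n) : Eu n :=
  gradient (homExt u) x - u x • x

/-- The (unnormalised) anisotropic expanding flow `∂_t u = f u^α σ_k^β` on the time set `s`. -/
def ExpFlow (n k : ℕ) (α β : ℝ) (f : Eu n → ℝ) (s : Set ℝ) (u : ℝ → Eu n → ℝ) : Prop :=
  (∀ t ∈ s, GoodSph (u t)) ∧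
  ∀ x ∈ sph n, ∀ t ∈ s,
    HasDerivWithinAt (fun r => u r x)
      (f x * u t x ^ α * sigmaK n k (u t) x ^ β) s t

/-- The global term `η(t) = |S^n|⁻¹ ∫ f u^α σ_k^{1+β}` of the normalised anisotropic flow. -/
def eta (n k : ℕ) (α β : ℝ) (f v : Eu n → ℝ) : ℝ :=
  (sphVol n)⁻¹ * sphInt n (fun x => f x * v x ^ α * sigmaK n k v x ^ (1 + β))

/-- The normalised anisotropic flow `∂_t u = f u^α σ_k^β − η(t) u` on the time set `s`,
with the initial normalisation `∫ u σ_k = |S^n|`. -/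
def NormFlow (n k : ℕ) (α β : ℝ) (f : Eu n → ℝ) (s : Set ℝ) (u : ℝ → Eu n → ℝ) : Prop :=
  (∀ t ∈ s, GoodSph (u t)) ∧
  sphInt n (fun x => u 0 x * sigmaK n k (u 0) x) = sphVol n ∧
  ∀ x ∈ sph n, ∀ t ∈ s,
    HasDerivWithinAt (fun r => u r x)
      (f x * u t x ^ α * sigmaK n k (u t) x ^ β - eta n k α β f (u t) * u t x) s t

/-- The normalised isotropic (`f ≡ 1`) flow `∂_t u = u^α σ_k^β − γ u`, where
`γ = C(n,k)^β`. -/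
def IsoNormFlow (n k : ℕ) (α β : ℝ) (s : Set ℝ) (u : ℝ → Eu n → ℝ) : Prop :=
  (∀ t ∈ s, GoodSph (u t)) ∧
  ∀ x ∈ sph n, ∀ t ∈ s,
    HasDerivWithinAt (fun r => u r x)
      (u t x ^ α * sigmaK n k (u t) x ^ β - (n.choose k : ℝ) ^ β * u t x) s t

/-- Andrews' functional `J(u) = ∫_{S^n} u σ_k (f u^{α−1} σ_k^β)^{−1/β} dμ`. -/
def Jfun (n k : ℕ) (α β : ℝ) (f v : Eu n → ℝ) : ℝ :=
  sphInt n (fun x =>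
    v x * sigmaK n k v x * (f x * v x ^ (α - 1) * sigmaK n k v x ^ β) ^ (-(1 / β)))

/-! Matrix algebra -/
abbrev Mt (n : ℕ) : Type := Matrix (Fin (n+1)) (Fin (n+1)) ℝ

def sg (n k : ℕ) (a : Mt n) : ℝ := (-1 : ℝ) ^ k * a.charpoly.coeff (n + 1 - k)

lemma sg_minors (n k : ℕ) (hk : k ≤ n) (a : Mt n) : sg n k a =
    ∑ s ∈ Finset.univ.powersetCard k,
      (a.submatrix (Subtype.val : {x // x ∈ s} → Fin (n+1)) (Subtype.val)).det := by
  have h := Matrix.charpoly_coeff_eq_sum_minors a k (by simp; omega)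
  simp only [Fintype.card_fin] at h
  rw [sg, h, ← mul_assoc, ← mul_pow]
  simp

lemma interp_coeff (N k : ℕ) : ∃ c : ℕ → ℝ, ∀ p : Polynomial ℝ, p.natDegree ≤ N →
    p.coeff k = ∑ j ∈ Finset.range (N+1), c j * p.eval (j:ℝ) := by
  classical
  refine ⟨fun j => (Lagrange.basis (Finset.range (N+1)) (fun i : ℕ => (i:ℝ)) j).coeff k, ?_⟩
  intro p hp
  have h := Lagrange.eq_interpolate (f := p) (s := Finset.range (N+1)) (v := fun i : ℕ => (i:ℝ))
    (fun a _ b _ h => by simpa using h) (by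
      rw [Finset.card_range]
      exact lt_of_le_of_lt Polynomial.degree_le_natDegree (by exact_mod_cast Nat.lt_succ_of_le hp))
  conv_lhs => rw [h]
  rw [Lagrange.interpolate_apply, Polynomial.finsetSum_coeff]
  refine Finset.sum_congr rfl fun j _ => ?_
  rw [Polynomial.coeff_C_mul, mul_comm]

lemma sg_interp (n k : ℕ) (hk : k ≤ n) : ∃ c : ℕ → ℝ, ∀ a : Mt n,
    sg n k a = ∑ j ∈ Finset.range (n+2), c j * (1 + (j:ℝ) • a).det := by
  obtain ⟨c, hc⟩ := interp_coeff (n+1) k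
  refine ⟨c, fun a => ?_⟩
  rw [sg_minors n k hk, ← Matrix.coeff_det_one_add_X_smul_eq_sum_minors, hc]
  · refine Finset.sum_congr rfl fun j _ => ?_
    congr 1
    rw [← Polynomial.coe_evalRingHom, RingHom.map_det]
    congr 1
    ext i l
    simp [Matrix.one_apply]
    split_ifs <;> simp [mul_comm]
  · have := Polynomial.natDegree_det_X_add_C_le a (1 : Mt n)
    simp only [Fintype.card_fin] at this
    rw [add_comm (1 : Matrix _ _ _)]
    simpa using this

lemma sg_smul (n k : ℕ) (hk : k ≤ n) (r : ℝ) (a : Mt n) : sg n k (r • a) = r^k * sg n k a := by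
  rw [sg_minors n k hk, sg_minors n k hk, Finset.mul_sum]
  refine Finset.sum_congr rfl fun s hs => ?_
  rw [Matrix.submatrix_smul, Pi.smul_apply, Pi.smul_apply, Matrix.det_smul]
  simp [(Finset.mem_powersetCard.1 hs).2]

lemma det_one_add_ge {ι : Type*} [Fintype ι] [DecidableEq ι] (C : Matrix ι ι ℝ)
    (hC : C.PosSemidef) : 1 ≤ (1 + C).det := by
  have h1 : (1 + C).det = ∏ i, (1 + hC.1.eigenvalues i) := by
    have h := congrArg (Polynomial.eval (-1)) hC.1.charpoly_eq
    rw [Matrix.eval_charpoly, Polynomial.eval_prod] at h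
    have h2 : Matrix.scalar ι (-1 : ℝ) - C = - (1 + C) := by
      rw [neg_add, sub_eq_add_neg]; congr 1
      ext i j; simp [Matrix.one_apply, Matrix.diagonal_apply]; split_ifs <;> simp
    rw [h2, Matrix.det_neg] at h
    have h3 : ∏ i, Polynomial.eval (-1) (Polynomial.X - Polynomial.C ((hC.1.eigenvalues i : ℝ)))
      = (-1)^(Fintype.card ι) * ∏ i, (1 + hC.1.eigenvalues i) := by
      rw [← Finset.card_univ, ← Finset.prod_const, ← Finset.prod_mul_distrib]
      refine Finset.prod_congr rfl fun i _ => ?_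
      simp; ring
    simp only [RCLike.ofReal_real_eq_id, id] at h
    rw [h3] at h
    exact mul_left_cancel₀ (pow_ne_zero _ (by norm_num)) h
  rw [h1]
  apply Finset.one_le_prod
  intro i _
  have := hC.eigenvalues_nonneg i
  linarith

section
open scoped MatrixOrder Matrix.Norms.L2Operator
lemma psd_factor {ι : Type*} [Fintype ι] [DecidableEq ι] (A : Matrix ι ι ℝ)
    (hA : A.PosSemidef) : ∃ R : Matrix ι ι ℝ, A = R.conjTranspose * R := by
  obtain ⟨B, h⟩ := CStarAlgebra.nonneg_iff_eq_star_mul_self.mp hA.nonneg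
  exact ⟨B, h⟩
end

lemma det_mono_psd {ι : Type*} [Fintype ι] [DecidableEq ι] (A H : Matrix ι ι ℝ)
    (hA : A.PosSemidef) (hH : H.PosSemidef) : A.det ≤ (A + H).det := by
  by_cases h0 : A.det = 0
  · rw [h0]; exact (hA.add hH).det_nonneg
  obtain ⟨R, rfl⟩ := psd_factor A hA
  have hR : IsUnit R.det := by
    rw [Matrix.det_mul] at h0
    exact isUnit_iff_ne_zero.2 (right_ne_zero_of_mul h0)
  have key : R.conjTranspose * R + H = R.conjTranspose * (1 + (R⁻¹).conjTranspose * H * R⁻¹) * R := by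
    rw [mul_add, add_mul, mul_one, Matrix.conjTranspose_nonsing_inv]
    congr 1
    have hR' : IsUnit R.conjTranspose.det := by
      rw [Matrix.det_conjTranspose]; exact hR.star
    simp only [← mul_assoc]
    rw [Matrix.mul_nonsing_inv _ hR', one_mul, mul_assoc, Matrix.nonsing_inv_mul _ hR, mul_one]
  rw [key, Matrix.det_mul, Matrix.det_mul, Matrix.det_mul]
  have := det_one_add_ge _ (hH.conjTranspose_mul_mul_same (R⁻¹))
  have h2 : 0 ≤ R.conjTranspose.det * R.det := by
    rw [Matrix.det_conjTranspose]; simp; exact mul_self_nonneg _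
  nlinarith

lemma sg_mono (n k : ℕ) (hk : k ≤ n) (a b : Mt n) (ha : a.PosSemidef) (hb : (b - a).PosSemidef) :
    sg n k a ≤ sg n k b := by
  rw [sg_minors n k hk, sg_minors n k hk]
  refine Finset.sum_le_sum fun s _ => ?_
  have := det_mono_psd _ _ (ha.submatrix (Subtype.val : {x // x ∈ s} → Fin (n+1))) (hb.submatrix (Subtype.val : {x // x ∈ s} → Fin (n+1)))
  have h2 : a.submatrix (Subtype.val : {x // x ∈ s} → Fin (n+1)) (Subtype.val : {x // x ∈ s} → Fin (n+1)) +
    (b - a).submatrix (Subtype.val : {x // x ∈ s} → Fin (n+1)) (Subtype.val : {x // x ∈ s} → Fin (n+1)) =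
      b.submatrix (Subtype.val : {x // x ∈ s} → Fin (n+1)) (Subtype.val : {x // x ∈ s} → Fin (n+1)) := by
    ext i j; simp
  rwa [h2] at this

lemma sg_pos (n k : ℕ) (hk : k ≤ n) (a : Mt n) (ha : a.PosSemidef) (hr : n ≤ a.rank) :
    0 < sg n k a := by
  have h1 : sg n k a = sg n k (Matrix.diagonal ha.1.eigenvalues) := by
    rw [sg, sg, ha.1.charpoly_eq, Matrix.charpoly_diagonal]; rfl
  rw [ha.1.rank_eq_card_non_zero_eigs] at hr
  rw [h1, sg_minors n k hk]
  have h2 : ∀ s : Finset (Fin (n+1)), ((Matrix.diagonal ha.1.eigenvalues).submatrix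
      (Subtype.val : {x // x ∈ s} → Fin (n+1)) (Subtype.val)).det = ∏ i ∈ s, ha.1.eigenvalues i := by
    intro s
    rw [Matrix.submatrix_diagonal _ _ Subtype.val_injective, Matrix.det_diagonal]
    exact Finset.prod_coe_sort s _
  simp_rw [h2]
  have hr' : k ≤ (Finset.univ.filter (fun i => ha.1.eigenvalues i ≠ 0)).card := by
    rw [← Fintype.card_subtype]; omega
  obtain ⟨s, hs, hs'⟩ := Finset.exists_subset_card_eq hr'
  refine Finset.sum_pos' (fun s _ => Finset.prod_nonneg fun i _ => ha.eigenvalues_nonneg i)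
    ⟨s, Finset.mem_powersetCard.2 ⟨Finset.subset_univ _, hs'⟩, Finset.prod_pos fun i hi => ?_⟩
  exact lt_of_le_of_ne (ha.eigenvalues_nonneg i) (Ne.symm (by simpa using hs hi))

/-! Sphere measure -/
def smu (n : ℕ) : Measure (Eu n) := (Measure.hausdorffMeasure (n : ℝ)).restrict (sph n)

lemma sph_compact (n : ℕ) : IsCompact (sph n) := isCompact_sphere _ _
lemma sph_meas (n : ℕ) : MeasurableSet (sph n) := (sph_compact n).isClosed.measurableSet
lemma mem_sph {n : ℕ} {x : Eu n} : x ∈ sph n ↔ ‖x‖ = 1 := by simp [sph]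

lemma sphInt_eq (n : ℕ) (g : Eu n → ℝ) : sphInt n g = ∫ x, g x ∂(smu n) := rfl

def insMap (n : ℕ) (i : Fin (n+1)) (s : ℝ) (y : Fin n → ℝ) : Eu n :=
  WithLp.toLp 2 (i.insertNth (α := fun _ => ℝ) s y)

lemma insMap_contDiff (n : ℕ) (i : Fin (n+1)) (s : ℝ) : ContDiff ℝ 1 (insMap n i s) := by
  rw [contDiff_euclidean]
  intro j
  simp only [insMap]
  refine Fin.succAboveCases i ?_ ?_ j
  · simp; exact contDiff_const
  · intro k; simp; exact contDiff_apply ℝ ℝ k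

lemma insMap_ne (n : ℕ) (i : Fin (n+1)) (s : ℝ) (hs : s ≠ 0) (y) : insMap n i s y ≠ 0 := by
  intro h
  have := congrArg (fun z : Eu n => z i) h
  simp [insMap] at this
  exact hs this

lemma sph_finite (n : ℕ) : Measure.hausdorffMeasure (n : ℝ) (sph n) < ⊤ := by
  have key : ∀ (i : Fin (n+1)) (s : ℝ), s ≠ 0 → Measure.hausdorffMeasure (n : ℝ)
      ((fun y => ‖insMap n i s y‖⁻¹ • insMap n i s y) '' (Set.Icc (-1) 1)) < ⊤ := by
    intro i s hs
    have hc : ContDiff ℝ 1 (fun y => ‖insMap n i s y‖⁻¹ • insMap n i s y) := by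
      have h1 := insMap_contDiff n i s
      refine ContDiff.smul (ContDiff.inv (h1.norm ℝ (insMap_ne n i s hs)) ?_) h1
      intro y; exact norm_ne_zero_iff.2 (insMap_ne n i s hs y)
    obtain ⟨K, hK⟩ := hc.contDiffOn.exists_lipschitzOnWith (s := Set.Icc (-1 : Fin n → ℝ) 1) (by norm_num) (convex_Icc _ _) isCompact_Icc
    refine lt_of_le_of_lt (hK.hausdorffMeasure_image_le (Nat.cast_nonneg n)) ?_
    refine ENNReal.mul_lt_top (by simp) ?_
    have := MeasureTheory.hausdorffMeasure_pi_real (ι := Fin n)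
    simp only [Fintype.card_fin] at this
    rw [this]
    exact isCompact_Icc.measure_lt_top
  have cov : sph n ⊆ ⋃ i : Fin (n+1), (((fun y => ‖insMap n i 1 y‖⁻¹ • insMap n i 1 y) '' (Set.Icc (-1) 1)) ∪
      ((fun y => ‖insMap n i (-1) y‖⁻¹ • insMap n i (-1) y) '' (Set.Icc (-1) 1))) := by
    intro x hx
    rw [mem_sph] at hx
    obtain ⟨i, hi⟩ := Finite.exists_max (fun i => |x i|)
    have hi0 : x i ≠ 0 := by
      intro h
      have : x = 0 := by
        ext j
        have := hi j
        rw [h] at this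
        simpa using this
      rw [this] at hx; simp at hx
    have gen : ∀ s : ℝ, s = 1 ∨ s = -1 → |x i| = s * x i → ‖insMap n i s (fun j => x (i.succAbove j) / |x i|)‖⁻¹ • insMap n i s (fun j => x (i.succAbove j) / |x i|) = x ∧
        (fun j => x (i.succAbove j) / |x i|) ∈ Set.Icc (-1 : Fin n → ℝ) 1 := by
      intro s hs hxs
      have hp : 0 < |x i| := abs_pos.2 hi0
      have e : insMap n i s (fun j => x (i.succAbove j) / |x i|) = |x i|⁻¹ • x := by
        ext j
        simp only [insMap]
        refine Fin.succAboveCases i ?_ ?_ j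
        · simp
          rcases hs with rfl | rfl
          · rw [hxs]; field_simp
          · rw [hxs]; field_simp; 
        · intro k; simp; field_simp
      rw [e, norm_smul, hx]
      constructor
      · simp
        rw [smul_smul, mul_inv_cancel₀ hp.ne', one_smul]
      · constructor <;> intro j <;> simp
        · rw [le_div_iff₀ hp]
          have := hi (i.succAbove j)
          simp only at this
          have := neg_abs_le (x (i.succAbove j))
          linarith
        · rw [div_le_iff₀ hp]
          have := hi (i.succAbove j)
          simp only at this
          have := le_abs_self (x (i.succAbove j))
          linarith
    refine Set.mem_iUnion.2 ⟨i, ?_⟩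
    rcases le_or_gt 0 (x i) with h | h
    · left
      obtain ⟨h1, h2⟩ := gen 1 (Or.inl rfl) (by rw [abs_of_nonneg h]; ring)
      exact ⟨_, h2, h1⟩
    · right
      obtain ⟨h1, h2⟩ := gen (-1) (Or.inr rfl) (by rw [abs_of_neg h]; ring)
      exact ⟨_, h2, h1⟩
  refine lt_of_le_of_lt (measure_mono cov) ?_
  refine lt_of_le_of_lt (measure_iUnion_fintype_le _ _) ?_
  refine ENNReal.sum_lt_top.2 fun i _ => ?_
  exact lt_of_le_of_lt (measure_union_le _ _) (ENNReal.add_lt_top.2 ⟨key i 1 (by norm_num), key i (-1) (by norm_num)⟩)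

lemma sph_pos (n : ℕ) : 0 < Measure.hausdorffMeasure (n : ℝ) (sph n) := by
  have hL : LipschitzWith 1 (fun x : Eu n => fun j : Fin n => x j.succ) := by
    refine LipschitzWith.of_dist_le_mul fun x y => ?_
    simp only [NNReal.coe_one, one_mul]
    refine (dist_pi_le_iff dist_nonneg).2 fun j => ?_
    rw [dist_eq_norm, dist_eq_norm]
    exact PiLp.norm_apply_le (x - y) j.succ
  have h := hL.hausdorffMeasure_image_le (Nat.cast_nonneg n : (0:ℝ) ≤ n) (sph n)
  simp only [ENNReal.coe_one, ENNReal.one_rpow, one_mul] at h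
  refine lt_of_lt_of_le ?_ h
  have := MeasureTheory.hausdorffMeasure_pi_real (ι := Fin n)
  simp only [Fintype.card_fin] at this
  rw [this]
  have hsub : Set.Icc (0 : Fin n → ℝ) (fun _ => 1 / ((n:ℝ)+1)) ⊆ (fun x : Eu n => fun j : Fin n => x j.succ) '' sph n := by
    intro y hy
    have hs : ∑ j, y j ^ 2 ≤ 1 := by
      have : ∀ j, y j ^ 2 ≤ (1 / ((n:ℝ)+1)) := fun j => by
        have h1 := hy.1 j
        have h2 := hy.2 j
        simp only [Pi.zero_apply] at h1 h2
        have h3 : 1 / ((n:ℝ)+1) ≤ 1 := by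
          rw [div_le_one (by positivity)]; linarith [(Nat.cast_nonneg n : (0:ℝ) ≤ n)]
        nlinarith
      calc ∑ j, y j ^ 2 ≤ ∑ j : Fin n, 1 / ((n:ℝ)+1) := Finset.sum_le_sum fun j _ => this j
        _ = n / (n+1) := by simp; field_simp
        _ ≤ 1 := by rw [div_le_one (by positivity)]; linarith
    refine ⟨WithLp.toLp 2 (Fin.cons (Real.sqrt (1 - ∑ j, y j ^ 2)) y), ?_, ?_⟩
    · rw [mem_sph, EuclideanSpace.norm_eq, Real.sqrt_eq_one]
      rw [Fin.sum_univ_succ]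
      simp only [Fin.cons_zero, Fin.cons_succ, Real.norm_eq_abs, sq_abs]
      rw [Real.sq_sqrt (by linarith)]; ring
    · ext j; simp
  refine lt_of_lt_of_le ?_ (measure_mono hsub)
  rw [Real.volume_Icc_pi]
  refine lt_of_lt_of_eq (b := ∏ i : Fin n, ENNReal.ofReal (1 / ((n:ℝ)+1))) ?_ (by simp)
  rw [pos_iff_ne_zero, Finset.prod_ne_zero_iff]
  intro i _
  have : (0:ℝ) < 1 / ((n:ℝ)+1) := by positivity
  exact (ENNReal.ofReal_pos.2 this).ne'

instance (n : ℕ) : IsFiniteMeasure (smu n) := ⟨by rw [smu, Measure.restrict_apply_univ]; exact sph_finite n⟩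

lemma smu_univ (n : ℕ) : (smu n).real Set.univ = sphVol n := by
  simp [smu, sphVol, Measure.real]

lemma sphVol_pos (n : ℕ) : 0 < sphVol n := ENNReal.toReal_pos (sph_pos n).ne' (sph_finite n).ne

lemma smu_ae (n : ℕ) : ∀ᵐ x ∂(smu n), x ∈ sph n := ae_restrict_mem (sph_meas n)

lemma cont_int {n : ℕ} {g : Eu n → ℝ} (hg : ContinuousOn g (sph n)) : Integrable g (smu n) := by
  obtain ⟨C, hC⟩ := (sph_compact n).exists_bound_of_continuousOn hg
  refine Integrable.of_bound (hg.aestronglyMeasurable (sph_meas n)) C ?_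
  filter_upwards [smu_ae n] with x hx using hC x hx

lemma smu_inv {n : ℕ} (L : Eu n ≃ₗᵢ[ℝ] Eu n) : MeasurePreserving L (smu n) (smu n) := by
  have h := (L.toIsometryEquiv.measurePreserving_hausdorffMeasure (n:ℝ)).restrict_preimage (sph_meas n)
  have e : (L.toIsometryEquiv ⁻¹' (sph n)) = sph n := by
    ext x; simp [sph]
  rw [e] at h
  exact h

lemma smu_int_inv {n : ℕ} (L : Eu n ≃ₗᵢ[ℝ] Eu n) (g : Eu n → ℝ) :
    ∫ x, g (L x) ∂(smu n) = ∫ x, g x ∂(smu n) :=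
  (smu_inv L).integral_comp L.toHomeomorph.measurableEmbedding g

lemma smu_open {n : ℕ} (V : Set (Eu n)) (hV : IsOpen V) (x : Eu n) (hx : x ∈ sph n) (hxV : x ∈ V) :
    0 < smu n V := by
  by_contra h0
  have h0 : smu n V = 0 := by simpa using h0
  have hL : ∀ y : Eu n, y ∈ sph n → ∃ L : Eu n ≃ₗᵢ[ℝ] Eu n, L y = x := by
    intro y hy
    exact ⟨_, Submodule.reflection_sub (v := y) (w := x) (by rw [mem_sph.1 hx, mem_sph.1 hy])⟩
  choose! L hL using hL
  obtain ⟨t, ht⟩ := (sph_compact n).elim_nhds_subcover' (fun y _ => (L y) ⁻¹' V) (fun y hy =>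
    (hV.preimage (L y).continuous).mem_nhds (by simpa [hL y hy] using hxV))
  have : smu n (sph n) = 0 := by
    refine measure_mono_null ht ?_
    refine (measure_biUnion_null_iff t.countable_toSet).2 fun y _ => ?_
    rw [(smu_inv (L y)).measure_preimage hV.measurableSet.nullMeasurableSet, h0]
  rw [smu, Measure.restrict_apply_self] at this
  exact (sph_pos n).ne' this

def eb {n : ℕ} (i : Fin (n+1)) : Eu n := EuclideanSpace.single i (1:ℝ)

lemma eb_apply {n : ℕ} (i j : Fin (n+1)) : (eb i : Eu n) j = if j = i then 1 else 0 := by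
  simp [eb]

lemma sum_eb {n : ℕ} (x : Eu n) : ∑ i, x i • (eb i : Eu n) = x := by
  ext j; simp [eb_apply]

def pd {n : ℕ} (i : Fin (n+1)) (φ : Eu n → ℝ) (x : Eu n) : ℝ := fderiv ℝ φ x (eb i)

lemma fderiv_pd {n : ℕ} (φ : Eu n → ℝ) (x v : Eu n) : fderiv ℝ φ x v = ∑ i, v i * pd i φ x := by
  conv_lhs => rw [← sum_eb v]
  simp [pd]

/-- generator of the rotation -/
def rotS {n : ℕ} (i j : Fin (n+1)) (x : Eu n) : Eu n := x i • eb j - x j • eb i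

def rotLin {n : ℕ} (i j : Fin (n+1)) (θ : ℝ) : Eu n →ₗ[ℝ] Eu n where
  toFun x := x + (Real.cos θ - 1) • (x i • eb i + x j • eb j) + Real.sin θ • rotS i j x
  map_add' x y := by simp only [rotS, PiLp.add_apply]; module
  map_smul' r x := by simp only [rotS, PiLp.smul_apply, smul_eq_mul, RingHom.id_apply]; module

lemma rotLin_apply {n : ℕ} (i j : Fin (n+1)) (θ : ℝ) (x : Eu n) : rotLin i j θ x =
  x + (Real.cos θ - 1) • (x i • eb i + x j • eb j) + Real.sin θ • rotS i j x := rfl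

lemma rotLin_norm {n : ℕ} (i j : Fin (n+1)) (hij : i ≠ j) (θ : ℝ) (x : Eu n) : ‖rotLin i j θ x‖ = ‖x‖ := by
  have h : ‖rotLin i j θ x‖ ^ 2 = ‖x‖ ^ 2 := by
    rw [EuclideanSpace.norm_sq_eq, EuclideanSpace.norm_sq_eq]
    simp only [Real.norm_eq_abs, sq_abs]
    have hj : j ∈ Finset.univ.erase i := by simp [hij.symm]
    rw [← Finset.add_sum_erase _ _ (Finset.mem_univ i), ← Finset.add_sum_erase _ _ hj,
      ← Finset.add_sum_erase _ (fun l => x l ^ 2) (Finset.mem_univ i), ← Finset.add_sum_erase _ (fun l => x l ^ 2) hj]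
    have e : ∑ l ∈ (Finset.univ.erase i).erase j, (rotLin i j θ x) l ^ 2 = ∑ l ∈ (Finset.univ.erase i).erase j, x l ^ 2 := by
      refine Finset.sum_congr rfl fun l hl => ?_
      simp at hl
      simp [rotLin_apply, rotS, eb_apply, hl.1, hl.2]
    rw [e]
    have hji := hij.symm
    simp [rotLin_apply, rotS, eb_apply, hij, hji]
    have := Real.sin_sq_add_cos_sq θ
    linear_combination (x i ^ 2 + x j ^ 2) * this
  exact (sq_eq_sq₀ (norm_nonneg _) (norm_nonneg _)).1 h

def rotE {n : ℕ} (i j : Fin (n+1)) (hij : i ≠ j) (θ : ℝ) : Eu n ≃ₗᵢ[ℝ] Eu n :=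
  LinearIsometry.toLinearIsometryEquiv ⟨rotLin i j θ, rotLin_norm i j hij θ⟩ rfl

lemma rotE_apply {n : ℕ} (i j : Fin (n+1)) (hij : i ≠ j) (θ : ℝ) (x : Eu n) : rotE i j hij θ x = rotLin i j θ x := rfl

lemma rot_deriv {n : ℕ} (i j : Fin (n+1)) (hij : i ≠ j) (x : Eu n) (θ : ℝ) :
    HasDerivAt (fun θ => rotLin i j θ x) (rotS i j (rotLin i j θ x)) θ := by
  have h : HasDerivAt (fun θ => rotLin i j θ x)
      ((-Real.sin θ) • (x i • eb i + x j • eb j) + Real.cos θ • rotS i j x) θ := by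
    simp only [rotLin_apply]
    have h1 : HasDerivAt (fun θ => (Real.cos θ - 1) • (x i • (eb i : Eu n) + x j • eb j)) ((-Real.sin θ) • (x i • eb i + x j • eb j)) θ :=
      ((Real.hasDerivAt_cos θ).sub_const 1).smul_const _
    have h2 : HasDerivAt (fun θ => Real.sin θ • rotS i j x) (Real.cos θ • rotS i j x) θ :=
      (Real.hasDerivAt_sin θ).smul_const _
    exact (h1.const_add x).add h2
  convert h using 1
  have hji := hij.symm
  simp only [rotS, rotLin_apply]
  simp [eb_apply, hij, hji]
  module

lemma rotS_cont {n : ℕ} (i j : Fin (n+1)) : Continuous (rotS (n := n) i j) := by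
  unfold rotS; fun_prop

lemma rot_int {n : ℕ} (i j : Fin (n+1)) (φ : Eu n → ℝ) (hφ : ContDiffOn ℝ 1 φ {0}ᶜ) :
    ∫ x, fderiv ℝ φ x (rotS i j x) ∂(smu n) = 0 := by
  by_cases hij : i = j
  · subst hij; simp [rotS]
  have ho : IsOpen ({0}ᶜ : Set (Eu n)) := isOpen_compl_singleton
  have hsub : sph n ⊆ {0}ᶜ := by
    intro x hx h
    simp only [Set.mem_singleton_iff] at h
    rw [mem_sph, h] at hx; simp at hx
  have hd : ContinuousOn (fun x => fderiv ℝ φ x (rotS i j x)) (sph n) :=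
    ((hφ.continuousOn_fderiv_of_isOpen ho le_rfl).mono hsub).clm_apply (rotS_cont i j).continuousOn
  obtain ⟨C, hC⟩ := (sph_compact n).exists_bound_of_continuousOn hd
  have hmem : ∀ θ : ℝ, ∀ x ∈ sph n, rotLin i j θ x ∈ sph n := fun θ x hx => by
    rw [mem_sph, rotLin_norm i j hij, mem_sph.1 hx]
  have hcont : ∀ θ : ℝ, Continuous (fun x : Eu n => rotLin i j θ x) := fun θ => (rotE i j hij θ).continuous
  have key := hasDerivAt_integral_of_dominated_loc_of_deriv_le (μ := smu n) (s := Set.univ) (x₀ := (0:ℝ))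
    (F := fun θ x => φ (rotLin i j θ x)) (F' := fun θ x => fderiv ℝ φ (rotLin i j θ x) (rotS i j (rotLin i j θ x)))
    (bound := fun _ => C) Filter.univ_mem
    (Filter.Eventually.of_forall fun θ => (cont_int (((hφ.continuousOn.mono hsub).comp (hcont θ).continuousOn (fun x hx => hmem θ x hx)))).1)
    (cont_int (((hφ.continuousOn.mono hsub).comp (hcont 0).continuousOn (fun x hx => hmem 0 x hx))))
    (cont_int ((hd.comp (hcont 0).continuousOn (fun x hx => hmem 0 x hx)))).1
    (by filter_upwards [smu_ae n] with x hx θ _ using hC _ (hmem θ x hx))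
    (integrable_const _)
    (by
      filter_upwards [smu_ae n] with x hx θ _
      have h1 : HasFDerivAt φ (fderiv ℝ φ (rotLin i j θ x)) (rotLin i j θ x) :=
        ((hφ.differentiableOn (by norm_num)).differentiableAt (ho.mem_nhds (hsub (hmem θ x hx)))).hasFDerivAt
      exact h1.comp_hasDerivAt θ (rot_deriv i j hij x θ))
  have h2 := key.2
  have hconst : (fun θ : ℝ => ∫ x, φ (rotLin i j θ x) ∂(smu n)) = fun _ => ∫ x, φ x ∂(smu n) := by
    funext θ
    exact smu_int_inv (rotE i j hij θ) φ
  rw [hconst] at h2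
  have h3 := h2.unique (hasDerivAt_const _ _)
  have h0 : ∀ x : Eu n, rotLin i j 0 x = x := fun x => by simp [rotLin_apply]
  simpa [h0] using h3

lemma div_int {n : ℕ} (X : Fin (n+1) → Eu n → ℝ) (hX : ∀ j, ContDiffOn ℝ 1 (X j) {0}ᶜ)
    (h0 : ∀ x : Eu n, x ≠ 0 → ∑ j, x j * X j x = 0) :
    ∫ x, ∑ j, pd j (X j) x ∂(smu n) = 0 := by
  have ho : IsOpen ({0}ᶜ : Set (Eu n)) := isOpen_compl_singleton
  have hsub : sph n ⊆ {0}ᶜ := by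
    intro x hx h
    simp only [Set.mem_singleton_iff] at h
    rw [mem_sph, h] at hx; simp at hx
  have hco : ∀ i : Fin (n+1), ContDiff ℝ 1 (fun x : Eu n => x i) := fun i => contDiff_piLp_apply 2
  have hφ : ∀ i j : Fin (n+1), ContDiffOn ℝ 1 (fun x : Eu n => x i * X j x) {0}ᶜ := fun i j =>
    (hco i).contDiffOn.mul (hX j)
  have hint : ∀ i j : Fin (n+1), Integrable (fun x => fderiv ℝ (fun x : Eu n => x i * X j x) x (rotS i j x)) (smu n) := fun i j =>
    cont_int ((((hφ i j).continuousOn_fderiv_of_isOpen ho le_rfl).mono hsub).clm_apply (rotS_cont i j).continuousOn)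
  have hs : ∫ x, ∑ i, ∑ j, fderiv ℝ (fun x : Eu n => x i * X j x) x (rotS i j x) ∂(smu n) = 0 := by
    rw [integral_finsetSum _ (fun i _ => integrable_finsetSum _ fun j _ => hint i j)]
    refine Finset.sum_eq_zero fun i _ => ?_
    rw [integral_finsetSum _ (fun j _ => hint i j)]
    exact Finset.sum_eq_zero fun j _ => rot_int i j _ (hφ i j)
  rw [← hs]
  refine integral_congr_ae ?_
  filter_upwards [smu_ae n] with x hx
  have hx0 : x ≠ 0 := hsub hx
  have hdX : ∀ j, DifferentiableAt ℝ (X j) x := fun j =>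
    ((hX j).differentiableOn (by norm_num)).differentiableAt (ho.mem_nhds hx0)
  have hdc : ∀ i : Fin (n+1), HasFDerivAt (fun x : Eu n => x i) (EuclideanSpace.proj i : Eu n →L[ℝ] ℝ) x := fun i =>
    (EuclideanSpace.proj i : Eu n →L[ℝ] ℝ).hasFDerivAt
  have hd : ∀ i j (v : Eu n), fderiv ℝ (fun x : Eu n => x i * X j x) x v = v i * X j x + x i * fderiv ℝ (X j) x v := by
    intro i j v
    have hh : HasFDerivAt (fun x : Eu n => x i * X j x) _ x := (hdc i).mul (hdX j).hasFDerivAt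
    rw [hh.fderiv]
    simp; ring
  have hrad : ∑ j, fderiv ℝ (fun x : Eu n => x j * X j x) x x = 0 := by
    have e : (fun y : Eu n => ∑ j, y j * X j y) =ᶠ[𝓝 x] fun _ => 0 := by
      filter_upwards [ho.mem_nhds hx0] with y hy using h0 y hy
    have e2 := e.fderiv_eq (𝕜 := ℝ)
    have e3 : fderiv ℝ (fun y : Eu n => ∑ j, y j * X j y) x = ∑ j, fderiv ℝ (fun y : Eu n => y j * X j y) x :=
      fderiv_fun_sum fun j _ => ((hdc j).mul (hdX j).hasFDerivAt).differentiableAt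
    rw [e3] at e2
    have := congrArg (fun L : Eu n →L[ℝ] ℝ => L x) e2
    simpa using this
  simp only [hd] at hrad ⊢
  rw [Finset.sum_add_distrib, h0 x hx0, zero_add] at hrad
  have hn : ∑ i, x i * x i = 1 := by
    have := EuclideanSpace.norm_sq_eq x
    rw [mem_sph.1 hx] at this
    simp at this
    rw [this]; simp [sq]
  have hrs : ∀ i j (v : Eu n →L[ℝ] ℝ), v (rotS i j x) = x i * v (eb j) - x j * v (eb i) := by
    intro i j v; simp [rotS]
  have hrv : ∀ i j : Fin (n+1), (rotS i j x) i = x i * (if i = j then 1 else 0) - x j := by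
    intro i j; simp [rotS, eb_apply]
  simp only [hrs, hrv]
  have e1 : ∀ i j : Fin (n+1), (x i * (if i = j then 1 else 0) - x j) * X j x +
      x i * (x i * fderiv ℝ (X j) x (eb j) - x j * fderiv ℝ (X j) x (eb i)) =
      (if i = j then x j * X j x else 0) - x j * X j x + (x i * x i) * pd j (X j) x - x j * (x i * pd i (X j) x) := by
    intro i j
    unfold pd
    split_ifs with h
    · subst h; ring
    · ring
  simp only [e1, Finset.sum_sub_distrib, Finset.sum_add_distrib]
  have a1 : ∑ i : Fin (n+1), ∑ j, (if i = j then x j * X j x else 0) = 0 := by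
    simp [h0 x hx0]
  have a2 : ∑ i : Fin (n+1), ∑ j, x j * X j x = 0 := by simp [h0 x hx0]
  have a3 : ∑ i : Fin (n+1), ∑ j, x i * x i * pd j (X j) x = ∑ j, pd j (X j) x := by
    simp only [← Finset.mul_sum, ← Finset.sum_mul]
    rw [hn, one_mul]
  have a4 : ∑ i : Fin (n+1), ∑ j, x j * (x i * pd i (X j) x) = 0 := by
    rw [Finset.sum_comm]
    simp only [← Finset.mul_sum]
    simp only [← fderiv_pd]
    exact hrad
  rw [a1, a2, a3, a4]; ring

/-! homogeneous calculus -/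
lemma ho0 (n : ℕ) : IsOpen ({0}ᶜ : Set (Eu n)) := isOpen_compl_singleton
lemma sph_sub (n : ℕ) : sph n ⊆ {0}ᶜ := by
  intro x hx h
  simp only [Set.mem_singleton_iff] at h
  rw [mem_sph, h] at hx; simp at hx
lemma sph_ne {n : ℕ} {x : Eu n} (hx : x ∈ sph n) : x ≠ 0 := sph_sub n hx

def Sm {n : ℕ} (F : Eu n → ℝ) : Prop := ContDiffOn ℝ (⊤ : ℕ∞) F {(0 : Eu n)}ᶜ
def Hom1 {n : ℕ} (F : Eu n → ℝ) : Prop := ∀ r : ℝ, 0 < r → ∀ x, F (r • x) = r * F x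
def hm {n : ℕ} (F : Eu n → ℝ) (x : Eu n) : Mt n := fun i j => pd j (pd i F) x

lemma Sm.diff {n : ℕ} {F : Eu n → ℝ} (h : Sm F) {x : Eu n} (hx : x ≠ 0) : DifferentiableAt ℝ F x :=
  (ContDiffOn.differentiableOn h (by norm_num)).differentiableAt ((ho0 n).mem_nhds hx)

lemma Sm.contOn {n : ℕ} {F : Eu n → ℝ} (h : Sm F) : ContinuousOn F (sph n) :=
  (ContDiffOn.continuousOn h).mono (sph_sub n)

lemma Sm.contDiffAt {n : ℕ} {F : Eu n → ℝ} (h : Sm F) {x : Eu n} (hx : x ≠ 0) : ContDiffAt ℝ (⊤ : ℕ∞) F x :=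
  ContDiffOn.contDiffAt h ((ho0 n).mem_nhds hx)

lemma Sm.pd {n : ℕ} {F : Eu n → ℝ} (h : Sm F) (i : Fin (n+1)) : Sm (pd i F) := by
  have := ContDiffOn.fderiv_of_isOpen (m := (⊤ : ℕ∞)) h (ho0 n) (by exact_mod_cast le_rfl)
  exact this.clm_apply contDiffOn_const

lemma Sm.one {n : ℕ} {F : Eu n → ℝ} (h : Sm F) : ContDiffOn ℝ 1 F {0}ᶜ := ContDiffOn.of_le h (by norm_cast)

lemma pd_congr {n : ℕ} {F G : Eu n → ℝ} (i : Fin (n+1)) (h : ∀ x, x ≠ 0 → F x = G x) {x : Eu n} (hx : x ≠ 0) :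
    pd i F x = pd i G x := by
  have e : F =ᶠ[𝓝 x] G := by
    filter_upwards [(ho0 n).mem_nhds hx] with y hy using h y hy
  rw [pd, pd, e.fderiv_eq]

lemma pd_comm {n : ℕ} {F : Eu n → ℝ} (h : Sm F) (i j : Fin (n+1)) {x : Eu n} (hx : x ≠ 0) :
    pd i (pd j F) x = pd j (pd i F) x := by
  have h1 := (h.contDiffAt hx).isSymmSndFDerivAt (by simp; norm_cast)
  have hdd : DifferentiableAt ℝ (fderiv ℝ F) x := by
    have := ContDiffOn.fderiv_of_isOpen (m := (⊤ : ℕ∞)) h (ho0 n) (by exact_mod_cast le_rfl)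
    exact (this.differentiableOn (by norm_num)).differentiableAt ((ho0 n).mem_nhds hx)
  have e : ∀ i j : Fin (n+1), pd i (pd j F) x = fderiv ℝ (fderiv ℝ F) x (eb i) (eb j) := by
    intro i j
    have : pd j F = fun y => (fderiv ℝ F y) (eb j) := rfl
    rw [pd, this, fderiv_clm_apply hdd (differentiableAt_const _)]
    simp
  rw [e, e]
  exact h1 _ _

lemma hm_symm {n : ℕ} {F : Eu n → ℝ} (h : Sm F) {x : Eu n} (hx : x ≠ 0) (i j) : hm F x i j = hm F x j i :=
  pd_comm h j i hx

lemma pd_hm_symm {n : ℕ} {F : Eu n → ℝ} (h : Sm F) {x : Eu n} (hx : x ≠ 0) (i j l : Fin (n+1)) :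
    pd l (fun y => hm F y i j) x = pd j (fun y => hm F y i l) x :=
  pd_comm (h.pd i) l j hx

lemma euler {n : ℕ} {F : Eu n → ℝ} (h : Sm F) (h1 : Hom1 F) {x : Eu n} (hx : x ≠ 0) :
    ∑ i, x i * pd i F x = F x := by
  rw [← fderiv_pd]
  have a : HasDerivAt (fun r : ℝ => F (r • x)) (fderiv ℝ F x x) 1 := by
    have hF : HasFDerivAt F (fderiv ℝ F x) ((1:ℝ) • x) := by rw [one_smul]; exact (h.diff hx).hasFDerivAt
    have hr : HasDerivAt (fun r : ℝ => r • x) x 1 := by simpa using (hasDerivAt_id (1:ℝ)).smul_const x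
    exact hF.comp_hasDerivAt 1 hr
  have b : HasDerivAt (fun r : ℝ => r * F x) (F x) 1 := by simpa using (hasDerivAt_id (1:ℝ)).mul_const (F x)
  have e : (fun r : ℝ => F (r • x)) =ᶠ[𝓝 1] fun r => r * F x := by
    filter_upwards [lt_mem_nhds (zero_lt_one : (0:ℝ) < 1)] with r hr using h1 r hr x
  exact a.unique (b.congr_of_eventuallyEq e)

lemma pd_hom {n : ℕ} {F : Eu n → ℝ} (h : Sm F) (h1 : Hom1 F) (i : Fin (n+1)) {x : Eu n} (hx : x ≠ 0)
    {r : ℝ} (hr : 0 < r) : pd i F (r • x) = pd i F x := by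
  have hrx : r • x ≠ 0 := smul_ne_zero hr.ne' hx
  have a : HasFDerivAt (fun y => F (r • y)) ((fderiv ℝ F (r • x)).comp (r • ContinuousLinearMap.id ℝ (Eu n))) x := by
    have hF : HasFDerivAt F (fderiv ℝ F (r • x)) (r • x) := (h.diff hrx).hasFDerivAt
    exact hF.comp x ((hasFDerivAt_id x).const_smul r)
  have b : HasFDerivAt (fun y => F (r • y)) (r • fderiv ℝ F x) x := by
    have : (fun y => F (r • y)) = fun y => r * F y := funext fun y => h1 r hr y
    rw [this]
    exact (h.diff hx).hasFDerivAt.const_mul r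
  have c := congrArg (fun L : Eu n →L[ℝ] ℝ => L (eb i)) (a.unique b)
  simp at c
  unfold pd
  rcases c with c | c
  · exact c
  · exact absurd c hr.ne'

lemma hm_hom {n : ℕ} {F : Eu n → ℝ} (h : Sm F) (h1 : Hom1 F) (i j : Fin (n+1)) {x : Eu n} (hx : x ≠ 0)
    {r : ℝ} (hr : 0 < r) : r * hm F (r • x) i j = hm F x i j := by
  have hrx : r • x ≠ 0 := smul_ne_zero hr.ne' hx
  have a : HasFDerivAt (fun y => pd i F (r • y)) ((fderiv ℝ (pd i F) (r • x)).comp (r • ContinuousLinearMap.id ℝ (Eu n))) x := by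
    have hF : HasFDerivAt (pd i F) (fderiv ℝ (pd i F) (r • x)) (r • x) := ((h.pd i).diff hrx).hasFDerivAt
    exact hF.comp x ((hasFDerivAt_id x).const_smul r)
  have b : HasFDerivAt (fun y => pd i F (r • y)) (fderiv ℝ (pd i F) x) x := by
    refine ((h.pd i).diff hx).hasFDerivAt.congr_of_eventuallyEq ?_
    filter_upwards [(ho0 n).mem_nhds hx] with y hy using pd_hom h h1 i hy hr
  have c := congrArg (fun L : Eu n →L[ℝ] ℝ => L (eb j)) (a.unique b)
  simp at c
  exact c

lemma hm_ker {n : ℕ} {F : Eu n → ℝ} (h : Sm F) (h1 : Hom1 F) {x : Eu n} (hx : x ≠ 0) (i : Fin (n+1)) :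
    ∑ j, hm F x i j * x j = 0 := by
  have : ∑ j, x j * pd j (pd i F) x = 0 := by
    rw [← fderiv_pd]
    have a : HasDerivAt (fun r : ℝ => pd i F (r • x)) (fderiv ℝ (pd i F) x x) 1 := by
      have hF : HasFDerivAt (pd i F) (fderiv ℝ (pd i F) x) ((1:ℝ) • x) := by rw [one_smul]; exact ((h.pd i).diff hx).hasFDerivAt
      have hr : HasDerivAt (fun r : ℝ => r • x) x 1 := by simpa using (hasDerivAt_id (1:ℝ)).smul_const x
      exact hF.comp_hasDerivAt 1 hr
    have e : (fun r : ℝ => pd i F (r • x)) =ᶠ[𝓝 1] fun r => pd i F x := by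
      filter_upwards [lt_mem_nhds (zero_lt_one : (0:ℝ) < 1)] with r hr using pd_hom h h1 i hx hr
    exact a.unique ((hasDerivAt_const _ _).congr_of_eventuallyEq e)
  rw [← this]
  exact Finset.sum_congr rfl fun j _ => mul_comm _ _

/-! homExt -/
lemma homExt_hom {n : ℕ} (u : Eu n → ℝ) : Hom1 (homExt u) := by
  intro r hr x
  by_cases hx : x = 0
  · simp [homExt, hx]
  have : ‖x‖ ≠ 0 := norm_ne_zero_iff.2 hx
  simp only [homExt, norm_smul, Real.norm_eq_abs, abs_of_pos hr, smul_smul]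
  have e : (r * ‖x‖)⁻¹ * r = ‖x‖⁻¹ := by field_simp
  rw [e]; ring

lemma homExt_sph {n : ℕ} (u : Eu n → ℝ) {x : Eu n} (hx : x ∈ sph n) : homExt u x = u x := by
  simp [homExt, mem_sph.1 hx]

lemma nrm_mem {n : ℕ} {x : Eu n} (hx : x ≠ 0) : ‖x‖⁻¹ • x ∈ sph n := by
  rw [mem_sph, norm_smul]; simp [hx]

lemma grad_apply {n : ℕ} (F : Eu n → ℝ) (x : Eu n) (i : Fin (n+1)) : gradient F x i = pd i F x := by
  have h : ⟪gradient F x, eb i⟫ = fderiv ℝ F x (eb i) := by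
    rw [gradient]; exact InnerProductSpace.toDual_symm_apply
  rw [pd, ← h, eb, EuclideanSpace.inner_single_right]
  simp

lemma hessOp_apply {n : ℕ} {u : Eu n → ℝ} (hu : SmoothOnSphere u) {x : Eu n} (hx : x ≠ 0) (v : Eu n) (i : Fin (n+1)) :
    hessOp u x v i = ∑ j, hm (homExt u) x i j * v j := by
  have hg : gradient (homExt u) = fun y => WithLp.toLp 2 (fun i => pd i (homExt u) y) := by
    funext y; ext i; exact grad_apply _ _ _
  have hS : Sm (homExt u) := hu
  have hD : HasFDerivAt (gradient (homExt u)) (hessOp u x) x := by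
    have : DifferentiableAt ℝ (gradient (homExt u)) x := by
      rw [differentiableAt_euclidean]
      intro i
      simp only [grad_apply]
      exact (hS.pd i).diff hx
    exact this.hasFDerivAt
  have h1 : HasFDerivAt (fun y => gradient (homExt u) y i) ((EuclideanSpace.proj i : Eu n →L[ℝ] ℝ).comp (hessOp u x)) x :=
    (EuclideanSpace.proj i : Eu n →L[ℝ] ℝ).hasFDerivAt.comp x hD
  simp only [grad_apply] at h1
  have h2 := h1.unique ((hS.pd i).diff hx).hasFDerivAt
  have h3 := congrArg (fun L : Eu n →L[ℝ] ℝ => L v) h2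
  simp at h3
  rw [h3, fderiv_pd]
  exact Finset.sum_congr rfl fun j _ => mul_comm _ _

lemma sigmaK_eq {n : ℕ} (k : ℕ) {u : Eu n → ℝ} (hu : SmoothOnSphere u) {x : Eu n} (hx : x ≠ 0) :
    sigmaK n k u x = sg n k (hm (homExt u) x) := by
  rw [sigmaK, esymmOp, sg]
  rw [← LinearMap.charpoly_toMatrix (hessOp u x).toLinearMap (EuclideanSpace.basisFun (Fin (n+1)) ℝ).toBasis]
  congr 3
  ext i j
  rw [LinearMap.toMatrix_apply]
  simp
  rw [hessOp_apply hu hx]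
  simp

lemma good_quad {n : ℕ} {u : Eu n → ℝ} (hu : GoodSph u) {x : Eu n} (hx : x ∈ sph n) (v : Fin (n+1) → ℝ) :
    0 ≤ v ⬝ᵥ (hm (homExt u) x).mulVec v ∧ (v ⬝ᵥ (hm (homExt u) x).mulVec v = 0 → ∃ c : ℝ, v = c • (fun i => x i)) := by
  have hS : Sm (homExt u) := hu.1
  have hx0 := sph_ne hx
  set V : Eu n := WithLp.toLp 2 v with hV
  set w : Eu n := V - ⟪x, V⟫ • x with hw
  have hxw : ⟪x, w⟫ = 0 := by
    rw [hw, inner_sub_right, inner_smul_right, real_inner_self_eq_norm_sq, mem_sph.1 hx]; ring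
  have hHx : (hm (homExt u) x).mulVec (fun i => x i) = 0 := by
    ext i; exact hm_ker hS (homExt_hom u) hx0 i
  have hsym : ∀ p q : Fin (n+1) → ℝ, p ⬝ᵥ (hm (homExt u) x).mulVec q = q ⬝ᵥ (hm (homExt u) x).mulVec p := by
    intro p q
    rw [Matrix.dotProduct_mulVec, ← Matrix.mulVec_transpose, dotProduct_comm]
    congr 2
    ext i j; exact hm_symm hS hx0 j i
  have hvw : v = (fun i => w i) + ⟪x, V⟫ • (fun i => x i) := by
    ext i; simp [hw, hV]
  have e : v ⬝ᵥ (hm (homExt u) x).mulVec v = ⟪w, hessOp u x w⟫ := by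
    conv_lhs => rw [hvw]
    rw [Matrix.mulVec_add, Matrix.mulVec_smul, hHx, smul_zero, add_zero, add_dotProduct, smul_dotProduct, hsym (fun i => x i), hHx]
    simp only [dotProduct_zero, smul_zero, add_zero]
    rw [PiLp.inner_apply]
    simp only [dotProduct, Matrix.mulVec, hessOp_apply hu.1 hx0]
    exact Finset.sum_congr rfl fun i _ => by simp [mul_comm]
  rw [e]
  by_cases hw0 : w = 0
  · refine ⟨by rw [hw0]; simp, fun _ => ⟨⟪x, V⟫, ?_⟩⟩
    conv_lhs => rw [hvw, hw0]
    ext i; simp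
  · have := hu.2.2 x hx w hxw hw0
    exact ⟨this.le, fun h => absurd h this.ne'⟩

lemma good_psd {n : ℕ} {u : Eu n → ℝ} (hu : GoodSph u) {x : Eu n} (hx : x ∈ sph n) :
    (hm (homExt u) x).PosSemidef := by
  refine Matrix.posSemidef_iff_dotProduct_mulVec.2 ⟨?_, fun v => ?_⟩
  · ext i j
    simp only [Matrix.conjTranspose_apply, star_trivial]
    exact hm_symm hu.1 (sph_ne hx) j i
  · simpa using (good_quad hu hx v).1

lemma good_psd' {n : ℕ} {u : Eu n → ℝ} (hu : GoodSph u) {x : Eu n} (hx : x ≠ 0) :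
    (hm (homExt u) x).PosSemidef := by
  have h1 := good_psd hu (nrm_mem hx)
  have hp : 0 < ‖x‖⁻¹ := inv_pos.2 (norm_pos_iff.2 hx)
  have e : hm (homExt u) x = ‖x‖⁻¹ • hm (homExt u) (‖x‖⁻¹ • x) := by
    ext i j
    rw [← hm_hom hu.1 (homExt_hom u) i j hx hp]; rfl
  rw [e]
  exact h1.smul hp.le

lemma good_rank {n : ℕ} {u : Eu n → ℝ} (hu : GoodSph u) {x : Eu n} (hx : x ∈ sph n) :
    n ≤ (hm (homExt u) x).rank := by
  have h := LinearMap.finrank_range_add_finrank_ker (hm (homExt u) x).mulVecLin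
  have hk : LinearMap.ker (hm (homExt u) x).mulVecLin ≤ Submodule.span ℝ {fun i => x i} := by
    intro v hv
    rw [LinearMap.mem_ker, Matrix.mulVecLin_apply] at hv
    obtain ⟨c, hc⟩ := (good_quad hu hx v).2 (by rw [hv]; simp)
    exact Submodule.mem_span_singleton.2 ⟨c, hc.symm⟩
  have h2 := Submodule.finrank_mono hk
  have h3 : Module.finrank ℝ (Submodule.span ℝ ({fun i => x i} : Set (Fin (n+1) → ℝ))) ≤ 1 := by
    simpa using finrank_span_le_card (R := ℝ) ({fun i => x i} : Set (Fin (n+1) → ℝ))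
  have h4 := h2.trans h3
  rw [Matrix.rank]
  simp only [Module.finrank_fintype_fun_eq_card, Fintype.card_fin] at h
  omega

lemma good_sig_pos {n k : ℕ} (hk : k ≤ n) {u : Eu n → ℝ} (hu : GoodSph u) {x : Eu n} (hx : x ∈ sph n) :
    0 < sigmaK n k u x := by
  rw [sigmaK_eq k hu.1 (sph_ne hx)]
  exact sg_pos n k hk _ (good_psd hu hx) (good_rank hu hx)

lemma jacobi {ι : Type*} [Fintype ι] [DecidableEq ι] (b : ℝ → Matrix ι ι ℝ) (b' : Matrix ι ι ℝ) (s : ℝ)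
    (h : ∀ i j, HasDerivAt (fun t => b t i j) (b' i j) s) :
    HasDerivAt (fun t => (b t).det) (((b s).adjugate * b').trace) s := by
  simp only [Matrix.det_apply']
  have h1 : HasDerivAt (fun t => ∑ σ : Equiv.Perm ι, ((Equiv.Perm.sign σ : ℤ) : ℝ) * ∏ i, b t (σ i) i)
      (∑ σ : Equiv.Perm ι, ((Equiv.Perm.sign σ : ℤ) : ℝ) * ∑ i, (∏ j ∈ Finset.univ.erase i, b s (σ j) j) • b' (σ i) i) s := by
    refine HasDerivAt.fun_sum fun σ _ => HasDerivAt.const_mul _ ?_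
    exact HasDerivAt.fun_finsetProd fun i _ => h (σ i) i
  convert h1 using 1
  simp only [Finset.mul_sum]
  rw [Finset.sum_comm, Matrix.trace]
  refine Finset.sum_congr rfl fun i _ => ?_
  have e : ((b s).adjugate * b').diag i = ((b s).updateCol i (fun l => b' l i)).det := by
    rw [← Matrix.cramer_apply, Matrix.cramer_eq_adjugate_mulVec]; rfl
  rw [e, Matrix.det_apply']
  refine Finset.sum_congr rfl fun σ _ => ?_
  congr 1
  rw [← Finset.prod_erase_mul _ _ (Finset.mem_univ i), smul_eq_mul]
  congr 1
  · refine Finset.prod_congr rfl fun j hj => ?_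
    rw [Matrix.updateCol_ne (Finset.ne_of_mem_erase hj)]
  · simp

lemma pd_line {n : ℕ} {φ : Eu n → ℝ} {x : Eu n} (h : DifferentiableAt ℝ φ x) (l : Fin (n+1)) :
    HasDerivAt (fun s : ℝ => φ (x + s • eb l)) (pd l φ x) 0 := by
  have hF : HasFDerivAt φ (fderiv ℝ φ x) (x + (0:ℝ) • eb l) := by simpa using h.hasFDerivAt
  have hr : HasDerivAt (fun s : ℝ => x + s • (eb l : Eu n)) (eb l) 0 := by
    simpa using ((hasDerivAt_id (0:ℝ)).smul_const (eb l : Eu n)).const_add x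
  exact hF.comp_hasDerivAt 0 hr

lemma Sm.det {n : ℕ} {ι : Type*} [Fintype ι] [DecidableEq ι] {b : Eu n → Matrix ι ι ℝ} (hb : ∀ i j, Sm (fun x => b x i j)) :
    Sm (fun x => (b x).det) := by
  unfold Sm
  simp only [Matrix.det_apply']
  exact ContDiffOn.sum fun σ _ => contDiffOn_const.mul (contDiffOn_prod fun i _ => hb _ _)

lemma Sm.adj {n : ℕ} {b : Eu n → Mt n} (hb : ∀ i j, Sm (fun x => b x i j)) (i j) :
    Sm (fun x => (b x).adjugate i j) := by
  simp only [Matrix.adjugate_apply]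
  refine Sm.det fun p q => ?_
  by_cases hp : p = j
  · subst hp; simp only [Matrix.updateRow_self]; exact contDiffOn_const
  · simp only [Matrix.updateRow_ne hp]; exact hb p q

lemma pd_det {n : ℕ} {b : Eu n → Mt n} (hb : ∀ i j, Sm (fun x => b x i j)) {x : Eu n} (hx : x ≠ 0) (l) :
    pd l (fun y => (b y).det) x = ∑ i, ∑ j, (b x).adjugate i j * pd l (fun y => b y j i) x := by
  have h1 := pd_line ((Sm.det hb).diff hx) l
  have h2 := jacobi (fun s => b (x + s • eb l)) (Matrix.of fun i j => pd l (fun y => b y i j) x) 0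
    (fun i j => pd_line ((hb i j).diff hx) l)
  rw [h1.unique h2]
  simp [Matrix.trace, Matrix.mul_apply]

lemma piola {n : ℕ} {b : Eu n → Mt n} (hb : ∀ i j, Sm (fun x => b x i j)) {x : Eu n} (hx : x ≠ 0)
    (hsym : ∀ i j l, pd l (fun y => b y i j) x = pd j (fun y => b y i l) x)
    (hdet : (b x).det ≠ 0) (j : Fin (n+1)) : ∑ l, pd l (fun y => (b y).adjugate l j) x = 0 := by
  set N := (b x).adjugate with hN
  set D := (b x).det with hD
  -- matrices of derivatives
  have key : ∀ l, D • (Matrix.of fun p q => pd l (fun y => (b y).adjugate p q) x) =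
      (pd l (fun y => (b y).det) x) • N - N * (Matrix.of fun p q => pd l (fun y => b y p q) x) * N := by
    intro l
    have e1 : (Matrix.of fun p q => pd l (fun y => b y p q) x) * N + b x * (Matrix.of fun p q => pd l (fun y => (b y).adjugate p q) x)
        = (pd l (fun y => (b y).det) x) • (1 : Mt n) := by
      ext p q
      have a : HasDerivAt (fun s : ℝ => ((b (x + s • eb l)) * (b (x + s • eb l)).adjugate) p q)
          (∑ m, (pd l (fun y => b y p m) x * N m q + b x p m * pd l (fun y => (b y).adjugate m q) x)) 0 := by
        simp only [Matrix.mul_apply]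
        refine HasDerivAt.fun_sum fun m _ => ?_
        have := (pd_line ((hb p m).diff hx) l).fun_mul (pd_line ((Sm.adj hb m q).diff hx) l)
        simpa [hN] using this
      have c : HasDerivAt (fun s : ℝ => ((b (x + s • eb l)) * (b (x + s • eb l)).adjugate) p q)
          ((pd l (fun y => (b y).det) x) * (1 : Mt n) p q) 0 := by
        simp only [Matrix.mul_adjugate, Matrix.smul_apply, smul_eq_mul]
        exact (pd_line ((Sm.det hb).diff hx) l).mul_const _
      have := a.unique c
      simp only [Matrix.add_apply, Matrix.mul_apply, Matrix.of_apply, Matrix.smul_apply, smul_eq_mul]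
      rw [← this, Finset.sum_add_distrib]
    have e2 := congrArg (fun A => N * A) e1
    simp only [mul_add, ← mul_assoc] at e2
    rw [hN, Matrix.adjugate_mul, ← hN, ← hD] at e2
    simp only [Matrix.mul_smul, mul_one, Matrix.smul_mul, one_mul] at e2
    rw [← e2, add_sub_cancel_left]
  have k2 : ∀ l, D * pd l (fun y => (b y).adjugate l j) x = pd l (fun y => (b y).det) x * N l j
      - ∑ c, (∑ a, N l a * pd l (fun y => b y a c) x) * N c j := by
    intro l
    have := congrArg (fun A : Mt n => A l j) (key l)
    simpa [Matrix.mul_apply] using this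
  have k3 : D * ∑ l, pd l (fun y => (b y).adjugate l j) x = 0 := by
    rw [Finset.mul_sum]
    simp only [k2, Finset.sum_sub_distrib]
    rw [Finset.sum_comm (f := fun l c => (∑ a, N l a * pd l (fun y => b y a c) x) * N c j)]
    rw [sub_eq_zero]
    refine Finset.sum_congr rfl fun c _ => ?_
    rw [← Finset.sum_mul, pd_det hb hx]
    congr 1
    refine Finset.sum_congr rfl fun l _ => Finset.sum_congr rfl fun a _ => ?_
    rw [hsym a l c]
  exact (mul_eq_zero.1 k3).resolve_left hdet

lemma Sm.hm {n : ℕ} {F : Eu n → ℝ} (h : Sm F) (i j) : Sm (fun x => hm F x i j) := (h.pd i).pd j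

lemma ibp {n : ℕ} {U Z : Eu n → ℝ} (hU : Sm U) (hU1 : Hom1 U) (hZ : Sm Z) (hZ1 : Hom1 Z)
    (hpsd : ∀ x : Eu n, x ≠ 0 → (hm U x).PosSemidef) (τ : ℝ) (hτ : 0 ≤ τ) :
    ∫ x, (U x * ((1 + τ • hm U x).adjugate * hm Z x).trace - Z x * ((1 + τ • hm U x).adjugate * hm U x).trace) ∂(smu n) = 0 := by
  set B : Eu n → Mt n := fun x => 1 + τ • hm U x with hB
  have hBs : ∀ i j, Sm (fun x => B x i j) := fun i j => by
    have : ContDiffOn ℝ (⊤ : ℕ∞) (fun x => (1 : Mt n) i j + τ * hm U x i j) {0}ᶜ :=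
      contDiffOn_const.add (contDiffOn_const.mul (hU.hm i j))
    exact this
  have hdet : ∀ x : Eu n, x ≠ 0 → (B x).det ≠ 0 := fun x hx =>
    (lt_of_lt_of_le one_pos (det_one_add_ge _ ((hpsd x hx).smul hτ))).ne'
  have hpB : ∀ x : Eu n, x ≠ 0 → ∀ i j l, pd l (fun y => B y i j) x = τ * pd l (fun y => hm U y i j) x := by
    intro x hx i j l
    have : (fun y => B y i j) = fun y => (1 : Mt n) i j + τ * hm U y i j := rfl
    rw [this, pd, fderiv_const_add, fderiv_const_mul ((hU.hm i j).diff hx)]; rfl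
  have hPi : ∀ x : Eu n, x ≠ 0 → ∀ j, ∑ l, pd l (fun y => (B y).adjugate l j) x = 0 := fun x hx j =>
    piola hBs hx (fun i j l => by rw [hpB x hx, hpB x hx, pd_hm_symm hU hx]) (hdet x hx) j
  have hNs : ∀ x : Eu n, x ≠ 0 → ∀ i j, (B x).adjugate i j = (B x).adjugate j i := by
    intro x hx i j
    have : (B x).transpose = B x := by
      ext p q; simp only [hB, Matrix.transpose_apply, Matrix.add_apply, Matrix.smul_apply, smul_eq_mul, hm_symm hU hx p q]
      rw [Matrix.one_apply, Matrix.one_apply]; simp only [eq_comm]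
    have h2 := Matrix.adjugate_transpose (B x)
    rw [this] at h2
    exact congrArg (fun A : Mt n => A j i) h2
  have hNx : ∀ x : Eu n, x ≠ 0 → ∀ i, ∑ j, x j * (B x).adjugate j i = (B x).det * x i := by
    intro x hx i
    have h1 : (B x).mulVec (fun i => x i) = fun i => x i := by
      simp only [hB]
      rw [Matrix.add_mulVec, Matrix.one_mulVec, Matrix.smul_mulVec]
      have : (hm U x).mulVec (fun i => x i) = 0 := by ext i; exact hm_ker hU hU1 hx i
      rw [this]; simp
    have h2 := congrArg (fun v => (B x).adjugate.mulVec v) h1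
    simp only [Matrix.mulVec_mulVec, Matrix.adjugate_mul, Matrix.smul_mulVec, Matrix.one_mulVec] at h2
    have h3 := congrFun h2 i
    simp only [Pi.smul_apply, smul_eq_mul, Matrix.mulVec, dotProduct] at h3
    rw [h3]
    exact Finset.sum_congr rfl fun j _ => by rw [hNs x hx, mul_comm]
  set X : Fin (n+1) → Eu n → ℝ := fun j x => ∑ i, (B x).adjugate j i * (U x * pd i Z x - Z x * pd i U x) with hX
  have hXi : ∀ i, Sm (fun x => U x * pd i Z x - Z x * pd i U x) := fun i =>
    (ContDiffOn.mul hU (hZ.pd i)).sub (ContDiffOn.mul hZ (hU.pd i))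
  have hXs : ∀ j, Sm (X j) := fun j => ContDiffOn.sum fun i _ => ContDiffOn.mul (Sm.adj hBs j i) (hXi i)
  have h0 : ∀ x : Eu n, x ≠ 0 → ∑ j, x j * X j x = 0 := by
    intro x hx
    simp only [hX, Finset.mul_sum]
    rw [Finset.sum_comm]
    simp only [← mul_assoc, ← Finset.sum_mul, hNx x hx]
    have : ∑ i, (B x).det * x i * (U x * pd i Z x - Z x * pd i U x) =
      (B x).det * (U x * ∑ i, x i * pd i Z x - Z x * ∑ i, x i * pd i U x) := by
      simp only [Finset.mul_sum, ← Finset.sum_sub_distrib]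
      exact Finset.sum_congr rfl fun i _ => by ring
    rw [this, euler hU hU1 hx, euler hZ hZ1 hx]; ring
  rw [← div_int X (fun j => (hXs j).one) h0]
  refine integral_congr_ae ?_
  filter_upwards [smu_ae n] with x hx'
  have hx := sph_ne hx'
  have hpX : ∀ j, pd j (X j) x = ∑ i, (pd j (fun y => (B y).adjugate j i) x * (U x * pd i Z x - Z x * pd i U x)
      + (B x).adjugate j i * (pd j U x * pd i Z x + U x * hm Z x i j - (pd j Z x * pd i U x + Z x * hm U x i j))) := by
    intro j
    refine (pd_line ((hXs j).diff hx) j).unique ?_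
    simp only [hX]
    refine HasDerivAt.fun_sum fun i _ => ?_
    have a1 := pd_line ((Sm.adj hBs j i).diff hx) j
    have a2 := (pd_line (hU.diff hx) j).fun_mul (pd_line ((hZ.pd i).diff hx) j)
    have a3 := (pd_line (hZ.diff hx) j).fun_mul (pd_line ((hU.pd i).diff hx) j)
    have a4 := a1.fun_mul (a2.fun_sub a3)
    simpa [hm] using a4
  simp only [hpX]
  have split : ∀ i j, (pd j (fun y => (B y).adjugate j i) x * (U x * pd i Z x - Z x * pd i U x)
      + (B x).adjugate j i * (pd j U x * pd i Z x + U x * hm Z x i j - (pd j Z x * pd i U x + Z x * hm U x i j))) =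
      (U x * pd i Z x - Z x * pd i U x) * pd j (fun y => (B y).adjugate j i) x + U x * ((B x).adjugate j i * hm Z x i j)
      - Z x * ((B x).adjugate j i * hm U x i j) + (B x).adjugate j i * (pd j U x * pd i Z x) - (B x).adjugate j i * (pd j Z x * pd i U x) := by
    intro i j; ring
  simp only [split, Finset.sum_sub_distrib, Finset.sum_add_distrib]
  have c1 : ∑ j, ∑ i, (U x * pd i Z x - Z x * pd i U x) * pd j (fun y => (B y).adjugate j i) x = 0 := by
    rw [Finset.sum_comm]
    refine Finset.sum_eq_zero fun i _ => ?_
    rw [← Finset.mul_sum, hPi x hx, mul_zero]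
  have c2 : ∑ j, ∑ i, (B x).adjugate j i * (pd j U x * pd i Z x) = ∑ j, ∑ i, (B x).adjugate j i * (pd j Z x * pd i U x) := by
    rw [Finset.sum_comm]
    refine Finset.sum_congr rfl fun i _ => Finset.sum_congr rfl fun j _ => ?_
    rw [hNs x hx]; ring
  rw [c1, c2]
  simp only [← Finset.mul_sum, Matrix.trace, Matrix.diag_apply, Matrix.mul_apply]
  ring

def cc (n k : ℕ) (hk : k ≤ n) : ℕ → ℝ := (sg_interp n k hk).choose
lemma cc_spec (n k : ℕ) (hk : k ≤ n) (a : Mt n) :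
    sg n k a = ∑ j ∈ Finset.range (n+2), cc n k hk j * (1 + (j:ℝ) • a).det := (sg_interp n k hk).choose_spec a

def dsg (n k : ℕ) (hk : k ≤ n) (a h : Mt n) : ℝ :=
  ∑ j ∈ Finset.range (n+2), cc n k hk j * ((j:ℝ) * ((1 + (j:ℝ) • a).adjugate * h).trace)

lemma dsg_deriv {n k : ℕ} (hk : k ≤ n) (b : ℝ → Mt n) (b' : Mt n) (s : ℝ)
    (h : ∀ i j, HasDerivAt (fun t => b t i j) (b' i j) s) :
    HasDerivAt (fun t => sg n k (b t)) (dsg n k hk (b s) b') s := by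
  simp only [cc_spec n k hk, dsg]
  refine HasDerivAt.fun_sum fun j _ => HasDerivAt.const_mul _ ?_
  have := jacobi (fun t => 1 + (j:ℝ) • b t) ((j:ℝ) • b') s (fun p q => by
    simp only [Matrix.add_apply, Matrix.smul_apply, smul_eq_mul]
    exact ((h p q).const_mul _).const_add _)
  rw [Matrix.mul_smul, Matrix.trace_smul, smul_eq_mul] at this
  exact this

lemma dsg_self {n k : ℕ} (hk : k ≤ n) (a : Mt n) : dsg n k hk a a = k * sg n k a := by
  have h1 := dsg_deriv hk (fun t => t • a) a 1 (fun i j => by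
    simpa using (hasDerivAt_id (1:ℝ)).mul_const (a i j))
  simp only [sg_smul n k hk, one_smul] at h1
  have h2 := (hasDerivAt_pow k (1:ℝ)).mul_const (sg n k a)
  rw [h1.unique h2]; simp

lemma sg_cont {n k : ℕ} (hk : k ≤ n) : Continuous (sg n k) := by
  have : sg n k = fun a => _ := funext (cc_spec n k hk)
  rw [this]
  fun_prop

lemma sgC {X : Type*} [TopologicalSpace X] {S : Set X} {n k : ℕ} (hk : k ≤ n) {A : X → Mt n} (hA : ContinuousOn A S) :
    ContinuousOn (fun x => sg n k (A x)) S := (sg_cont hk).comp_continuousOn hA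

lemma trC0 {X : Type*} [TopologicalSpace X] {n : ℕ} (r : ℝ) {A B : X → Mt n} (hA : Continuous A)
    (hB : Continuous B) : Continuous (fun x => ((1 + r • A x).adjugate * B x).trace) := by
  have h1 : Continuous fun x => 1 + r • A x := continuous_const.add (hA.const_smul r)
  exact Continuous.matrix_trace (Continuous.matrix_mul (Continuous.matrix_adjugate h1) hB)

lemma trC {X : Type*} [TopologicalSpace X] {S : Set X} {n : ℕ} (r : ℝ) {A B : X → Mt n} (hA : ContinuousOn A S)
    (hB : ContinuousOn B S) : ContinuousOn (fun x => ((1 + r • A x).adjugate * B x).trace) S := by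
  rw [continuousOn_iff_continuous_domRestrict] at hA hB ⊢
  exact trC0 r hA hB

lemma dsgC {X : Type*} [TopologicalSpace X] {S : Set X} {n k : ℕ} (hk : k ≤ n) {A B : X → Mt n} (hA : ContinuousOn A S)
    (hB : ContinuousOn B S) : ContinuousOn (fun x => dsg n k hk (A x) (B x)) S := by
  unfold dsg
  exact continuousOn_finsetSum _ fun j _ => continuousOn_const.mul (continuousOn_const.mul (trC (j:ℝ) hA hB))

lemma homExt_lin {n : ℕ} (v w : Eu n → ℝ) (a b : ℝ) :
    homExt (fun x => a * v x + b * w x) = fun y => a * homExt v y + b * homExt w y := by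
  funext y; simp only [homExt]; ring

lemma Sm.lin {n : ℕ} {V W : Eu n → ℝ} (hV : Sm V) (hW : Sm W) (a b : ℝ) : Sm (fun y => a * V y + b * W y) :=
  (contDiffOn_const.mul hV).add (contDiffOn_const.mul hW)

lemma smooth_lin {n : ℕ} {v w : Eu n → ℝ} (hv : SmoothOnSphere v) (hw : SmoothOnSphere w) (a b : ℝ) :
    SmoothOnSphere (fun x => a * v x + b * w x) := by
  rw [SmoothOnSphere, homExt_lin]; exact Sm.lin hv hw a b

lemma pd_lin {n : ℕ} {V W : Eu n → ℝ} {x : Eu n} (hV : DifferentiableAt ℝ V x) (hW : DifferentiableAt ℝ W x) (a b : ℝ) (i) :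
    pd i (fun y => a * V y + b * W y) x = a * pd i V x + b * pd i W x := by
  have h : HasFDerivAt (fun y => a * V y + b * W y) (a • fderiv ℝ V x + b • fderiv ℝ W x) x :=
    (hV.hasFDerivAt.const_mul a).add (hW.hasFDerivAt.const_mul b)
  rw [pd, h.fderiv]; simp [pd]

lemma hm_lin {n : ℕ} {V W : Eu n → ℝ} (hV : Sm V) (hW : Sm W) (a b : ℝ) {x : Eu n} (hx : x ≠ 0) :
    hm (fun y => a * V y + b * W y) x = a • hm V x + b • hm W x := by
  ext i j
  simp only [hm, Matrix.add_apply, Matrix.smul_apply, smul_eq_mul]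
  rw [pd_congr j (fun y hy => pd_lin (hV.diff hy) (hW.diff hy) a b i) hx]
  exact pd_lin ((hV.pd i).diff hx) ((hW.pd i).diff hx) a b j

lemma inner_hess {n : ℕ} {u : Eu n → ℝ} (hu : SmoothOnSphere u) {x : Eu n} (hx : x ≠ 0) (v : Eu n) :
    ⟪v, hessOp u x v⟫ = (fun i => v i) ⬝ᵥ (hm (homExt u) x).mulVec (fun i => v i) := by
  rw [PiLp.inner_apply]
  simp only [dotProduct, Matrix.mulVec, hessOp_apply hu hx]
  exact Finset.sum_congr rfl fun i _ => by simp [mul_comm]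

lemma inner_hess_lin {n : ℕ} {v w : Eu n → ℝ} (hv : SmoothOnSphere v) (hw : SmoothOnSphere w) (a b : ℝ) {x : Eu n} (hx : x ≠ 0) (y : Eu n) :
    ⟪y, hessOp (fun x => a * v x + b * w x) x y⟫ = a * ⟪y, hessOp v x y⟫ + b * ⟪y, hessOp w x y⟫ := by
  rw [inner_hess (smooth_lin hv hw a b) hx, inner_hess hv hx, inner_hess hw hx, homExt_lin, hm_lin hv hw a b hx,
    Matrix.add_mulVec, Matrix.smul_mulVec, Matrix.smul_mulVec, dotProduct_add, dotProduct_smul, dotProduct_smul]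
  simp

lemma good_lin {n : ℕ} {v w : Eu n → ℝ} (hv : GoodSph v) (hw : GoodSph w) (a b : ℝ) (ha : 0 ≤ a) (hb : 0 ≤ b) (hab : 0 < a + b) :
    GoodSph (fun x => a * v x + b * w x) := by
  have gen : ∀ p q : ℝ, 0 < p → 0 < q → 0 < a * p + b * q := by
    intro p q hp hq
    rcases ha.eq_or_lt with h | h
    · subst h; have : 0 < b := by linarith
      simp; positivity
    · have := mul_pos h hp; have := mul_nonneg hb hq.le; linarith
  refine ⟨smooth_lin hv.1 hw.1 a b, fun x hx => gen _ _ (hv.2.1 x hx) (hw.2.1 x hx), fun x hx y hy hy0 => ?_⟩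
  rw [inner_hess_lin hv.1 hw.1 a b (sph_ne hx)]
  exact gen _ _ (hv.2.2 x hx y hy hy0) (hw.2.2 x hx y hy hy0)

/-- functional `M` -/
def Mf (n k : ℕ) (v : Eu n → ℝ) : ℝ := ∫ x, v x * sigmaK n k v x ∂(smu n)

lemma hm_contOn {n : ℕ} {F : Eu n → ℝ} (h : Sm F) : ContinuousOn (hm F) (sph n) := by
  refine continuousOn_pi.2 fun i => continuousOn_pi.2 fun j => (h.hm i j).contOn

lemma sig_contOn {n k : ℕ} (hk : k ≤ n) {u : Eu n → ℝ} (hu : SmoothOnSphere u) : ContinuousOn (sigmaK n k u) (sph n) := by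
  refine (sgC hk (hm_contOn hu)).congr fun x hx => sigmaK_eq k hu (sph_ne hx)

lemma u_contOn {n : ℕ} {u : Eu n → ℝ} (hu : SmoothOnSphere u) : ContinuousOn u (sph n) :=
  (Sm.contOn hu).congr fun x hx => (homExt_sph u hx).symm

lemma dui {n : ℕ} (g g' : ℝ → Eu n → ℝ) (s₀ : ℝ)
    (hg : ∀ s, ContinuousOn (g s) (sph n)) (hg' : ContinuousOn (fun p : ℝ × Eu n => g' p.1 p.2) (Set.univ ×ˢ sph n))
    (hd : ∀ x ∈ sph n, ∀ s, HasDerivAt (fun s => g s x) (g' s x) s) :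
    HasDerivAt (fun s => ∫ x, g s x ∂(smu n)) (∫ x, g' s₀ x ∂(smu n)) s₀ := by
  obtain ⟨C, hC⟩ := ((isCompact_Icc (a := s₀ - 1) (b := s₀ + 1)).prod (sph_compact n)).exists_bound_of_continuousOn
    (hg'.mono (Set.prod_mono (Set.subset_univ _) subset_rfl))
  have hs : ∀ s, ContinuousOn (g' s) (sph n) := fun s =>
    hg'.comp (f := fun x => (s, x)) (by fun_prop) (fun x hx => ⟨Set.mem_univ _, hx⟩)
  refine (hasDerivAt_integral_of_dominated_loc_of_deriv_le (μ := smu n) (s := Set.Icc (s₀ - 1) (s₀ + 1)) (x₀ := s₀)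
    (F := g) (F' := g') (bound := fun _ => C) (Icc_mem_nhds (by linarith) (by linarith))
    (Filter.Eventually.of_forall fun s => (cont_int (hg s)).1) (cont_int (hg s₀)) (cont_int (hs s₀)).1 ?_ (integrable_const _) ?_).2
  · filter_upwards [smu_ae n] with x hx s hs using hC (s, x) ⟨hs, hx⟩
  · filter_upwards [smu_ae n] with x hx s _ using hd x hx s

lemma ibp_sig {n k : ℕ} (hk : k ≤ n) {v z : Eu n → ℝ} (hv : GoodSph v) (hz : SmoothOnSphere z) :
    ∫ x, v x * dsg n k hk (hm (homExt v) x) (hm (homExt z) x) ∂(smu n) = k * ∫ x, z x * sigmaK n k v x ∂(smu n) := by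
  have hc : ∀ j : ℕ, ∀ w y : Eu n → ℝ, SmoothOnSphere w → SmoothOnSphere y → Integrable (fun x => w x * ((1 + (j:ℝ) • hm (homExt v) x).adjugate * hm (homExt y) x).trace) (smu n) := by
    intro j w y hw hy
    refine cont_int ((u_contOn hw).mul ?_)
    have hA := hm_contOn (F := homExt v) hv.1
    have hB := hm_contOn (F := homExt y) hy
    exact trC (j:ℝ) hA hB
  have hj : ∀ j : ℕ, ∫ x, v x * ((1 + (j:ℝ) • hm (homExt v) x).adjugate * hm (homExt z) x).trace ∂(smu n) =
      ∫ x, z x * ((1 + (j:ℝ) • hm (homExt v) x).adjugate * hm (homExt v) x).trace ∂(smu n) := by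
    intro j
    have h1 := ibp (U := homExt v) (Z := homExt z) hv.1 (homExt_hom v) hz (homExt_hom z) (fun x hx => good_psd' hv hx) (j:ℝ) (Nat.cast_nonneg j)
    rw [← sub_eq_zero, ← integral_sub (hc j v z hv.1 hz) (hc j z v hz hv.1), ← h1]
    refine integral_congr_ae ?_
    filter_upwards [smu_ae n] with x hx
    rw [homExt_sph v hx, homExt_sph z hx]
  have e1 : ∀ w y : Eu n → ℝ, SmoothOnSphere w → SmoothOnSphere y →
      ∫ x, w x * dsg n k hk (hm (homExt v) x) (hm (homExt y) x) ∂(smu n) =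
      ∑ j ∈ Finset.range (n+2), cc n k hk j * ((j:ℝ) * ∫ x, w x * ((1 + (j:ℝ) • hm (homExt v) x).adjugate * hm (homExt y) x).trace ∂(smu n)) := by
    intro w y hw hy
    have : ∀ x, w x * dsg n k hk (hm (homExt v) x) (hm (homExt y) x) =
      ∑ j ∈ Finset.range (n+2), (cc n k hk j * (j:ℝ)) * (w x * ((1 + (j:ℝ) • hm (homExt v) x).adjugate * hm (homExt y) x).trace) := by
      intro x; rw [dsg, Finset.mul_sum]; exact Finset.sum_congr rfl fun j _ => by ring
    simp only [this]
    rw [integral_finsetSum _ fun j _ => (hc j w y hw hy).const_mul _]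
    refine Finset.sum_congr rfl fun j _ => ?_
    rw [integral_const_mul]; ring
  rw [e1 v z hv.1 hz]
  simp only [hj]
  rw [← e1 z v hz hv.1, ← integral_const_mul]
  refine integral_congr_ae ?_
  filter_upwards [smu_ae n] with x hx
  rw [dsg_self, sigmaK_eq k hv.1 (sph_ne hx)]; ring

lemma M_deriv {n k : ℕ} (hk : k ≤ n) {v z : Eu n → ℝ} (hv : SmoothOnSphere v) (hz : SmoothOnSphere z) (s₀ : ℝ)
    (hg : GoodSph (fun x => 1 * v x + s₀ * z x)) :
    HasDerivAt (fun s => Mf n k (fun x => 1 * v x + s * z x))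
      ((k+1) * ∫ x, z x * sigmaK n k (fun x => 1 * v x + s₀ * z x) x ∂(smu n)) s₀ := by
  have hA := hm_contOn (F := homExt v) hv
  have hB := hm_contOn (F := homExt z) hz
  set b : ℝ → Eu n → Mt n := fun s x => (1:ℝ) • hm (homExt v) x + s • hm (homExt z) x with hb
  have hsig : ∀ s x, x ∈ sph n → sigmaK n k (fun x => 1 * v x + s * z x) x = sg n k (b s x) := by
    intro s x hx
    rw [sigmaK_eq k (smooth_lin hv hz 1 s) (sph_ne hx), homExt_lin, hm_lin hv hz 1 s (sph_ne hx)]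
  have hbj : ContinuousOn (fun p : ℝ × Eu n => b p.1 p.2) (Set.univ ×ˢ sph n) := by
    have h2 : ∀ F : Eu n → Mt n, ContinuousOn F (sph n) → ContinuousOn (fun p : ℝ × Eu n => F p.2) (Set.univ ×ˢ sph n) := fun F hF =>
      hF.comp continuousOn_snd (fun p hp => hp.2)
    exact ((h2 _ hA).const_smul (1:ℝ)).add (continuousOn_fst.smul (h2 _ hB))
  have hscal : ∀ F : Eu n → ℝ, ContinuousOn F (sph n) → ContinuousOn (fun p : ℝ × Eu n => F p.2) (Set.univ ×ˢ sph n) := fun F hF =>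
      hF.comp continuousOn_snd (fun p hp => hp.2)
  have hvj : ContinuousOn (fun p : ℝ × Eu n => 1 * v p.2 + p.1 * z p.2) (Set.univ ×ˢ sph n) :=
    (continuousOn_const.mul (hscal _ (u_contOn hv))).add (continuousOn_fst.mul (hscal _ (u_contOn hz)))
  have hBj : ContinuousOn (fun p : ℝ × Eu n => hm (homExt z) p.2) (Set.univ ×ˢ sph n) := hB.comp continuousOn_snd (fun p hp => hp.2)
  have key := dui (fun s x => (1 * v x + s * z x) * sg n k (b s x))
    (fun s x => z x * sg n k (b s x) + (1 * v x + s * z x) * dsg n k hk (b s x) (hm (homExt z) x)) s₀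
    (fun s => by
      have : ContinuousOn (b s) (sph n) := (hA.const_smul (1:ℝ)).add (hB.const_smul s)
      exact ((continuousOn_const.mul (u_contOn hv)).add (continuousOn_const.mul (u_contOn hz))).mul (sgC hk this))
    (((hscal _ (u_contOn hz)).mul (sgC hk hbj)).add
      (hvj.mul (dsgC hk hbj hBj)))
    (fun x hx s => by
      have h1 : HasDerivAt (fun s => 1 * v x + s * z x) (z x) s := by
        simpa using ((hasDerivAt_id s).mul_const (z x)).const_add (1 * v x)
      have h2 := dsg_deriv hk (fun s => b s x) (hm (homExt z) x) s (fun i j => by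
        simp only [hb, Matrix.add_apply, Matrix.smul_apply, smul_eq_mul]
        simpa using ((hasDerivAt_id s).mul_const (hm (homExt z) x i j)).const_add (1 * hm (homExt v) x i j))
      exact h1.mul h2)
  have e : (fun s => Mf n k (fun x => 1 * v x + s * z x)) = fun s => ∫ x, (1 * v x + s * z x) * sg n k (b s x) ∂(smu n) := by
    funext s
    refine integral_congr_ae ?_
    filter_upwards [smu_ae n] with x hx
    rw [hsig s x hx]
  rw [e]
  convert key using 1
  have hbs : ContinuousOn (b s₀) (sph n) := (hA.const_smul (1:ℝ)).add (hB.const_smul s₀)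
  rw [integral_add]
  · have h3 := ibp_sig hk hg hz
    have h4 : ∫ x, (1 * v x + s₀ * z x) * dsg n k hk (b s₀ x) (hm (homExt z) x) ∂(smu n) =
        ∫ x, (1 * v x + s₀ * z x) * dsg n k hk (hm (homExt (fun x => 1 * v x + s₀ * z x)) x) (hm (homExt z) x) ∂(smu n) := by
      refine integral_congr_ae ?_
      filter_upwards [smu_ae n] with x hx
      rw [homExt_lin, hm_lin hv hz 1 s₀ (sph_ne hx)]
    rw [h4, h3]
    have h5 : ∫ x, z x * sg n k (b s₀ x) ∂(smu n) = ∫ x, z x * sigmaK n k (fun x => 1 * v x + s₀ * z x) x ∂(smu n) := by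
      refine integral_congr_ae ?_
      filter_upwards [smu_ae n] with x hx
      rw [hsig s₀ x hx]
    rw [h5]; ring
  · exact cont_int ((u_contOn hz).mul (sgC hk hbs))
  · exact cont_int (((continuousOn_const.mul (u_contOn hv)).add (continuousOn_const.mul (u_contOn hz))).mul
      (dsgC hk hbs hB))

lemma sig_smul {n k : ℕ} (hk : k ≤ n) {v : Eu n → ℝ} (hv : SmoothOnSphere v) (r : ℝ) {x : Eu n} (hx : x ∈ sph n) :
    sigmaK n k (fun x => r * v x) x = r ^ k * sigmaK n k v x := by
  have e : (fun x => r * v x) = fun x => r * v x + 0 * v x := by funext x; ring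
  rw [e, sigmaK_eq k (smooth_lin hv hv r 0) (sph_ne hx), homExt_lin, hm_lin hv hv r 0 (sph_ne hx), sigmaK_eq k hv (sph_ne hx),
    ← sg_smul n k hk, zero_smul, add_zero]

lemma good_smul {n : ℕ} {v : Eu n → ℝ} (hv : GoodSph v) (r : ℝ) (hr : 0 < r) : GoodSph (fun x => r * v x) := by
  have e : (fun x => r * v x) = fun x => r * v x + 0 * v x := by funext x; ring
  rw [e]; exact good_lin hv hv r 0 hr.le le_rfl (by linarith)

lemma M_smul {n k : ℕ} (hk : k ≤ n) {v : Eu n → ℝ} (hv : SmoothOnSphere v) (r : ℝ) :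
    Mf n k (fun x => r * v x) = r ^ (k+1) * Mf n k v := by
  rw [Mf, Mf, ← integral_const_mul]
  refine integral_congr_ae ?_
  filter_upwards [smu_ae n] with x hx
  rw [sig_smul hk hv r hx]; ring

lemma M_mono {n k : ℕ} (hk : k ≤ n) {v w : Eu n → ℝ} (hv : GoodSph v) (hw : GoodSph w) (h : ∀ x ∈ sph n, v x ≤ w x) :
    Mf n k v ≤ Mf n k w := by
  set z : Eu n → ℝ := fun x => 1 * w x + (-1) * v x with hz
  have hzs : SmoothOnSphere z := smooth_lin hw.1 hv.1 1 (-1)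
  have hgood : ∀ s ∈ Set.Icc (0:ℝ) 1, GoodSph (fun x => 1 * v x + s * z x) := by
    intro s hs
    have : (fun x => 1 * v x + s * z x) = fun x => (1 - s) * v x + s * w x := by
      funext x; simp only [hz]; ring
    rw [this]; exact good_lin hv hw _ _ (by linarith [hs.2]) hs.1 (by linarith)
  have hd : ∀ s ∈ Set.Icc (0:ℝ) 1, HasDerivAt (fun s => Mf n k (fun x => 1 * v x + s * z x))
      ((k+1) * ∫ x, z x * sigmaK n k (fun x => 1 * v x + s * z x) x ∂(smu n)) s := fun s hs =>
    M_deriv hk hv.1 hzs s (hgood s hs)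
  have hmono : MonotoneOn (fun s => Mf n k (fun x => 1 * v x + s * z x)) (Set.Icc (0:ℝ) 1) := by
    refine monotoneOn_of_deriv_nonneg (convex_Icc 0 1) (fun s hs => (hd s hs).continuousAt.continuousWithinAt)
      (fun s hs => (hd s (interior_subset hs)).differentiableAt.differentiableWithinAt) (fun s hs => ?_)
    rw [(hd s (interior_subset hs)).deriv]
    refine mul_nonneg (by positivity) (integral_nonneg_of_ae ?_)
    filter_upwards [smu_ae n] with x hx
    have h1 := good_sig_pos hk (hgood s (interior_subset hs)) hx
    have h2 : 0 ≤ z x := by simp only [hz]; linarith [h x hx]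
    exact mul_nonneg h2 h1.le
  have := hmono (Set.left_mem_Icc.2 zero_le_one) (Set.right_mem_Icc.2 zero_le_one) zero_le_one
  have e0 : (fun x => 1 * v x + 0 * z x) = v := by funext x; ring
  have e1 : (fun x => 1 * v x + 1 * z x) = w := by funext x; simp only [hz]; ring
  simpa only [e0, e1] using this

lemma int_pos {n : ℕ} {g : Eu n → ℝ} (hg : ContinuousOn g (sph n)) (hp : ∀ x ∈ sph n, 0 < g x) : 0 < ∫ x, g x ∂(smu n) := by
  have hne : ∀ᵐ x ∂(smu n), 0 < g x := by filter_upwards [smu_ae n] with x hx using hp x hx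
  rw [integral_pos_iff_support_of_nonneg_ae (hne.mono fun x hx => hx.le) (cont_int hg)]
  have : Function.support g =ᵐ[smu n] Set.univ := by
    filter_upwards [hne] with x hx
    exact propext ⟨fun _ => trivial, fun _ => hx.ne'⟩
  rw [measure_congr this, smu, Measure.restrict_apply_univ]
  exact sph_pos n

lemma M_pos {n k : ℕ} (hk : k ≤ n) {v : Eu n → ℝ} (hv : GoodSph v) : 0 < Mf n k v :=
  int_pos ((u_contOn hv.1).mul (sig_contOn hk hv.1)) fun x hx => mul_pos (hv.2.1 x hx) (good_sig_pos hk hv hx)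

lemma maxP {X : Type*} [TopologicalSpace X] (K : Set X) (hK : IsCompact K) (a b : ℝ) (hab : a ≤ b)
    (ψ ψ' : ℝ → X → ℝ) (C m : ℝ) (hc : ContinuousOn (fun p : ℝ × X => ψ p.1 p.2) (Set.Icc a b ×ˢ K))
    (hd : ∀ z ∈ K, ∀ t ∈ Set.Icc a b, HasDerivWithinAt (fun t => ψ t z) (ψ' t z) (Set.Icc a b) t)
    (hmx : ∀ t ∈ Set.Ioc a b, ∀ z ∈ K, (∀ y ∈ K, ψ t y ≤ ψ t z) → ψ' t z ≤ C)
    (h0 : ∀ z ∈ K, ψ a z ≤ m) : ∀ z ∈ K, ψ b z ≤ m + C * (b - a) := by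
  intro z hz
  refine le_of_forall_pos_le_add fun e he => ?_
  obtain ⟨ε, hε, hεe⟩ : ∃ ε > 0, ε * (b - a) ≤ e := by
    refine ⟨e / (b - a + 1), by have : 0 < b - a + 1 := by linarith
                                positivity, ?_⟩
    have : 0 < b - a + 1 := by linarith
    rw [div_mul_eq_mul_div, div_le_iff₀ this]; nlinarith
  have hcc : ContinuousOn (fun p : ℝ × X => ψ p.1 p.2 - (C + ε) * (p.1 - a)) (Set.Icc a b ×ˢ K) :=
    hc.sub (by fun_prop)
  obtain ⟨⟨ts, zs⟩, ⟨hts, hzs⟩, hmax⟩ := (isCompact_Icc.prod hK).exists_isMaxOn (f := fun p : ℝ × X => ψ p.1 p.2 - (C + ε) * (p.1 - a))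
    ⟨(a, z), ⟨Set.left_mem_Icc.2 hab, hz⟩⟩ hcc
  simp only at hts hzs
  have hM : ∀ t ∈ Set.Icc a b, ∀ y ∈ K, ψ t y - (C + ε) * (t - a) ≤ ψ ts zs - (C + ε) * (ts - a) := fun t ht y hy =>
    hmax (show (t, y) ∈ Set.Icc a b ×ˢ K from ⟨ht, hy⟩)
  rcases hts.1.eq_or_lt with h | h
  · have h1 := hM b (Set.right_mem_Icc.2 hab) z hz
    have h2 := h0 zs hzs
    rw [← h] at h1
    nlinarith
  · exfalso
    have h1 := hmx ts ⟨h, hts.2⟩ zs hzs (fun y hy => by linarith [hM ts hts y hy])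
    have hg : HasDerivWithinAt (fun t => ψ t zs - (C + ε) * (t - a)) (ψ' ts zs - (C + ε)) (Set.Icc a b) ts := by
      have : HasDerivWithinAt (fun t : ℝ => (C + ε) * (t - a)) (C + ε) (Set.Icc a b) ts := by
        simpa using (((hasDerivAt_id ts).sub_const a).const_mul (C + ε)).hasDerivWithinAt
      exact (hd zs hzs ts hts).sub this
    have hmo : IsLocalMaxOn (fun t => ψ t zs - (C + ε) * (t - a)) (Set.Icc a b) ts :=
      IsMaxOn.localize fun t ht => hM t ht zs hzs
    have h3 := hmo.hasFDerivWithinAt_nonpos hg.hasFDerivWithinAt (y := a - ts) (by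
      refine mem_posTangentConeAt_of_segment_subset ?_
      simp only [add_sub_cancel]
      exact (convex_Icc a b).segment_subset hts (Set.left_mem_Icc.2 hab))
    simp at h3
    nlinarith

lemma line1 {n : ℕ} {F : Eu n → ℝ} (h : Sm F) (x e : Eu n) (s : ℝ) (hs : x + s • e ≠ 0) :
    HasDerivAt (fun s : ℝ => F (x + s • e)) (∑ i, e i * pd i F (x + s • e)) s := by
  rw [← fderiv_pd]
  have hr : HasDerivAt (fun s : ℝ => x + s • e) e s := by
    simpa using ((hasDerivAt_id s).smul_const e).const_add x
  exact (h.diff hs).hasFDerivAt.comp_hasDerivAt s hr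

lemma line2 {n : ℕ} {F : Eu n → ℝ} (h : Sm F) (x e : Eu n) (s : ℝ) (hs : x + s • e ≠ 0) :
    HasDerivAt (fun s : ℝ => ∑ i, e i * pd i F (x + s • e)) ((fun i => e i) ⬝ᵥ (hm F (x + s • e)).mulVec (fun i => e i)) s := by
  have : (fun i => e i) ⬝ᵥ (hm F (x + s • e)).mulVec (fun i => e i) = ∑ i, e i * ∑ j, e j * pd j (pd i F) (x + s • e) := by
    simp only [dotProduct, Matrix.mulVec, hm]
    exact Finset.sum_congr rfl fun i _ => by congr 1; exact Finset.sum_congr rfl fun j _ => mul_comm _ _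
  rw [this]
  exact HasDerivAt.fun_sum fun i _ => (line1 (h.pd i) x e s hs).const_mul _

lemma min_psd {n : ℕ} {W : Eu n → ℝ} (h : Sm W) {x : Eu n} (hx : x ≠ 0) (hW : ∀ y, y ≠ 0 → 0 ≤ W y) (hWx : W x = 0) :
    (hm W x).PosSemidef := by
  refine Matrix.posSemidef_iff_dotProduct_mulVec.2 ⟨?_, fun v => ?_⟩
  · ext i j
    simp only [Matrix.conjTranspose_apply, star_trivial]
    exact hm_symm h hx j i
  · simp only [star_trivial]
    by_contra hneg
    push Not at hneg
    set e : Eu n := WithLp.toLp 2 v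
    have hev : (0:ℝ) ≠ 1 := by norm_num
    have hne : ∀ᶠ s : ℝ in 𝓝 0, x + s • e ≠ 0 := by
      have : ContinuousAt (fun s : ℝ => x + s • e) 0 := by fun_prop
      exact this.eventually_ne (by simpa using hx)
    have hx' : x + (0:ℝ) • e ≠ 0 := by simpa using hx
    set φ : ℝ → ℝ := fun s => W (x + s • e) with hφ
    have d1 : deriv φ =ᶠ[𝓝 0] fun s => ∑ i, e i * pd i W (x + s • e) := by
      filter_upwards [hne] with s hs using (line1 h x e s hs).deriv
    have d2 : deriv (deriv φ) 0 = v ⬝ᵥ (hm W x).mulVec v := by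
      rw [d1.deriv_eq, (line2 h x e 0 hx').deriv]; simp [e]
    have hmin : IsLocalMin φ 0 := by
      filter_upwards [hne] with s hs
      simpa [hφ, hWx] using hW _ hs
    have hd0 : deriv φ 0 = 0 := hmin.deriv_eq_zero
    have hcont : ContinuousAt φ 0 := (line1 h x e 0 hx').continuousAt
    have e1 : deriv (fun s => - φ s) = fun s => - deriv φ s := by funext s; exact deriv.fun_neg
    have hmin2 : IsLocalMin (fun s => - φ s) 0 := by
      refine isLocalMin_of_deriv_deriv_pos ?_ ?_ hcont.neg
      · rw [e1, deriv.fun_neg, d2]; linarith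
      · rw [e1]; simp [hd0]
    have hc : φ =ᶠ[𝓝 0] fun _ => φ 0 := by
      filter_upwards [hmin, hmin2] with s h1 h2
      linarith
    have : deriv (deriv φ) 0 = 0 := by
      have h3 : deriv φ =ᶠ[𝓝 0] deriv (fun _ => φ 0) := hc.deriv
      rw [h3.deriv_eq]; simp
    rw [d2] at this
    linarith

lemma hom_nonneg {n : ℕ} {W : Eu n → ℝ} (h1 : Hom1 W) (h : ∀ x ∈ sph n, 0 ≤ W x) : ∀ y, y ≠ 0 → 0 ≤ W y := by
  intro y hy
  have hp : 0 < ‖y‖ := norm_pos_iff.2 hy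
  have : y = ‖y‖ • (‖y‖⁻¹ • y) := by rw [smul_smul, mul_inv_cancel₀ hp.ne', one_smul]
  rw [this, h1 _ hp]
  exact mul_nonneg hp.le (h _ (nrm_mem hy))

lemma touch {n k : ℕ} (hk : k ≤ n) {v b : Eu n → ℝ} (hv : GoodSph v) (hb : GoodSph b) (r : ℝ)
    (hle : ∀ y ∈ sph n, v y ≤ r * b y) {x : Eu n} (hx : x ∈ sph n) (heq : v x = r * b x) :
    sigmaK n k v x ≤ r ^ k * sigmaK n k b x := by
  have hx0 := sph_ne hx
  have hW : Sm (fun y => r * homExt b y + (-1) * homExt v y) := Sm.lin hb.1 hv.1 r (-1)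
  have hW1 : Hom1 (fun y => r * homExt b y + (-1) * homExt v y) := by
    intro t ht y
    simp only [homExt_hom b t ht y, homExt_hom v t ht y]; ring
  have h := min_psd hW hx0 (hom_nonneg hW1 (fun y hy => by
    rw [homExt_sph b hy, homExt_sph v hy]; linarith [hle y hy])) (by rw [homExt_sph b hx, homExt_sph v hx]; linarith)
  rw [hm_lin hb.1 hv.1 r (-1) hx0] at h
  rw [sigmaK_eq k hv.1 hx0, sigmaK_eq k hb.1 hx0, ← sg_smul n k hk]
  refine sg_mono n k hk _ _ (good_psd hv hx) ?_
  convert h using 1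
  rw [neg_one_smul, sub_eq_add_neg]

lemma supp_ineq {n : ℕ} {u : Eu n → ℝ} (hu : GoodSph u) {x : Eu n} (hx : x ≠ 0) (y : Eu n) (hnn : ∀ z : Eu n, 0 ≤ homExt u z) :
    ∑ i, y i * pd i (homExt u) x ≤ homExt u y := by
  have hS : Sm (homExt u) := hu.1
  by_cases hseg : ∀ s ∈ Set.Icc (0:ℝ) 1, x + s • (y - x) ≠ 0
  · set e := y - x with he
    have hmono : MonotoneOn (fun s : ℝ => ∑ i, e i * pd i (homExt u) (x + s • e)) (Set.Icc 0 1) := by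
      refine monotoneOn_of_deriv_nonneg (convex_Icc 0 1) (fun s hs => (line2 hS x e s (hseg s hs)).continuousAt.continuousWithinAt)
        (fun s hs => (line2 hS x e s (hseg s (interior_subset hs))).differentiableAt.differentiableWithinAt) (fun s hs => ?_)
      rw [(line2 hS x e s (hseg s (interior_subset hs))).deriv]
      have := (good_psd' hu (hseg s (interior_subset hs))).dotProduct_mulVec_nonneg (fun i => e i)
      simpa using this
    obtain ⟨c, hc, hc2⟩ := exists_hasDerivAt_eq_slope (fun s : ℝ => homExt u (x + s • e)) (fun s => ∑ i, e i * pd i (homExt u) (x + s • e)) zero_lt_one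
      (fun s hs => (line1 hS x e s (hseg s hs)).continuousAt.continuousWithinAt)
      (fun s hs => line1 hS x e s (hseg s (Set.Ioo_subset_Icc_self hs)))
    have h1 := hmono (Set.left_mem_Icc.2 zero_le_one) (Set.Ioo_subset_Icc_self hc) hc.1.le
    simp only at h1
    rw [hc2] at h1
    simp only [zero_smul, add_zero, one_smul, sub_zero, div_one, he, add_sub_cancel, PiLp.sub_apply, sub_mul, Finset.sum_sub_distrib] at h1
    rw [euler hS (homExt_hom u) hx] at h1
    linarith
  · push Not at hseg
    obtain ⟨s, hs, h0⟩ := hseg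
    have hs0 : s ≠ 0 := by
      rintro rfl; simp at h0; exact hx h0
    have hsp : 0 < s := lt_of_le_of_ne hs.1 hs0.symm
    have hy : ∀ i, y i = -((1 - s) / s) * x i := by
      intro i
      have := congrArg (fun z : Eu n => z i) h0
      simp at this
      field_simp
      linarith
    have : ∑ i, y i * pd i (homExt u) x = -((1 - s) / s) * ∑ i, x i * pd i (homExt u) x := by
      rw [Finset.mul_sum]; exact Finset.sum_congr rfl fun i _ => by rw [hy i]; ring
    rw [this, euler hS (homExt_hom u) hx]
    have h2 : 0 ≤ (1 - s) / s := div_nonneg (by linarith [hs.2]) hs.1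
    have := mul_nonneg h2 (hnn x)
    linarith [hnn y]

lemma homExt_nonneg {n : ℕ} {u : Eu n → ℝ} (hu : GoodSph u) (z : Eu n) : 0 ≤ homExt u z := by
  by_cases hz : z = 0
  · simp [homExt, hz]
  · exact mul_nonneg (norm_nonneg _) (hu.2.1 _ (nrm_mem hz)).le

lemma subadd {n : ℕ} {u : Eu n → ℝ} (hu : GoodSph u) (y z : Eu n) : homExt u (y + z) ≤ homExt u y + homExt u z := by
  have hnn := homExt_nonneg hu
  by_cases h : y + z = 0
  · rw [h]; have : homExt u 0 = 0 := by simp [homExt]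
    rw [this]; linarith [hnn y, hnn z]
  · have h1 := supp_ineq hu h y hnn
    have h2 := supp_ineq hu h z hnn
    rw [← euler hu.1 (homExt_hom u) h]
    simp only [PiLp.add_apply, add_mul, Finset.sum_add_distrib]
    linarith

lemma eb_sph {n : ℕ} (i : Fin (n+1)) : (eb i : Eu n) ∈ sph n := by rw [mem_sph]; simp [eb]
lemma neb_sph {n : ℕ} (i : Fin (n+1)) : -(eb i : Eu n) ∈ sph n := by rw [mem_sph]; simp [eb]

lemma equiLip {n : ℕ} {u : Eu n → ℝ} (hu : GoodSph u) {y z : Eu n} (hy : y ∈ sph n) (hz : z ∈ sph n) :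
    |u y - u z| ≤ ‖y - z‖ * ∑ i, (u (eb i) + u (-eb i)) := by
  have hnn := homExt_nonneg hu
  have fin : ∀ (s : Finset (Fin (n+1))) (w : Fin (n+1) → Eu n), homExt u (∑ i ∈ s, w i) ≤ ∑ i ∈ s, homExt u (w i) := by
    intro s w
    induction s using Finset.induction_on with
    | empty => simp [homExt]
    | insert a s ha ih => rw [Finset.sum_insert ha, Finset.sum_insert ha]; linarith [subadd hu (w a) (∑ i ∈ s, w i)]
  have one : ∀ (r : ℝ) (i : Fin (n+1)), homExt u (r • eb i) ≤ |r| * (u (eb i) + u (-eb i)) := by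
    intro r i
    have p1 := (hu.2.1 _ (eb_sph i)).le
    have p2 := (hu.2.1 _ (neb_sph i)).le
    rcases lt_trichotomy r 0 with h | h | h
    · have : r • (eb i : Eu n) = (-r) • (-eb i) := by simp
      rw [this, homExt_hom u _ (by linarith), homExt_sph u (neb_sph i), abs_of_neg h]
      nlinarith
    · subst h; simp [homExt]
    · rw [homExt_hom u _ h, homExt_sph u (eb_sph i), abs_of_pos h]; nlinarith
  have bd : ∀ w : Eu n, homExt u w ≤ ‖w‖ * ∑ i, (u (eb i) + u (-eb i)) := by
    intro w
    conv_lhs => rw [← sum_eb w]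
    refine (fin _ _).trans ?_
    rw [Finset.mul_sum]
    refine Finset.sum_le_sum fun i _ => (one _ i).trans ?_
    have p1 := (hu.2.1 _ (eb_sph i)).le
    have p2 := (hu.2.1 _ (neb_sph i)).le
    exact mul_le_mul_of_nonneg_right (by simpa using PiLp.norm_apply_le w i) (by linarith)
  have half : ∀ y z : Eu n, y ∈ sph n → z ∈ sph n → u y - u z ≤ ‖y - z‖ * ∑ i, (u (eb i) + u (-eb i)) := by
    intro y z hy hz
    have h1 := subadd hu z (y - z)
    rw [add_sub_cancel, homExt_sph u hy, homExt_sph u hz] at h1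
    linarith [bd (y - z)]
  rw [abs_le]
  constructor
  · have := half z y hz hy
    rw [norm_sub_rev] at this; linarith
  · exact half y z hy hz

lemma joint_cont {n : ℕ} (u : ℝ → Eu n → ℝ) (S : Set ℝ) (hg : ∀ t ∈ S, GoodSph (u t))
    (hc : ∀ x ∈ sph n, ContinuousOn (fun t => u t x) S) :
    ContinuousOn (fun p : ℝ × Eu n => u p.1 p.2) (S ×ˢ sph n) := by
  rintro ⟨t, x⟩ ⟨ht, hx⟩
  simp only at ht hx
  set L : ℝ → ℝ := fun t => ∑ i, (u t (eb i) + u t (-eb i)) with hL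
  have hLc : ContinuousOn L S := continuousOn_finsetSum _ fun i _ => (hc _ (eb_sph i)).add (hc _ (neb_sph i))
  have t1 : Tendsto (fun p : ℝ × Eu n => u p.1 x) (𝓝[S ×ˢ sph n] (t, x)) (𝓝 (u t x)) := by
    have : ContinuousOn (fun p : ℝ × Eu n => u p.1 x) (S ×ˢ sph n) := (hc x hx).comp continuousOn_fst (fun p hp => hp.1)
    exact this (t, x) ⟨ht, hx⟩
  have t2 : Tendsto (fun p : ℝ × Eu n => ‖p.2 - x‖ * L p.1) (𝓝[S ×ˢ sph n] (t, x)) (𝓝 0) := by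
    have : ContinuousOn (fun p : ℝ × Eu n => ‖p.2 - x‖ * L p.1) (S ×ˢ sph n) :=
      ContinuousOn.mul (by fun_prop) (hLc.comp continuousOn_fst (fun p hp => hp.1))
    have h := this (t, x) ⟨ht, hx⟩
    simpa [ContinuousWithinAt] using h
  have t3 : Tendsto (fun p : ℝ × Eu n => u p.1 p.2 - u p.1 x) (𝓝[S ×ˢ sph n] (t, x)) (𝓝 0) := by
    refine squeeze_zero_norm' ?_ t2
    filter_upwards [self_mem_nhdsWithin] with p hp
    exact equiLip (hg p.1 hp.1) hp.2 hx
  have := t3.add t1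
  simpa [ContinuousWithinAt] using this

def Ph (n k : ℕ) (α β : ℝ) (f v : Eu n → ℝ) (x : Eu n) : ℝ := f x * v x ^ (α - 1) * sigmaK n k v x ^ β

lemma Ph_pos {n k : ℕ} (hk : k ≤ n) (α β : ℝ) {f v : Eu n → ℝ} (hf : PosOnSphere f) (hv : GoodSph v) {x : Eu n} (hx : x ∈ sph n) :
    0 < Ph n k α β f v x :=
  mul_pos (mul_pos (hf x hx) (Real.rpow_pos_of_pos (hv.2.1 x hx) _)) (Real.rpow_pos_of_pos (good_sig_pos hk hv hx) _)

lemma Ph_contOn {n k : ℕ} (hk : k ≤ n) (α β : ℝ) {f v : Eu n → ℝ} (hf : SmoothOnSphere f) (hv : GoodSph v) :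
    ContinuousOn (Ph n k α β f v) (sph n) :=
  ((u_contOn hf).mul ((u_contOn hv.1).rpow_const fun x hx => Or.inl (hv.2.1 x hx).ne')).mul
    ((sig_contOn hk hv.1).rpow_const fun x hx => Or.inl (good_sig_pos hk hv hx).ne')

lemma touchPh {n k : ℕ} (hk : k ≤ n) {α β : ℝ} (hβ : 0 < β) {f v b : Eu n → ℝ} (hf : PosOnSphere f) (hv : GoodSph v) (hb : GoodSph b)
    {r : ℝ} (hr : 0 < r) (hle : ∀ y ∈ sph n, v y ≤ r * b y) {x : Eu n} (hx : x ∈ sph n) (heq : v x = r * b x) :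
    Ph n k α β f v x ≤ r ^ (α - 1 + k * β) * Ph n k α β f b x := by
  have h1 := touch hk hv hb r hle hx heq
  have hσ := good_sig_pos hk hb hx
  have hσv := good_sig_pos hk hv hx
  have hbx := hb.2.1 x hx
  have h2 : sigmaK n k v x ^ β ≤ r ^ (k * β) * sigmaK n k b x ^ β := by
    calc sigmaK n k v x ^ β ≤ (r ^ k * sigmaK n k b x) ^ β := Real.rpow_le_rpow hσv.le h1 hβ.le
      _ = _ := by rw [Real.mul_rpow (by positivity) hσ.le, ← Real.rpow_natCast r k, ← Real.rpow_mul hr.le]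
  unfold Ph
  rw [heq, Real.mul_rpow hr.le hbx.le, Real.rpow_add hr]
  have h3 : 0 ≤ f x * (r ^ (α - 1) * b x ^ (α - 1)) := by
    have := hf x hx
    positivity
  nlinarith [mul_le_mul_of_nonneg_left h2 h3]

lemma touch_max {n k : ℕ} (hk : k ≤ n) {α β : ℝ} (hβ : 0 < β) {f v b : Eu n → ℝ} (hf : PosOnSphere f) (hv : GoodSph v) (hb : GoodSph b)
    {x : Eu n} (hx : x ∈ sph n) (hm : ∀ y ∈ sph n, Real.log (v y) - Real.log (b y) ≤ Real.log (v x) - Real.log (b x)) :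
    Ph n k α β f v x ≤ Real.exp ((α - 1 + k * β) * (Real.log (v x) - Real.log (b x))) * Ph n k α β f b x := by
  have hvx := hv.2.1 x hx
  have hbx := hb.2.1 x hx
  have hr : 0 < v x / b x := div_pos hvx hbx
  have := touchPh hk (α := α) hβ hf hv hb (r := v x / b x) hr (fun y hy => by
    have hvy := hv.2.1 y hy
    have hby := hb.2.1 y hy
    have h := hm y hy
    rw [← Real.log_div hvy.ne' hby.ne', ← Real.log_div hvx.ne' hbx.ne', Real.log_le_log_iff (div_pos hvy hby) hr, div_le_iff₀ hby] at h
    exact h) hx (by field_simp)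
  rwa [Real.rpow_def_of_pos hr, Real.log_div hvx.ne' hbx.ne', mul_comm (_ - _)] at this

lemma touch_min {n k : ℕ} (hk : k ≤ n) {α β : ℝ} (hβ : 0 < β) {f v b : Eu n → ℝ} (hf : PosOnSphere f) (hv : GoodSph v) (hb : GoodSph b)
    {x : Eu n} (hx : x ∈ sph n) (hm : ∀ y ∈ sph n, Real.log (v x) - Real.log (b x) ≤ Real.log (v y) - Real.log (b y)) :
    Real.exp ((α - 1 + k * β) * (Real.log (v x) - Real.log (b x))) * Ph n k α β f b x ≤ Ph n k α β f v x := by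
  have := touch_max hk (α := α) hβ hf hb hv hx (fun y hy => by linarith [hm y hy])
  calc _ ≤ Real.exp ((α - 1 + k * β) * (Real.log (v x) - Real.log (b x))) * (Real.exp ((α - 1 + k * β) * (Real.log (b x) - Real.log (v x))) * Ph n k α β f v x) :=
        mul_le_mul_of_nonneg_left this (Real.exp_pos _).le
    _ = _ := by rw [← mul_assoc, ← Real.exp_add]; ring_nf; simp

lemma pairMax {n : ℕ} (a c : ℝ) (hac : a ≤ c) (L L' : ℝ → Eu n → ℝ) (C m : ℝ)
    (hc : ContinuousOn (fun p : ℝ × Eu n => L p.1 p.2) (Set.Icc a c ×ˢ sph n))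
    (hd : ∀ x ∈ sph n, ∀ t ∈ Set.Icc a c, HasDerivWithinAt (fun t => L t x) (L' t x) (Set.Icc a c) t)
    (hmx : ∀ t ∈ Set.Ioc a c, ∀ x ∈ sph n, ∀ y ∈ sph n, (∀ z ∈ sph n, L t z ≤ L t x) → (∀ z ∈ sph n, L t y ≤ L t z) → L' t x - L' t y ≤ C)
    (h0 : ∀ x ∈ sph n, ∀ y ∈ sph n, L a x - L a y ≤ m) :
    ∀ x ∈ sph n, ∀ y ∈ sph n, L c x - L c y ≤ m + C * (c - a) := by
  intro x hx y hy
  refine maxP (sph n ×ˢ sph n) ((sph_compact n).prod (sph_compact n)) a c hac (fun t z => L t z.1 - L t z.2) (fun t z => L' t z.1 - L' t z.2) C m ?_ ?_ ?_ ?_ (x, y) ⟨hx, hy⟩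
  · exact (hc.comp (f := fun p : ℝ × (Eu n × Eu n) => (p.1, p.2.1)) (by fun_prop) (fun p hp => ⟨hp.1, hp.2.1⟩)).sub
      (hc.comp (f := fun p : ℝ × (Eu n × Eu n) => (p.1, p.2.2)) (by fun_prop) (fun p hp => ⟨hp.1, hp.2.2⟩))
  · exact fun z hz t ht => (hd z.1 hz.1 t ht).sub (hd z.2 hz.2 t ht)
  · intro t ht z hz h
    refine hmx t ht z.1 hz.1 z.2 hz.2 (fun w hw => ?_) (fun w hw => ?_)
    · have := h (w, z.2) ⟨hw, hz.2⟩
      simp only at this; linarith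
    · have := h (z.1, w) ⟨hz.1, hw⟩
      simp only at this; linarith
  · exact fun z hz => h0 z.1 hz.1 z.2 hz.2

lemma unif_small {X : Type*} [TopologicalSpace X] {K : Set X} (hK : IsCompact K) {S : Set ℝ} {g : ℝ → X → ℝ} {t₀ : ℝ} (ht : t₀ ∈ S)
    (hc : ContinuousOn (fun p : ℝ × X => g p.1 p.2) (S ×ˢ K)) {ε : ℝ} (he : 0 < ε) :
    ∀ᶠ t in 𝓝[S] t₀, ∀ x ∈ K, |g t x - g t₀ x| < ε := by
  obtain ⟨v, hv, h⟩ := IsCompact.mem_uniformity_of_prod (f := g) hK hc ht (Metric.dist_mem_uniformity he)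
  filter_upwards [hv] with t ht x hx
  exact h t ht x hx

def hh (n k : ℕ) (α β : ℝ) (f v : Eu n → ℝ) (x : Eu n) : ℝ := f x * v x ^ α * sigmaK n k v x ^ β

lemma hh_eq {n k : ℕ} (α β : ℝ) (f : Eu n → ℝ) {v : Eu n → ℝ} (hv : GoodSph v) {x : Eu n} (hx : x ∈ sph n) :
    hh n k α β f v x = v x * Ph n k α β f v x := by
  have : v x ^ α = v x * v x ^ (α - 1) := by
    rw [Real.rpow_sub_one (hv.2.1 x hx).ne']; field_simp [(hv.2.1 x hx).ne']
  rw [hh, Ph, this]; ring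

lemma sg_smooth {n k : ℕ} (hk : k ≤ n) {F : Eu n → ℝ} (h : Sm F) : ContDiffOn ℝ (⊤ : ℕ∞) (fun y => sg n k (hm F y)) {(0 : Eu n)}ᶜ := by
  simp only [cc_spec n k hk]
  refine ContDiffOn.sum fun j _ => contDiffOn_const.mul ?_
  simp only [Matrix.det_apply]
  refine ContDiffOn.sum fun σ _ => ContDiffOn.const_smul _ ?_
  refine contDiffOn_prod fun i _ => ?_
  simp only [Matrix.add_apply, Matrix.smul_apply, smul_eq_mul]
  exact contDiffOn_const.add (contDiffOn_const.mul (h.hm _ _))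

lemma hh_smooth {n k : ℕ} (hk : k ≤ n) (α β : ℝ) {f v : Eu n → ℝ} (hf : SmoothOnSphere f) (hv : GoodSph v) :
    SmoothOnSphere (hh n k α β f v) := by
  have hnorm : ContDiffOn ℝ (⊤ : ℕ∞) (fun y : Eu n => ‖y‖) {(0 : Eu n)}ᶜ := contDiffOn_id.norm ℝ (fun y hy => hy)
  have hN : ContDiffOn ℝ (⊤ : ℕ∞) (fun y : Eu n => ‖y‖⁻¹ • y) {(0 : Eu n)}ᶜ :=
    (hnorm.inv (fun y hy => norm_ne_zero_iff.2 hy)).smul contDiffOn_id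
  have hmap : Set.MapsTo (fun y : Eu n => ‖y‖⁻¹ • y) {(0 : Eu n)}ᶜ {(0 : Eu n)}ᶜ := fun y hy => sph_ne (nrm_mem hy)
  have h1 := ContDiffOn.comp (g := homExt f) hf hN hmap
  have h2 := ContDiffOn.comp (g := homExt v) hv.1 hN hmap
  have h3 := ContDiffOn.comp (sg_smooth hk (F := homExt v) hv.1) hN hmap
  have h4 := (hnorm.mul ((h1.mul (h2.rpow_const_of_ne (p := α) ?_)).mul (h3.rpow_const_of_ne (p := β) ?_)))
  · refine h4.congr fun y hy => ?_
    have hy' := nrm_mem (n := n) hy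
    simp only [homExt, hh, Function.comp]
    rw [sigmaK_eq k hv.1 (sph_ne hy')]
    have := mem_sph.1 hy'
    simp [this]
  · intro y hy
    have hy' := nrm_mem (n := n) hy
    simp only [Function.comp]
    rw [homExt_sph v hy']; exact (hv.2.1 _ hy').ne'
  · intro y hy
    have hy' := nrm_mem (n := n) hy
    simp only [Function.comp]
    rw [← sigmaK_eq k hv.1 (sph_ne hy')]; exact (good_sig_pos hk hv hy').ne'

lemma good_pert {n : ℕ} {v h : Eu n → ℝ} (hv : GoodSph v) (hh : SmoothOnSphere h) :
    ∃ δ > 0, ∀ s ∈ Set.Icc (0:ℝ) δ, GoodSph (fun x => 1 * v x + s * h x) := by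
  set K : Set (Eu n × Eu n) := (sph n ×ˢ sph n) ∩ {p | ⟪p.1, p.2⟫ = 0} with hKd
  have hK : IsCompact K := ((sph_compact n).prod (sph_compact n)).inter_right
    (isClosed_eq (by fun_prop) continuous_const)
  have hq : ∀ w : Eu n → ℝ, SmoothOnSphere w → ContinuousOn (fun p : Eu n × Eu n => ⟪p.2, hessOp w p.1 p.2⟫) K := by
    intro w hw
    have : ContinuousOn (fun p : Eu n × Eu n => ∑ i, p.2 i * ∑ j, hm (homExt w) p.1 i j * p.2 j) K := by
      refine continuousOn_finsetSum _ fun i _ => ContinuousOn.mul (by fun_prop) (continuousOn_finsetSum _ fun j _ => ContinuousOn.mul ?_ (by fun_prop))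
      exact (Sm.contOn (Sm.hm (F := homExt w) hw i j)).comp continuousOn_fst (fun p hp => hp.1.1)
    refine this.congr fun p hp => ?_
    rw [inner_hess hw (sph_ne hp.1.1)]
    simp only [dotProduct, Matrix.mulVec]
  have key : ∀ {X : Type} [TopologicalSpace X] (K : Set X) (_ : IsCompact K) (a b : X → ℝ), ContinuousOn a K → ContinuousOn b K → (∀ x ∈ K, 0 < a x) →
      ∃ δ > 0, ∀ s ∈ Set.Icc (0:ℝ) δ, ∀ x ∈ K, 0 < 1 * a x + s * b x := by
    intro X _ K hK a b ha hb hp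
    rcases K.eq_empty_or_nonempty with rfl | hne
    · exact ⟨1, one_pos, by simp⟩
    obtain ⟨z, hz, hmin⟩ := hK.exists_isMinOn hne ha
    obtain ⟨C, hC⟩ := hK.exists_bound_of_continuousOn hb
    have hz0 := hp z hz
    refine ⟨a z / (2 * (|C| + 1)), by positivity, fun s hs x hx => ?_⟩
    have h1 : a z ≤ a x := hmin hx
    have h2 : -|C| ≤ b x := by
      have := hC x hx
      rw [Real.norm_eq_abs] at this
      have h3 := neg_abs_le (b x)
      have h4 := le_abs_self C
      linarith
    have h5 : s * (2 * (|C| + 1)) ≤ a z := by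
      have := hs.2
      rwa [le_div_iff₀ (by positivity)] at this
    have h6 := mul_le_mul_of_nonneg_left h2 hs.1
    nlinarith [hs.1, abs_nonneg C]
  obtain ⟨δ1, h1, hd1⟩ := key (sph n) (sph_compact n) v h (u_contOn hv.1) (u_contOn hh) hv.2.1
  obtain ⟨δ2, h2, hd2⟩ := key K hK _ _ (hq v hv.1) (hq h hh) (fun p hp => hv.2.2 _ hp.1.1 _ hp.2 (sph_ne hp.1.2))
  refine ⟨min δ1 δ2, lt_min h1 h2, fun s hs => ⟨smooth_lin hv.1 hh 1 s, fun x hx => hd1 s ⟨hs.1, hs.2.trans (min_le_left _ _)⟩ x hx, fun x hx w hw hw0 => ?_⟩⟩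
  have hwn := norm_pos_iff.2 hw0
  have := hd2 s ⟨hs.1, hs.2.trans (min_le_right _ _)⟩ (x, ‖w‖⁻¹ • w) ⟨⟨hx, nrm_mem hw0⟩, by
    simp only [Set.mem_setOf_eq, inner_smul_right, hw, mul_zero]⟩
  simp only at this
  rw [← inner_hess_lin hv.1 hh 1 s (sph_ne hx)] at this
  rw [map_smul, inner_smul_left, inner_smul_right] at this
  simp only [conj_trivial] at this
  have h3 : 0 < ‖w‖⁻¹ * (‖w‖⁻¹ * ⟪w, hessOp (fun x => 1 * v x + s * h x) x w⟫) := this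
  have h4 : 0 < ‖w‖⁻¹ := inv_pos.2 hwn
  exact pos_of_mul_pos_right (pos_of_mul_pos_right h3 h4.le) h4.le

lemma M_sand {n k : ℕ} (hk : k ≤ n) {v b : Eu n → ℝ} (hv : GoodSph v) (hb : GoodSph b) (c : ℝ)
    (h : ∀ x ∈ sph n, Real.log (v x) - Real.log (b x) ≤ c) : Real.log (Mf n k v) ≤ Real.log (Mf n k b) + (k+1) * c := by
  have h1 := M_mono hk hv (good_smul hb (Real.exp c) (Real.exp_pos c)) (fun x hx => by
    have := h x hx
    rw [← Real.log_le_log_iff (hv.2.1 x hx) (mul_pos (Real.exp_pos c) (hb.2.1 x hx)), Real.log_mul (Real.exp_pos c).ne' (hb.2.1 x hx).ne', Real.log_exp]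
    linarith)
  rw [M_smul hk hb.1] at h1
  have h2 := Real.log_le_log (M_pos hk hv) h1
  rw [Real.log_mul (by positivity) (M_pos hk hb).ne', Real.log_pow, Real.log_exp] at h2
  push_cast at h2
  linarith

lemma flow_log {n k : ℕ} {α β T : ℝ} {f : Eu n → ℝ} {u : ℝ → Eu n → ℝ} (hu : NormFlow n k α β f (Set.Ico 0 T) u)
    {x : Eu n} (hx : x ∈ sph n) {t : ℝ} (ht : t ∈ Set.Ico 0 T) :
    HasDerivWithinAt (fun r => Real.log (u r x)) (Ph n k α β f (u t) x - eta n k α β f (u t)) (Set.Ico 0 T) t := by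
  have hp := (hu.1 t ht).2.1 x hx
  have := (hu.2.2 x hx t ht).log hp.ne'
  convert this using 1
  have e := hh_eq (k := k) α β f (hu.1 t ht) hx
  rw [hh] at e
  rw [e]; field_simp

lemma flow_cont {n k : ℕ} {α β T : ℝ} {f : Eu n → ℝ} {u : ℝ → Eu n → ℝ} (hu : NormFlow n k α β f (Set.Ico 0 T) u) :
    ContinuousOn (fun p : ℝ × Eu n => Real.log (u p.1 p.2)) (Set.Ico 0 T ×ˢ sph n) :=
  (joint_cont u _ hu.1 fun x hx t ht => (hu.2.2 x hx t ht).continuousWithinAt).log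
    fun p hp => ((hu.1 p.1 hp.1).2.1 p.2 hp.2).ne'

lemma bcont {n : ℕ} {v h : Eu n → ℝ} (hv : SmoothOnSphere v) (hh : SmoothOnSphere h) (S : Set ℝ) :
    ContinuousOn (fun p : ℝ × Eu n => 1 * v p.2 + p.1 * h p.2) (S ×ˢ sph n) := by
  have h1 : ContinuousOn (fun p : ℝ × Eu n => v p.2) (S ×ˢ sph n) := (u_contOn hv).comp continuousOn_snd (fun p hp => hp.2)
  have h2 : ContinuousOn (fun p : ℝ × Eu n => h p.2) (S ×ˢ sph n) := (u_contOn hh).comp continuousOn_snd (fun p hp => hp.2)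
  exact (continuousOn_const.mul h1).add (continuousOn_fst.mul h2)

lemma Phb_cont {n k : ℕ} (hk : k ≤ n) (α β : ℝ) {f v h : Eu n → ℝ} (hf : SmoothOnSphere f) (hv : SmoothOnSphere v) (hh : SmoothOnSphere h)
    (S : Set ℝ) (hg : ∀ s ∈ S, GoodSph (fun x => 1 * v x + s * h x)) :
    ContinuousOn (fun p : ℝ × Eu n => Ph n k α β f (fun x => 1 * v x + p.1 * h x) p.2) (S ×ˢ sph n) := by
  have h1 : ContinuousOn (fun p : ℝ × Eu n => f p.2) (S ×ˢ sph n) := (u_contOn hf).comp continuousOn_snd (fun p hp => hp.2)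
  have hA : ContinuousOn (fun p : ℝ × Eu n => hm (homExt v) p.2) (S ×ˢ sph n) := (hm_contOn hv).comp continuousOn_snd (fun p hp => hp.2)
  have hB : ContinuousOn (fun p : ℝ × Eu n => hm (homExt h) p.2) (S ×ˢ sph n) := (hm_contOn hh).comp continuousOn_snd (fun p hp => hp.2)
  have hC : ContinuousOn (fun p : ℝ × Eu n => (1:ℝ) • hm (homExt v) p.2 + p.1 • hm (homExt h) p.2) (S ×ˢ sph n) :=
    (hA.const_smul (1:ℝ)).add (continuousOn_fst.smul hB)
  have hD : ContinuousOn (fun p : ℝ × Eu n => sigmaK n k (fun x => 1 * v x + p.1 * h x) p.2) (S ×ˢ sph n) := by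
    refine (sgC hk hC).congr fun p hp => ?_
    show sigmaK n k (fun x => 1 * v x + p.1 * h x) p.2 = _
    rw [sigmaK_eq k (smooth_lin hv hh 1 p.1) (sph_ne hp.2), homExt_lin, hm_lin hv hh 1 p.1 (sph_ne hp.2)]
  exact (h1.mul ((bcont hv hh S).rpow_const fun p hp => Or.inl ((hg p.1 hp.1).2.1 p.2 hp.2).ne')).mul
    (hD.rpow_const fun p hp => Or.inl (good_sig_pos hk (hg p.1 hp.1) hp.2).ne')

lemma short {n k : ℕ} (hk : k ≤ n) {α β T : ℝ} (hβ : 0 < β) {f : Eu n → ℝ} (hfs : SmoothOnSphere f) (hfp : PosOnSphere f)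
    {u : ℝ → Eu n → ℝ} (hu : NormFlow n k α β f (Set.Ico 0 T) u) {t₀ : ℝ} (ht₀ : t₀ ∈ Set.Ico 0 T) {δ : ℝ} (hδ : 0 < δ)
    (hg : ∀ s ∈ Set.Icc (0:ℝ) δ, GoodSph (fun x => 1 * u t₀ x + s * hh n k α β f (u t₀) x)) {ε : ℝ} (hε : 0 < ε) :
    ∀ᶠ t in 𝓝[>] t₀, t ∈ Set.Icc t₀ (t₀ + δ) ∧ ∀ x ∈ sph n, |Real.log (u t x) - Real.log (1 * u t₀ x + (t - t₀) * hh n k α β f (u t₀) x)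
      + eta n k α β f (u t₀) * (t - t₀)| ≤ ε * (t - t₀) := by
  set h := hh n k α β f (u t₀) with hhd
  have hgu := hu.1 t₀ ht₀
  have hhs : SmoothOnSphere h := hh_smooth hk α β hfs hgu
  obtain ⟨c, hc1, hc2, hcT⟩ : ∃ c, t₀ < c ∧ c ≤ t₀ + δ ∧ c < T :=
    ⟨min (t₀ + δ) ((t₀ + T) / 2), lt_min (by linarith) (by linarith [ht₀.2]), min_le_left _ _, (min_le_right _ _).trans_lt (by linarith [ht₀.2])⟩
  have hsub : Set.Icc t₀ c ⊆ Set.Ico 0 T := fun t ht => ⟨ht₀.1.trans ht.1, ht.2.trans_lt hcT⟩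
  have hG : ∀ t ∈ Set.Icc t₀ c, GoodSph (fun x => 1 * u t₀ x + (t - t₀) * h x) := fun t ht => hg _ ⟨by linarith [ht.1], by linarith [ht.2]⟩
  set bb : ℝ → Eu n → ℝ := fun t x => 1 * u t₀ x + (t - t₀) * h x with hbb
  set L : ℝ → Eu n → ℝ := fun t x => Real.log (u t x) - Real.log (bb t x) with hL
  set L' : ℝ → Eu n → ℝ := fun t x => (Ph n k α β f (u t) x - eta n k α β f (u t)) - h x / bb t x with hL'
  set E : ℝ → Eu n → ℝ := fun t x => Real.exp ((α - 1 + k * β) * L t x) * Ph n k α β f (bb t) x - h x / bb t x with hE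
  have hbc : ContinuousOn (fun p : ℝ × Eu n => bb p.1 p.2) (Set.Icc t₀ c ×ˢ sph n) :=
    (bcont hgu.1 hhs Set.univ).comp (f := fun p : ℝ × Eu n => (p.1 - t₀, p.2)) (by fun_prop) (fun p hp => ⟨trivial, hp.2⟩)
  have hLc : ContinuousOn (fun p : ℝ × Eu n => L p.1 p.2) (Set.Icc t₀ c ×ˢ sph n) :=
    ((flow_cont hu).mono (Set.prod_mono hsub subset_rfl)).sub (hbc.log fun p hp => ((hG p.1 hp.1).2.1 p.2 hp.2).ne')
  have hPc : ContinuousOn (fun p : ℝ × Eu n => Ph n k α β f (bb p.1) p.2) (Set.Icc t₀ c ×ˢ sph n) :=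
    (Phb_cont hk α β hfs hgu.1 hhs (Set.Icc 0 δ) hg).comp (f := fun p : ℝ × Eu n => (p.1 - t₀, p.2)) (by fun_prop)
      (fun p hp => ⟨⟨by linarith [hp.1.1], by linarith [hp.1.2]⟩, hp.2⟩)
  have hEc : ContinuousOn (fun p : ℝ × Eu n => E p.1 p.2) (Set.Icc t₀ c ×ˢ sph n) := by
    refine ((Real.continuous_exp.comp_continuousOn (continuousOn_const.mul hLc)).mul hPc).sub (ContinuousOn.div ?_ hbc fun p hp => ((hG p.1 hp.1).2.1 p.2 hp.2).ne')
    exact (u_contOn hhs).comp continuousOn_snd (fun p hp => hp.2)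
  have hb0 : bb t₀ = u t₀ := by funext x; simp [hbb]
  have hL0 : ∀ x, L t₀ x = 0 := fun x => by simp only [hL, hb0, sub_self]
  have hE0 : ∀ x ∈ sph n, E t₀ x = 0 := by
    intro x hx
    have := (hgu.2.1 x hx).ne'
    simp only [hE, hL0, hb0, hhd, hh_eq (k := k) α β f hgu hx]
    field_simp; simp
  have hd : ∀ x ∈ sph n, ∀ t ∈ Set.Icc t₀ c, HasDerivWithinAt (fun t => L t x) (L' t x) (Set.Icc t₀ c) t := by
    intro x hx t ht
    refine ((flow_log hu hx (hsub ht)).mono hsub).sub ?_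
    have h1 : HasDerivAt (fun t => bb t x) (h x) t := by
      have h2 := (((hasDerivAt_id t).sub_const t₀).mul_const (h x)).const_add (1 * u t₀ x)
      rw [one_mul (h x)] at h2
      exact h2
    exact (h1.log ((hG t ht).2.1 x hx).ne').hasDerivWithinAt
  have hsm := unif_small (sph_compact n) (Set.left_mem_Icc.2 hc1.le) hEc (ε := ε / 4) (by linarith)
  obtain ⟨d, hd1, hd2⟩ : ∃ d, t₀ < d ∧ ∀ t ∈ Set.Icc t₀ d, t ≤ c ∧ ∀ x ∈ sph n, |E t x| < ε / 4 := by
    rw [eventually_nhdsWithin_iff, Metric.eventually_nhds_iff] at hsm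
    obtain ⟨r, hr, h⟩ := hsm
    refine ⟨min c (t₀ + r / 2), lt_min hc1 (by linarith), fun t ht => ⟨ht.2.trans (min_le_left _ _), fun x hx => ?_⟩⟩
    have h1 := ht.2.trans (min_le_right _ _)
    have := h (y := t) (by rw [Real.dist_eq, abs_of_nonneg (by linarith [ht.1])]; linarith) ⟨ht.1, ht.2.trans (min_le_left _ _)⟩ x hx
    rwa [hE0 x hx, sub_zero] at this
  have hosc : ∀ t ∈ Set.Icc t₀ d, ∀ x ∈ sph n, ∀ y ∈ sph n, L t x - L t y ≤ ε / 2 * (t - t₀) := by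
    intro t ht x hx y hy
    have hs2 : Set.Icc t₀ t ⊆ Set.Icc t₀ c := Set.Icc_subset_Icc_right (hd2 t ht).1
    have := pairMax t₀ t ht.1 L L' (ε / 2) 0 (hLc.mono (Set.prod_mono hs2 subset_rfl)) (fun x hx t ht => (hd x hx t (hs2 ht)).mono hs2) ?_
      (fun x _ y _ => by simp [hL0]) x hx y hy
    · linarith
    · intro r hr p hp q hq hmax hmin
      have hr' : r ∈ Set.Icc t₀ c := hs2 ⟨hr.1.le, hr.2⟩
      have h1 := touch_max hk (α := α) hβ hfp (hu.1 r (hsub hr')) (hG r hr') hp hmax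
      have h2 := touch_min hk (α := α) hβ hfp (hu.1 r (hsub hr')) (hG r hr') hq hmin
      have h3 := (abs_lt.1 ((hd2 r ⟨hr.1.le, hr.2.trans ht.2⟩).2 p hp)).2
      have h4 := (abs_lt.1 ((hd2 r ⟨hr.1.le, hr.2.trans ht.2⟩).2 q hq)).1
      simp only [hE, hL, hbb] at h3 h4
      simp only [hL', hbb]
      linarith
  have hy := eb_sph (n := n) 0
  have hpt : ∀ᶠ t in 𝓝[>] t₀, |L t (eb 0) + eta n k α β f (u t₀) * (t - t₀)| ≤ ε / 2 * (t - t₀) := by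
    have h1 := hd _ hy t₀ (Set.left_mem_Icc.2 hc1.le)
    have h2 : L' t₀ (eb 0) = - eta n k α β f (u t₀) := by
      have := (hgu.2.1 _ hy).ne'
      simp only [hL', hb0, hhd, hh_eq (k := k) α β f hgu hy]
      field_simp; ring
    rw [h2] at h1
    have h3 := (hasDerivWithinAt_iff_isLittleO.1 h1).def (c := ε / 2) (by linarith)
    have h4 : 𝓝[>] t₀ ≤ 𝓝[Set.Icc t₀ c] t₀ := by
      rw [← nhdsWithin_Ioc_eq_nhdsGT hc1]
      exact nhdsWithin_mono _ Set.Ioc_subset_Icc_self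
    filter_upwards [h4 h3, self_mem_nhdsWithin] with t ht ht2
    have ht2 : t₀ < t := ht2
    simp only [hL0, sub_zero, Real.norm_eq_abs, smul_eq_mul] at ht
    rw [abs_of_pos (sub_pos.2 ht2)] at ht
    convert ht using 2
    ring
  filter_upwards [hpt, Ioc_mem_nhdsGT hd1] with t h1 ht
  have ht' : t ∈ Set.Icc t₀ d := ⟨ht.1.le, ht.2⟩
  refine ⟨⟨ht.1.le, (hd2 t ht').1.trans hc2⟩, fun x hx => ?_⟩
  have h2 := hosc t ht' x hx _ hy
  have h3 := hosc t ht' _ hy x hx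
  rw [abs_le] at h1 ⊢
  simp only [hL, hbb] at h1 h2 h3
  constructor <;> linarith

lemma eta_int {n k : ℕ} (hk : k ≤ n) {α β : ℝ} {f v : Eu n → ℝ} (hv : GoodSph v) :
    ∫ x, hh n k α β f v x * sigmaK n k v x ∂(smu n) = sphVol n * eta n k α β f v := by
  rw [eta, ← mul_assoc, mul_inv_cancel₀ (sphVol_pos n).ne', one_mul, sphInt_eq]
  refine integral_congr_ae ?_
  filter_upwards [smu_ae n] with x hx
  rw [hh, Real.rpow_add (good_sig_pos hk hv hx), Real.rpow_one]; ring

lemma eta_pos {n k : ℕ} (hk : k ≤ n) {α β : ℝ} {f v : Eu n → ℝ} (hf : SmoothOnSphere f) (hfp : PosOnSphere f) (hv : GoodSph v) :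
    0 < eta n k α β f v := by
  have : 0 < sphVol n * eta n k α β f v := by
    rw [← eta_int hk hv]
    refine int_pos ((u_contOn (hh_smooth hk α β hf hv)).mul (sig_contOn hk hv.1)) fun x hx => mul_pos ?_ (good_sig_pos hk hv hx)
    rw [hh_eq α β f hv hx]
    exact mul_pos (hv.2.1 x hx) (Ph_pos hk α β hfp hv hx)
  exact pos_of_mul_pos_right this (sphVol_pos n).le

lemma logM_deriv {n k : ℕ} (hk : k ≤ n) {α β T : ℝ} (hβ : 0 < β) {f : Eu n → ℝ} (hfs : SmoothOnSphere f) (hfp : PosOnSphere f)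
    {u : ℝ → Eu n → ℝ} (hu : NormFlow n k α β f (Set.Ico 0 T) u) {t₀ : ℝ} (ht₀ : t₀ ∈ Set.Ico 0 T) :
    HasDerivWithinAt (fun t => Real.log (Mf n k (u t))) ((k+1) * (sphVol n * eta n k α β f (u t₀)) / Mf n k (u t₀) - (k+1) * eta n k α β f (u t₀)) (Set.Ici t₀) t₀ := by
  have hgu := hu.1 t₀ ht₀
  have hhs := hh_smooth hk α β hfs hgu
  obtain ⟨δ, hδ, hg⟩ := good_pert hgu hhs
  set η := eta n k α β f (u t₀) with hη
  set bb : ℝ → Eu n → ℝ := fun t x => 1 * u t₀ x + (t - t₀) * hh n k α β f (u t₀) x with hbb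
  have hb0 : bb t₀ = u t₀ := by funext x; simp [hbb]
  have hB : HasDerivAt (fun t => Real.log (Mf n k (bb t)) - (k+1) * η * (t - t₀)) ((k+1) * (sphVol n * η) / Mf n k (u t₀) - (k+1) * η) t₀ := by
    have h1 := M_deriv hk hgu.1 hhs 0 (hg 0 ⟨le_rfl, hδ.le⟩)
    simp only [zero_mul, add_zero, one_mul] at h1
    rw [eta_int hk hgu] at h1
    have h2 : HasDerivAt (fun t => Mf n k (bb t)) ((k+1) * (sphVol n * η)) t₀ := by
      have h3 := HasDerivAt.comp_sub_const (f := fun s => Mf n k (fun x => u t₀ x + s * hh n k α β f (u t₀) x)) t₀ t₀ (by simpa using h1)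
      simpa only [hbb, one_mul] using h3
    have h3 := h2.log (by rw [hb0]; exact (M_pos hk hgu).ne')
    rw [hb0] at h3
    refine h3.sub ?_
    simpa using ((hasDerivAt_id t₀).sub_const t₀).const_mul ((k+1) * η)
  have hD : HasDerivWithinAt (fun t => Real.log (Mf n k (u t)) - (Real.log (Mf n k (bb t)) - (k+1) * η * (t - t₀))) 0 (Set.Ioi t₀) t₀ := by
    rw [hasDerivWithinAt_iff_isLittleO, Asymptotics.isLittleO_iff]
    intro e he
    filter_upwards [short hk hβ hfs hfp hu ht₀ hδ hg (ε := e / (k+1)) (by positivity), self_mem_nhdsWithin, Ico_mem_nhdsGT ht₀.2] with t ht ht2 htT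
    have ht2 : t₀ < t := ht2
    have hgb : GoodSph (bb t) := hg _ ⟨by linarith, by linarith [ht.1.2]⟩
    have hgt := hu.1 t ⟨ht₀.1.trans ht2.le, htT.2⟩
    have h1 := M_sand hk hgt hgb (e / (k+1) * (t - t₀) - η * (t - t₀)) (fun x hx => by
      have := (abs_le.1 (ht.2 x hx)).2; simp only [hbb]; linarith)
    have h2 := M_sand hk hgb hgt (e / (k+1) * (t - t₀) + η * (t - t₀)) (fun x hx => by
      have := (abs_le.1 (ht.2 x hx)).1; simp only [hbb]; linarith)
    simp only [hb0, sub_self, mul_zero, sub_zero, smul_eq_mul]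
    rw [Real.norm_eq_abs, Real.norm_eq_abs, abs_of_pos (sub_pos.2 ht2)]
    have h3 : ((k:ℝ)+1) * (e / (k+1) * (t - t₀)) = e * (t - t₀) := by field_simp
    rw [abs_le]
    constructor <;> nlinarith
  have := (hasDerivWithinAt_Ioi_iff_Ici.1 hD).add hB.hasDerivWithinAt
  simp only [zero_add] at this
  refine this.congr_of_mem (fun t _ => ?_) (Set.self_mem_Ici)
  simp

lemma logM_cont {n k : ℕ} (hk : k ≤ n) {α β T : ℝ} {f : Eu n → ℝ}
    {u : ℝ → Eu n → ℝ} (hu : NormFlow n k α β f (Set.Ico 0 T) u) :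
    ContinuousOn (fun t => Real.log (Mf n k (u t))) (Set.Ico 0 T) := by
  intro t₀ ht₀
  refine Metric.tendsto_nhds.2 fun e he => ?_
  filter_upwards [unif_small (sph_compact n) ht₀ (g := fun t x => Real.log (u t x)) (flow_cont hu) (ε := e / (2 * (k+1))) (by positivity), self_mem_nhdsWithin] with t h ht
  have h1 := M_sand hk (hu.1 t ht) (hu.1 t₀ ht₀) _ (fun x hx => (abs_lt.1 (h x hx)).2.le)
  have h2 := M_sand hk (hu.1 t₀ ht₀) (hu.1 t ht) (e / (2 * (k+1))) (fun x hx => by linarith [(abs_lt.1 (h x hx)).1])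
  have h3 : ((k:ℝ)+1) * (e / (2 * (k+1))) = e / 2 := by field_simp
  rw [Real.dist_eq, abs_lt]
  constructor <;> linarith

lemma M_const {n k : ℕ} (hk : k ≤ n) {α β T : ℝ} (hβ : 0 < β) {f : Eu n → ℝ} (hfs : SmoothOnSphere f) (hfp : PosOnSphere f)
    {u : ℝ → Eu n → ℝ} (hu : NormFlow n k α β f (Set.Ico 0 T) u) {t : ℝ} (ht : t ∈ Set.Ico 0 T) :
    Mf n k (u t) = sphVol n := by
  set l : ℝ → ℝ := fun t => Real.log (Mf n k (u t)) - Real.log (sphVol n) with hl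
  have hsub : Set.Icc 0 t ⊆ Set.Ico 0 T := fun r hr => ⟨hr.1, hr.2.trans_lt ht.2⟩
  have hlc : ContinuousOn l (Set.Icc 0 t) := ((logM_cont hk hu).mono hsub).sub continuousOn_const
  have hV := sphVol_pos n
  have key := image_le_of_deriv_right_le_deriv_boundary (f := fun t => l t ^ 2) (B := fun _ => 0) (B' := fun _ => 0) (a := 0) (b := t)
    (f' := fun t₀ => 2 * l t₀ * ((k+1) * (sphVol n * eta n k α β f (u t₀)) / Mf n k (u t₀) - (k+1) * eta n k α β f (u t₀)))
    (hlc.pow 2) (fun r hr => by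
      have := ((logM_deriv hk hβ hfs hfp hu (hsub (Set.Ico_subset_Icc_self hr))).sub_const (Real.log (sphVol n))).fun_pow 2
      exact this.congr_deriv (by simp [hl])) (by
      have h0 : Mf n k (u 0) = sphVol n := by rw [← hu.2.1, sphInt_eq]; rfl
      simp [hl, h0]) continuousOn_const (fun r hr => hasDerivWithinAt_const _ _ _) (fun r hr => by
      have hg := hu.1 r (hsub (Set.Ico_subset_Icc_self hr))
      have hM := M_pos hk hg
      have he := eta_pos hk (α := α) (β := β) hfs hfp hg
      have e1 : 2 * l r * ((k+1) * (sphVol n * eta n k α β f (u r)) / Mf n k (u r) - (k+1) * eta n k α β f (u r))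
        = (2 * (k+1) * eta n k α β f (u r) / Mf n k (u r)) * (l r * (sphVol n - Mf n k (u r))) := by
        field_simp
      rw [e1]
      refine mul_nonpos_of_nonneg_of_nonpos (by positivity) ?_
      rcases le_total (Mf n k (u r)) (sphVol n) with h | h
      · exact mul_nonpos_of_nonpos_of_nonneg (sub_nonpos.2 (Real.log_le_log hM h)) (by linarith)
      · exact mul_nonpos_of_nonneg_of_nonpos (sub_nonneg.2 (Real.log_le_log hV h)) (by linarith))
  have h1 := key (Set.right_mem_Icc.2 ht.1)
  have h2 : l t = 0 := by
    exact pow_eq_zero_iff (two_ne_zero) |>.1 (le_antisymm h1 (sq_nonneg _))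
  exact Real.log_injOn_pos (M_pos hk (hu.1 t ht)) hV (sub_eq_zero.1 h2)

lemma sph_ne_empty (n : ℕ) : (sph n).Nonempty := ⟨eb 0, eb_sph 0⟩

lemma max_nonneg {n k : ℕ} (hk : k ≤ n) {v b : Eu n → ℝ} (hv : GoodSph v) (hb : GoodSph b) (hM : Mf n k v = Mf n k b) {c : ℝ}
    (h : ∀ x ∈ sph n, Real.log (v x) - Real.log (b x) ≤ c) : 0 ≤ c := by
  have := M_sand hk hv hb c h
  rw [hM] at this
  have h1 : 0 ≤ ((k:ℝ)+1) * c := by linarith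
  exact nonneg_of_mul_nonneg_right h1 (by positivity)

lemma osc {n k : ℕ} (hk : k ≤ n) {α β T : ℝ} (hβ : 0 < β) (hα : α - 1 + k * β ≤ 0) {f : Eu n → ℝ} (hfs : SmoothOnSphere f) (hfp : PosOnSphere f)
    {u : ℝ → Eu n → ℝ} (hu : NormFlow n k α β f (Set.Ico 0 T) u) :
    ∃ C, ∀ t ∈ Set.Ico 0 T, ∀ x ∈ sph n, ∀ y ∈ sph n, Ph n k α β f (u t) x - Ph n k α β f (u t) y ≤ C := by
  by_cases hT : 0 < T
  swap
  · exact ⟨0, fun t ht => absurd (ht.1.trans_lt ht.2) hT⟩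
  have h0 : (0:ℝ) ∈ Set.Ico 0 T := ⟨le_rfl, hT⟩
  have hg0 := hu.1 0 h0
  obtain ⟨δ, hδ, hg⟩ := good_pert hg0 (hh_smooth hk α β hfs hg0)
  obtain ⟨K, hK⟩ := (sph_compact n).exists_bound_of_continuousOn (Ph_contOn hk α β hfs hg0)
  have hini : ∀ᶠ s in 𝓝[>] (0:ℝ), ∀ x ∈ sph n, ∀ y ∈ sph n, (Real.log (u s x) - Real.log (u 0 x)) - (Real.log (u s y) - Real.log (u 0 y)) ≤ (2 + K) * s := by
    filter_upwards [short hk hβ hfs hfp hu h0 hδ hg one_pos, self_mem_nhdsWithin] with s hs hs0 x hx y hy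
    have hs0 : 0 < s := hs0
    have bd : ∀ x ∈ sph n, 0 ≤ Real.log (1 * u 0 x + (s - 0) * hh n k α β f (u 0) x) - Real.log (u 0 x) ∧
        Real.log (1 * u 0 x + (s - 0) * hh n k α β f (u 0) x) - Real.log (u 0 x) ≤ K * s := by
      intro x hx
      have p1 := hg0.2.1 x hx
      have p2 := Ph_pos hk α β hfp hg0 hx
      have e : 1 * u 0 x + (s - 0) * hh n k α β f (u 0) x = u 0 x * (1 + s * Ph n k α β f (u 0) x) := by rw [hh_eq α β f hg0 hx]; ring
      have p3 : 0 < s * Ph n k α β f (u 0) x := mul_pos hs0 p2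
      rw [e, Real.log_mul p1.ne' (by linarith), add_sub_cancel_left]
      refine ⟨Real.log_nonneg (by linarith), ?_⟩
      have h1 := Real.log_le_sub_one_of_pos (show 0 < 1 + s * Ph n k α β f (u 0) x by linarith)
      have h2 := (Real.le_norm_self _).trans (hK x hx)
      nlinarith
    have a1 := (abs_le.1 (hs.2 x hx)).2
    have a2 := (abs_le.1 (hs.2 y hy)).1
    have b1 := bd x hx
    have b2 := bd y hy
    linarith [b1.2, b2.1]
  refine ⟨2 + K, fun t ht x hx y hy => ?_⟩
  have hev : ∀ᶠ s in 𝓝[>] (0:ℝ), (Real.log (u (t + s) x) - Real.log (u t x)) - (Real.log (u (t + s) y) - Real.log (u t y)) ≤ (2 + K) * s := by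
    filter_upwards [hini, Ioo_mem_nhdsGT (show (0:ℝ) < T - t by linarith [ht.2])] with s hs hs2
    have hm1 : ∀ r ∈ Set.Icc 0 t, r ∈ Set.Ico 0 T := fun r hr => ⟨hr.1, hr.2.trans_lt ht.2⟩
    have hm2 : ∀ r ∈ Set.Icc 0 t, r + s ∈ Set.Ico 0 T := fun r hr => ⟨by linarith [hr.1, hs2.1], by linarith [hr.2, hs2.2]⟩
    have := pairMax 0 t ht.1 (fun r x => Real.log (u (r + s) x) - Real.log (u r x))
      (fun r x => (Ph n k α β f (u (r + s)) x - eta n k α β f (u (r + s))) - (Ph n k α β f (u r) x - eta n k α β f (u r))) 0 ((2 + K) * s) ?_ ?_ ?_ ?_ x hx y hy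
    · linarith
    · refine ContinuousOn.sub ?_ ((flow_cont hu).mono (Set.prod_mono hm1 subset_rfl))
      exact (flow_cont hu).comp (f := fun p : ℝ × Eu n => (p.1 + s, p.2)) (by fun_prop) (fun p hp => ⟨hm2 _ hp.1, hp.2⟩)
    · intro x hx r hr
      refine HasDerivWithinAt.sub ?_ ((flow_log hu hx (hm1 r hr)).mono hm1)
      have h1 : HasDerivWithinAt (fun r : ℝ => r + s) 1 (Set.Icc 0 t) r := ((hasDerivAt_id r).add_const s).hasDerivWithinAt
      have := (flow_log hu hx (hm2 r hr)).comp r h1 hm2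
      rw [mul_one] at this
      exact this
    · intro r hr p hp q hq hmax hmin
      have hr' : r ∈ Set.Icc 0 t := ⟨hr.1.le, hr.2⟩
      have g1 := hu.1 _ (hm1 r hr')
      have g2 := hu.1 _ (hm2 r hr')
      have e1 := M_const hk hβ hfs hfp hu (hm1 r hr')
      have e2 := M_const hk hβ hfs hfp hu (hm2 r hr')
      have n1 := max_nonneg hk g2 g1 (e2.trans e1.symm) hmax
      have n2 := max_nonneg hk g1 g2 (e1.trans e2.symm) (c := -(Real.log (u (r+s) q) - Real.log (u r q))) (fun z hz => by linarith [hmin z hz])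
      have t1 := touch_max hk (α := α) hβ hfp g2 g1 hp hmax
      have t2 := touch_min hk (α := α) hβ hfp g2 g1 hq hmin
      have p1 := Ph_pos hk α β hfp g1 hp
      have p2 := Ph_pos hk α β hfp g1 hq
      have x1 : Real.exp ((α - 1 + k * β) * (Real.log (u (r+s) p) - Real.log (u r p))) ≤ 1 :=
        Real.exp_le_one_iff.2 (mul_nonpos_of_nonpos_of_nonneg hα n1)
      have x2 : 1 ≤ Real.exp ((α - 1 + k * β) * (Real.log (u (r+s) q) - Real.log (u r q))) :=
        Real.one_le_exp (mul_nonneg_of_nonpos_of_nonpos hα (by linarith))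
      have y1 := mul_le_mul_of_nonneg_right x1 p1.le
      have y2 := mul_le_mul_of_nonneg_right x2 p2.le
      linarith
    · intro x hx y hy
      simpa using hs x hx y hy
  have hder : HasDerivWithinAt (fun r => Real.log (u r x) - Real.log (u r y)) (Ph n k α β f (u t) x - Ph n k α β f (u t) y) (Set.Ioo t T) t := by
    have := ((flow_log hu hx ht).sub (flow_log hu hy ht)).mono (s := Set.Ioo t T) (fun r hr => ⟨ht.1.trans hr.1.le, hr.2⟩)
    exact this.congr_deriv (by ring)
  rw [hasDerivWithinAt_iff_tendsto_slope' (by simp)] at hder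
  rw [nhdsWithin_Ioo_eq_nhdsGT ht.2] at hder
  refine le_of_tendsto hder ?_
  have hmap : Tendsto (fun r => r - t) (𝓝[>] t) (𝓝[>] 0) := by
    refine tendsto_nhdsWithin_iff.2 ⟨?_, ?_⟩
    · have : Tendsto (fun r => r - t) (𝓝 t) (𝓝 (t - t)) := (continuous_sub_right t).tendsto t
      rw [sub_self] at this
      exact this.mono_left nhdsWithin_le_nhds
    · filter_upwards [self_mem_nhdsWithin] with r hr
      exact sub_pos.2 (Set.mem_Ioi.1 hr)
  filter_upwards [hmap.eventually hev, self_mem_nhdsWithin] with r hr hr2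
  have hr2 : t < r := hr2
  rw [add_sub_cancel] at hr
  rw [slope_def_field, div_le_iff₀ (sub_pos.2 hr2)]
  linarith

lemma eta_avg {n k : ℕ} (hk : k ≤ n) {α β T : ℝ} (hβ : 0 < β) {f : Eu n → ℝ} (hfs : SmoothOnSphere f) (hfp : PosOnSphere f)
    {u : ℝ → Eu n → ℝ} (hu : NormFlow n k α β f (Set.Ico 0 T) u) {t : ℝ} (ht : t ∈ Set.Ico 0 T) (c : ℝ) :
    ∫ x, u t x * sigmaK n k (u t) x * (Ph n k α β f (u t) x - c) ∂(smu n) = sphVol n * (eta n k α β f (u t) - c) := by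
  have hg := hu.1 t ht
  have hw := (u_contOn hg.1).mul (sig_contOn hk hg.1)
  have e1 : ∫ x, u t x * sigmaK n k (u t) x * Ph n k α β f (u t) x ∂(smu n) = sphVol n * eta n k α β f (u t) := by
    rw [← eta_int hk hg]
    refine integral_congr_ae ?_
    filter_upwards [smu_ae n] with x hx
    rw [hh_eq α β f hg hx]; ring
  simp only [mul_sub]
  have i1 : Integrable (fun x => u t x * sigmaK n k (u t) x * Ph n k α β f (u t) x) (smu n) := cont_int (hw.mul (Ph_contOn hk α β hfs hg))
  have i2 : Integrable (fun x => u t x * sigmaK n k (u t) x * c) (smu n) := cont_int (hw.mul continuousOn_const)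
  rw [integral_sub i1 i2, e1, integral_mul_const]
  have := M_const hk hβ hfs hfp hu ht
  rw [Mf] at this
  rw [this]

lemma osc2 {n k : ℕ} (hk : k ≤ n) {α β T : ℝ} (hβ : 0 < β) (hα : α - 1 + k * β ≤ 0) {f : Eu n → ℝ} (hfs : SmoothOnSphere f) (hfp : PosOnSphere f)
    {u : ℝ → Eu n → ℝ} (hu : NormFlow n k α β f (Set.Ico 0 T) u) :
    ∃ C, ∀ t ∈ Set.Ico 0 T, ∀ x ∈ sph n, |Ph n k α β f (u t) x - eta n k α β f (u t)| ≤ C := by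
  obtain ⟨C, hC⟩ := osc hk hβ hα hfs hfp hu
  refine ⟨C, fun t ht x hx => ?_⟩
  have hg := hu.1 t ht
  have hV := sphVol_pos n
  have hw := (u_contOn hg.1).mul (sig_contOn hk hg.1)
  have hwp : ∀ x ∈ sph n, 0 ≤ u t x * sigmaK n k (u t) x := fun x hx => (mul_pos (hg.2.1 x hx) (good_sig_pos hk hg hx)).le
  have a1 := eta_avg hk hβ hfs hfp hu ht (Ph n k α β f (u t) x - C)
  have a2 := eta_avg hk hβ hfs hfp hu ht (Ph n k α β f (u t) x + C)
  have b1 : 0 ≤ sphVol n * (eta n k α β f (u t) - (Ph n k α β f (u t) x - C)) := by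
    rw [← a1]
    refine integral_nonneg_of_ae ?_
    filter_upwards [smu_ae n] with y hy
    exact mul_nonneg (hwp y hy) (by linarith [hC t ht x hx y hy])
  have b2 : sphVol n * (eta n k α β f (u t) - (Ph n k α β f (u t) x + C)) ≤ 0 := by
    rw [← a2]
    refine integral_nonpos_of_ae ?_
    filter_upwards [smu_ae n] with y hy
    exact mul_nonpos_of_nonneg_of_nonpos (hwp y hy) (by linarith [hC t ht y hy x hx])
  have c1 := nonneg_of_mul_nonneg_right b1 hV
  have c2 : eta n k α β f (u t) - (Ph n k α β f (u t) x + C) ≤ 0 := by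
    by_contra h
    push Not at h
    linarith [mul_pos hV h]
  rw [abs_le]; constructor <;> linarith

lemma int_neg {n : ℕ} {g : Eu n → ℝ} (hg : ContinuousOn g (sph n)) (hn : ∀ x ∈ sph n, g x ≤ 0)
    {x : Eu n} (hx : x ∈ sph n) (hgx : g x ≠ 0) : ∫ x, g x ∂(smu n) < 0 := by
  have h1 : 0 < ∫ x, - g x ∂(smu n) := by
    have hi : Integrable (fun x => - g x) (smu n) := (cont_int hg).neg
    rw [integral_pos_iff_support_of_nonneg_ae (by
      filter_upwards [smu_ae n] with y hy
      simpa using hn y hy) hi]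
    have h2 : ∀ᶠ y in 𝓝[sph n] x, g y ≠ 0 := (hg x hx).eventually_ne hgx
    rw [eventually_nhdsWithin_iff] at h2
    obtain ⟨V, hV, hVo, hxV⟩ := eventually_nhds_iff.1 h2
    have h3 := smu_open V hVo x hx hxV
    refine h3.trans_le (measure_mono_ae ?_)
    filter_upwards [smu_ae n] with y hy hyV
    have := hV y hyV hy
    show - g y ≠ 0
    simpa using this
  rw [integral_neg] at h1
  linarith

lemma J_integrand {n k : ℕ} (hk : k ≤ n) {α β : ℝ} (hβ : 0 < β) {f v : Eu n → ℝ} (hfp : PosOnSphere f) (hv : GoodSph v) {x : Eu n} (hx : x ∈ sph n) :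
    v x * sigmaK n k v x * (Ph n k α β f v x) ^ (-(1 / β)) = f x ^ (-(1 / β)) * Real.exp ((1 + (1 - α) / β) * Real.log (v x)) := by
  have h1 := hv.2.1 x hx
  have h2 := good_sig_pos hk hv hx
  have h3 := hfp x hx
  rw [Ph, Real.mul_rpow (by positivity) (by positivity), Real.mul_rpow h3.le (by positivity), ← Real.rpow_mul h1.le, ← Real.rpow_mul h2.le,
    mul_comm (1 + (1 - α) / β), ← Real.rpow_def_of_pos h1, Real.rpow_add h1, Real.rpow_one]
  have e1 : β * (-(1 / β)) = -1 := by field_simp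
  have e2 : (α - 1) * (-(1 / β)) = (1 - α) / β := by field_simp; ring
  rw [e1, e2, Real.rpow_neg_one]
  field_simp

lemma J_deriv {n k : ℕ} (hk : k ≤ n) {α β T : ℝ} (hβ : 0 < β) (hα : α - 1 + k * β ≤ 0) {f : Eu n → ℝ} (hfs : SmoothOnSphere f) (hfp : PosOnSphere f)
    {u : ℝ → Eu n → ℝ} (hu : NormFlow n k α β f (Set.Ico 0 T) u) {t : ℝ} (ht : t ∈ Set.Ico 0 T) :
    HasDerivWithinAt (fun s => Jfun n k α β f (u s)) ((1 + (1 - α) / β) * ∫ x, u t x * sigmaK n k (u t) x * (Ph n k α β f (u t) x) ^ (-(1 / β)) *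
      (Ph n k α β f (u t) x - eta n k α β f (u t)) ∂(smu n)) (Set.Ico 0 T) t := by
  obtain ⟨C, hC⟩ := osc2 hk hβ hα hfs hfp hu
  set γ := 1 + (1 - α) / β with hγ
  set G : ℝ → Eu n → ℝ := fun r x => f x ^ (-(1 / β)) * Real.exp (γ * Real.log (u r x)) with hG
  have hGd : ∀ x ∈ sph n, ∀ r ∈ Set.Ico 0 T, HasDerivWithinAt (fun r => G r x) (G r x * (γ * (Ph n k α β f (u r) x - eta n k α β f (u r)))) (Set.Ico 0 T) r := by
    intro x hx r hr
    exact ((((flow_log hu hx hr).const_mul γ).exp).const_mul (f x ^ (-(1 / β)))).congr_deriv (by simp only [hG]; ring)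
  have hGc : ContinuousOn (fun p : ℝ × Eu n => G p.1 p.2) (Set.Ico 0 T ×ˢ sph n) := by
    have h1 : ContinuousOn (fun x => f x ^ (-(1 / β))) (sph n) := (u_contOn hfs).rpow_const fun x hx => Or.inl (hfp x hx).ne'
    exact (h1.comp continuousOn_snd (fun p hp => hp.2)).mul (Real.continuous_exp.comp_continuousOn (continuousOn_const.mul (flow_cont hu)))
  have hGx : ∀ r ∈ Set.Ico 0 T, ContinuousOn (G r) (sph n) := fun r hr =>
    hGc.comp (f := fun x => (r, x)) (by fun_prop) (fun x hx => ⟨hr, hx⟩)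
  have hJ : ∀ r ∈ Set.Ico 0 T, Jfun n k α β f (u r) = ∫ x, G r x ∂(smu n) := by
    intro r hr
    rw [Jfun, sphInt_eq]
    refine integral_congr_ae ?_
    filter_upwards [smu_ae n] with x hx
    exact J_integrand hk hβ hfp (hu.1 r hr) hx
  have hval : (γ * ∫ x, u t x * sigmaK n k (u t) x * (Ph n k α β f (u t) x) ^ (-(1 / β)) *
      (Ph n k α β f (u t) x - eta n k α β f (u t)) ∂(smu n)) = ∫ x, G t x * (γ * (Ph n k α β f (u t) x - eta n k α β f (u t))) ∂(smu n) := by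
    rw [← integral_const_mul]
    refine integral_congr_ae ?_
    filter_upwards [smu_ae n] with x hx
    rw [J_integrand hk hβ hfp (hu.1 t ht) hx]; simp only [hG, hγ]; ring
  rw [hval]
  obtain ⟨c, hc1, hc2⟩ := exists_between ht.2
  have hsub : Set.Icc 0 c ⊆ Set.Ico 0 T := fun r hr => ⟨hr.1, hr.2.trans_lt hc2⟩
  obtain ⟨B, hB⟩ := (isCompact_Icc.prod (sph_compact n)).exists_bound_of_continuousOn (hGc.mono (Set.prod_mono hsub subset_rfl))
  have hloc : 𝓝[Set.Ico 0 T] t = 𝓝[Set.Icc 0 c] t := by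
    refine le_antisymm ?_ (nhdsWithin_mono _ hsub)
    refine le_inf inf_le_left ?_
    rw [le_principal_iff]
    filter_upwards [self_mem_nhdsWithin, mem_nhdsWithin_of_mem_nhds (Iic_mem_nhds hc1)] with r hr1 hr2
    exact ⟨hr1.1, hr2⟩
  suffices HasDerivWithinAt (fun r => ∫ x, G r x ∂(smu n)) (∫ x, G t x * (γ * (Ph n k α β f (u t) x - eta n k α β f (u t))) ∂(smu n)) (Set.Ico 0 T) t from
    this.congr hJ (hJ t ht)
  have htc : t ∈ Set.Icc 0 c := ⟨ht.1, hc1.le⟩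
  rw [hasDerivWithinAt_iff_tendsto_slope]
  have hF : ∀ᶠ r in 𝓝[Set.Ico 0 T \ {t}] t, r ∈ Set.Icc 0 c ∧ r ≠ t := by
    have h1 : 𝓝[Set.Ico 0 T \ {t}] t ≤ 𝓝[Set.Icc 0 c] t := by rw [← hloc]; exact nhdsWithin_mono _ Set.diff_subset
    filter_upwards [h1 self_mem_nhdsWithin, self_mem_nhdsWithin] with r hr hr2
    exact ⟨hr, hr2.2⟩
  have hlim : Tendsto (fun r => ∫ x, slope (fun r => G r x) t r ∂(smu n)) (𝓝[Set.Ico 0 T \ {t}] t)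
      (𝓝 (∫ x, G t x * (γ * (Ph n k α β f (u t) x - eta n k α β f (u t))) ∂(smu n))) := by
    refine tendsto_integral_filter_of_dominated_convergence (fun _ => B * (|γ| * C)) ?_ ?_ (integrable_const _) ?_
    · filter_upwards [hF] with r hr
      simp only [slope_def_field]
      exact (((cont_int (hGx r (hsub hr.1))).sub (cont_int (hGx t ht))).div_const _).aestronglyMeasurable
    · filter_upwards [hF] with r hr
      filter_upwards [smu_ae n] with x hx
      have := (convex_Icc (0:ℝ) c).norm_image_sub_le_of_norm_hasDerivWithin_le (f := fun r => G r x) (C := B * (|γ| * C))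
        (fun r hr => (hGd x hx r (hsub hr)).mono hsub) (fun r hr => by
          have h1 := hB (r, x) ⟨hr, hx⟩
          have h2 := hC r (hsub hr) x hx
          rw [Real.norm_eq_abs] at h1 ⊢
          rw [abs_mul, abs_mul γ]
          exact mul_le_mul h1 (mul_le_mul_of_nonneg_left h2 (abs_nonneg γ)) (by positivity) ((abs_nonneg _).trans h1)) htc hr.1
      rw [slope_def_field, norm_div, div_le_iff₀ (norm_pos_iff.2 (sub_ne_zero.2 hr.2))]
      exact this
    · filter_upwards [smu_ae n] with x hx
      exact hasDerivWithinAt_iff_tendsto_slope.1 (hGd x hx t ht)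
  refine hlim.congr' ?_
  filter_upwards [hF] with r hr
  simp only [slope_def_field]
  rw [integral_div, integral_sub (cont_int (hGx r (hsub hr.1))) (cont_int (hGx t ht))]

lemma D_facts {n k : ℕ} (hk : k ≤ n) {α β T : ℝ} (hβ : 0 < β) {f : Eu n → ℝ} (hfs : SmoothOnSphere f) (hfp : PosOnSphere f)
    {u : ℝ → Eu n → ℝ} (hu : NormFlow n k α β f (Set.Ico 0 T) u) {t : ℝ} (ht : t ∈ Set.Ico 0 T) :
    (∫ x, u t x * sigmaK n k (u t) x * (Ph n k α β f (u t) x) ^ (-(1 / β)) * (Ph n k α β f (u t) x - eta n k α β f (u t)) ∂(smu n) ≤ 0) ∧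
    ((∫ x, u t x * sigmaK n k (u t) x * (Ph n k α β f (u t) x) ^ (-(1 / β)) * (Ph n k α β f (u t) x - eta n k α β f (u t)) ∂(smu n) = 0) ↔
      ∃ c : ℝ, 0 < c ∧ ∀ x ∈ sph n, Ph n k α β f (u t) x = c) := by
  have hg := hu.1 t ht
  set η := eta n k α β f (u t) with hη
  have hηp : 0 < η := eta_pos hk hfs hfp hg
  have hw := (u_contOn hg.1).mul (sig_contOn hk hg.1)
  have hPc := Ph_contOn hk α β hfs hg
  have hPp : ∀ x ∈ sph n, 0 < Ph n k α β f (u t) x := fun x hx => Ph_pos hk α β hfp hg hx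
  have hΨ : ContinuousOn (fun x => Ph n k α β f (u t) x ^ (-(1 / β))) (sph n) := hPc.rpow_const fun x hx => Or.inl (hPp x hx).ne'
  have hb : -(1 / β) < 0 := by have : 0 < 1 / β := by positivity
                               linarith
  set g : Eu n → ℝ := fun x => u t x * sigmaK n k (u t) x * (Ph n k α β f (u t) x - η) * (Ph n k α β f (u t) x ^ (-(1 / β)) - η ^ (-(1 / β))) with hgd
  have hgc : ContinuousOn g (sph n) := (hw.mul (hPc.sub continuousOn_const)).mul (hΨ.sub continuousOn_const)
  have h0 := eta_avg hk hβ hfs hfp hu ht η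
  rw [← hη, sub_self, mul_zero] at h0
  have e : ∫ x, u t x * sigmaK n k (u t) x * (Ph n k α β f (u t) x) ^ (-(1 / β)) * (Ph n k α β f (u t) x - η) ∂(smu n) = ∫ x, g x ∂(smu n) := by
    have i1 : Integrable (fun x => u t x * sigmaK n k (u t) x * (Ph n k α β f (u t) x) ^ (-(1 / β)) * (Ph n k α β f (u t) x - η)) (smu n) :=
      cont_int ((hw.mul hΨ).mul (hPc.sub continuousOn_const))
    have i2 : Integrable (fun x => u t x * sigmaK n k (u t) x * (Ph n k α β f (u t) x - η) * η ^ (-(1 / β))) (smu n) :=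
      cont_int ((hw.mul (hPc.sub continuousOn_const)).mul continuousOn_const)
    have : g = fun x => u t x * sigmaK n k (u t) x * (Ph n k α β f (u t) x) ^ (-(1 / β)) * (Ph n k α β f (u t) x - η) - u t x * sigmaK n k (u t) x * (Ph n k α β f (u t) x - η) * η ^ (-(1 / β)) := by
      funext x; simp only [hgd]; ring
    rw [this, integral_sub i1 i2, integral_mul_const, h0]; ring
  rw [e]
  have hwp : ∀ x ∈ sph n, 0 < u t x * sigmaK n k (u t) x := fun x hx => mul_pos (hg.2.1 x hx) (good_sig_pos hk hg hx)
  have hgn : ∀ x ∈ sph n, g x ≤ 0 := by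
    intro x hx
    have p := hPp x hx
    simp only [hgd]; rw [mul_assoc]
    refine mul_nonpos_of_nonneg_of_nonpos (hwp x hx).le ?_
    rcases le_total (Ph n k α β f (u t) x) η with h | h
    · exact mul_nonpos_of_nonpos_of_nonneg (by linarith) (sub_nonneg.2 (Real.rpow_le_rpow_of_nonpos p h hb.le))
    · exact mul_nonpos_of_nonneg_of_nonpos (by linarith) (sub_nonpos.2 (Real.rpow_le_rpow_of_nonpos hηp h hb.le))
  refine ⟨integral_nonpos_of_ae ?_, fun h => ⟨η, hηp, fun x hx => ?_⟩, ?_⟩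
  · filter_upwards [smu_ae n] with x hx using hgn x hx
  · by_contra hne
    refine (int_neg hgc hgn hx ?_).ne h
    have p := hPp x hx
    refine mul_ne_zero (mul_ne_zero (hwp x hx).ne' (sub_ne_zero.2 hne)) (sub_ne_zero.2 ?_)
    rcases lt_or_gt_of_ne hne with h | h
    · exact (Real.rpow_lt_rpow_of_neg p h hb).ne'
    · exact (Real.rpow_lt_rpow_of_neg hηp h hb).ne
  · rintro ⟨c, hc, hcc⟩
    have h1 := eta_avg hk hβ hfs hfp hu ht c
    have h2 : ∫ x, u t x * sigmaK n k (u t) x * (Ph n k α β f (u t) x - c) ∂(smu n) = ∫ x, (0:ℝ) ∂(smu n) := by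
      refine integral_congr_ae ?_
      filter_upwards [smu_ae n] with x hx
      rw [hcc x hx]; ring
    rw [h2, integral_zero] at h1
    have h3 : η = c := by
      rcases mul_eq_zero.1 h1.symm with h | h
      · exact absurd h (sphVol_pos n).ne'
      · linarith
    rw [← integral_zero (Eu n) ℝ (μ := smu n)]
    refine integral_congr_ae ?_
    filter_upwards [smu_ae n] with x hx
    simp only [hgd, hcc x hx, h3]; ring

/-- Lemma 2.3: the functional `J` is non-increasing along the normalised anisotropic flow,
and for a given time its derivative vanishes iff `f u^{α−1} σ_k^β` is a (positive) constant
on `S^n` at that time. -/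
theorem stmt6 (n k : ℕ) (hn : 2 ≤ n) (hk1 : 1 ≤ k) (hkn : k ≤ n)
    (α β T : ℝ) (hβ : 1 / (k : ℝ) < β) (hα : α ≤ 1 - k * β)
    (f : Eu n → ℝ) (hfs : SmoothOnSphere f) (hfp : PosOnSphere f)
    (u : ℝ → Eu n → ℝ) (hu : NormFlow n k α β f (Set.Ico 0 T) u) :
    (∀ t₁ ∈ Set.Ico (0 : ℝ) T, ∀ t₂ ∈ Set.Ico (0 : ℝ) T, t₁ ≤ t₂ →
      Jfun n k α β f (u t₂) ≤ Jfun n k α β f (u t₁)) ∧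
    ∀ t ∈ Set.Ico (0 : ℝ) T,
      (HasDerivWithinAt (fun s => Jfun n k α β f (u s)) 0 (Set.Ico 0 T) t ↔
        ∃ c : ℝ, 0 < c ∧
          ∀ x ∈ sph n, f x * u t x ^ (α - 1) * sigmaK n k (u t) x ^ β = c) := by
  have hk0 : (0:ℝ) < k := by exact_mod_cast hk1
  have hβ0 : 0 < β := lt_trans (by positivity) hβ
  have hα' : α - 1 + k * β ≤ 0 := by linarith
  have hγ : 0 < 1 + (1 - α) / β := by
    have : 0 ≤ (1 - α) / β := div_nonneg (by nlinarith) hβ0.le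
    linarith
  have hD := fun t ht => J_deriv hkn hβ0 hα' hfs hfp hu (t := t) ht
  have hF := fun t ht => D_facts hkn hβ0 hfs hfp hu (t := t) ht
  constructor
  · have hanti := antitoneOn_of_hasDerivWithinAt_nonpos (convex_Ico 0 T) (fun t ht => (hD t ht).continuousWithinAt)
      (fun t ht => (hD t (interior_subset ht)).mono interior_subset)
      (fun t ht => mul_nonpos_of_nonneg_of_nonpos hγ.le (hF t (interior_subset ht)).1)
    exact fun t₁ h₁ t₂ h₂ h => hanti h₁ h₂ h
  · intro t ht
    refine Iff.trans ?_ (hF t ht).2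
    constructor
    · intro h
      have := (uniqueDiffOn_Ico 0 T t ht).eq_deriv _ h (hD t ht)
      exact (mul_eq_zero.1 this.symm).resolve_left hγ.ne'
    · intro h
      have := hD t ht
      rwa [h, mul_zero] at this
end
end

section
/- Let n ≥ 2, let k be an integer with 1 ≤ k ≤ n, let β > 1/k and α ≤ 1 − kβ. Let u be a solution of the normalised flow ∂_t u = u^α σ_k^β − γu on S^n × [0,T), where γ = C(n,k)^β. Then for all (x,t) ∈ S^n × [0,T): min{1, min_{S^n} u(·,0)} ≤ u(x,t) ≤ max{1, max_{S^n} u(·,0)}. -/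
open MeasureTheory Filter
open scoped RealInnerProductSpace Topology

noncomputable section

namespace Aux

lemma contDiffAt_hom {n : ℕ} {u : Eu n → ℝ} (h : SmoothOnSphere u) {y : Eu n} (hy : y ≠ 0) :
    ContDiffAt ℝ (⊤ : ℕ∞) (homExt u) y :=
  ContDiffOn.contDiffAt h (isOpen_compl_singleton.mem_nhds hy)

lemma hasGrad {n : ℕ} {u : Eu n → ℝ} (h : SmoothOnSphere u) {y : Eu n} (hy : y ≠ 0) :
    HasGradientAt (homExt u) (gradient (homExt u) y) y :=
  ((contDiffAt_hom h hy).differentiableAt (by simp)).hasGradientAt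

lemma hasHess {n : ℕ} {u : Eu n → ℝ} (h : SmoothOnSphere u) {y : Eu n} (hy : y ≠ 0) :
    HasFDerivAt (gradient (homExt u)) (hessOp u y) y := by
  have h1 : DifferentiableAt ℝ (fderiv ℝ (homExt u)) y :=
    ((contDiffAt_hom h hy).fderiv_right (m := 1) (by norm_cast)).differentiableAt (by simp)
  have h2 : DifferentiableAt ℝ (gradient (homExt u)) y := by
    have := ((InnerProductSpace.toDual ℝ (Eu n)).symm.differentiableAt
      (x := fderiv ℝ (homExt u) y)).comp y h1
    exact this
  exact h2.hasFDerivAt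

lemma hess_inner {n : ℕ} {u : Eu n → ℝ} (h : SmoothOnSphere u) {y : Eu n} (hy : y ≠ 0)
    (v w : Eu n) : ⟪hessOp u y v, w⟫ = fderiv ℝ (fderiv ℝ (homExt u)) y v w := by
  have h1 : DifferentiableAt ℝ (fderiv ℝ (homExt u)) y :=
    ((contDiffAt_hom h hy).fderiv_right (m := 1) (by norm_cast)).differentiableAt (by simp)
  have h2 := (hasHess h hy).inner ℝ (hasFDerivAt_const w y)
  have h3 := h1.hasFDerivAt.clm_apply (hasFDerivAt_const w y)
  have e : (fun z => ⟪gradient (homExt u) z, w⟫) = fun z => fderiv ℝ (homExt u) z w := by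
    funext z; simp
  rw [e] at h2
  have h4 := DFunLike.congr_fun (h2.unique h3) v
  simpa using h4

lemma hess_symm {n : ℕ} {u : Eu n → ℝ} (h : SmoothOnSphere u) {y : Eu n} (hy : y ≠ 0)
    (v w : Eu n) : ⟪hessOp u y v, w⟫ = ⟪v, hessOp u y w⟫ := by
  rw [real_inner_comm _ v, hess_inner h hy, hess_inner h hy]
  exact ((contDiffAt_hom h hy).isSymmSndFDerivAt (by simp; norm_cast)).eq v w

lemma hom_smul {n : ℕ} (u : Eu n → ℝ) {t : ℝ} (ht : 0 < t) (y : Eu n) :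
    homExt u (t • y) = t * homExt u y := by
  unfold homExt
  have e : (t * ‖y‖)⁻¹ * t = ‖y‖⁻¹ := by
    rw [mul_inv, mul_right_comm, inv_mul_cancel₀ ht.ne', one_mul]
  rw [norm_smul, Real.norm_of_nonneg ht.le, smul_smul, e, mul_assoc]

lemma hom_sph {n : ℕ} (u : Eu n → ℝ) {y : Eu n} (hy : y ∈ sph n) :
    homExt u y = u y := by
  have : ‖y‖ = 1 := by simpa [sph] using hy
  simp [homExt, this]

lemma euler {n : ℕ} {u : Eu n → ℝ} (h : SmoothOnSphere u) {y : Eu n} (hy : y ≠ 0) :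
    ⟪gradient (homExt u) y, y⟫ = homExt u y := by
  have h1 : HasDerivAt (fun t : ℝ => t • y) y 1 := by
    simpa using (hasDerivAt_id (1:ℝ)).smul_const y
  have h0 := (hasGrad h hy).hasFDerivAt
  have h2 : HasDerivAt (fun t : ℝ => homExt u (t • y)) ⟪gradient (homExt u) y, y⟫ 1 := by
    have := HasFDerivAt.comp_hasDerivAt (f := fun t : ℝ => t • y) (1:ℝ) (by rw [one_smul]; exact h0) h1
    simp only [InnerProductSpace.toDual_apply_apply] at this
    exact this
  have h3 : HasDerivAt (fun t : ℝ => t * homExt u y) (homExt u y) 1 := by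
    simpa using (hasDerivAt_id (1:ℝ)).mul_const (homExt u y)
  have h4 : (fun t : ℝ => homExt u (t • y)) =ᶠ[𝓝 1] fun t : ℝ => t * homExt u y := by
    filter_upwards [lt_mem_nhds (zero_lt_one (α := ℝ))] with t ht using hom_smul u ht y
  exact h2.unique (h3.congr_of_eventuallyEq h4)

lemma hess_radial {n : ℕ} {u : Eu n → ℝ} (h : SmoothOnSphere u) {y : Eu n} (hy : y ≠ 0) :
    hessOp u y y = 0 := by
  apply ext_inner_right ℝ
  intro w
  rw [hess_symm h hy, inner_zero_left]
  have h1 := (hasHess h hy).inner ℝ (hasFDerivAt_id y)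
  have h2 : (fun z : Eu n => ⟪gradient (homExt u) z, id z⟫) =ᶠ[𝓝 y] homExt u := by
    filter_upwards [isOpen_compl_singleton.mem_nhds hy] with z hz using euler h hz
  have h3 := ((hasGrad h hy).hasFDerivAt.congr_of_eventuallyEq h2).unique h1
  have h4 := DFunLike.congr_fun h3 w
  simp at h4
  rw [real_inner_comm]
  exact h4

/-- second derivative along great circles -/
lemma circ {n : ℕ} {u : Eu n → ℝ} (h : SmoothOnSphere u) {x v : Eu n} (hx : ‖x‖ = 1)
    (hv : ‖v‖ = 1) (hxv : ⟪x, v⟫ = 0) :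
    ∃ f : ℝ → ℝ, (∀ s, ∃ z ∈ sph n, f s = u z) ∧ f 0 = u x ∧ Continuous f ∧
      HasDerivAt (deriv f) (⟪v, hessOp u x v⟫ - u x) 0 := by
  set c : ℝ → Eu n := fun s => Real.cos s • x + Real.sin s • v with hc
  set c' : ℝ → Eu n := fun s => (-Real.sin s) • x + Real.cos s • v with hc'
  have hcn : ∀ s, ‖c s‖ = 1 := by
    intro s
    have : ‖c s‖ ^ 2 = 1 := by
      rw [hc]
      simp only
      rw [norm_add_sq_real, norm_smul, norm_smul, inner_smul_left, inner_smul_right, hxv, hx, hv]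
      simp
    nlinarith [norm_nonneg (c s)]
  have hc0 : ∀ s, c s ≠ 0 := fun s hs => by
    have := hcn s; rw [hs] at this; simp at this
  have hd : ∀ s, HasDerivAt c (c' s) s := fun s =>
    ((Real.hasDerivAt_cos s).smul_const x).add ((Real.hasDerivAt_sin s).smul_const v)
  have hd' : HasDerivAt c' (-x) 0 := by
    have := (((Real.hasDerivAt_sin 0).neg).smul_const x).add ((Real.hasDerivAt_cos 0).smul_const v)
    convert! this using 1
    simp
  have hf : ∀ s, HasDerivAt (fun s => homExt u (c s)) ⟪gradient (homExt u) (c s), c' s⟫ s := by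
    intro s
    have := (hasGrad h (hc0 s)).hasFDerivAt.comp_hasDerivAt s (hd s)
    simp only [InnerProductSpace.toDual_apply_apply] at this
    exact this
  have hs : ∀ s, c s ∈ sph n := fun s => by simp [sph, hcn]
  have c00 : c 0 = x := by simp [hc]
  have c0' : c' 0 = v := by simp [hc']
  have hx0 : x ≠ 0 := c00 ▸ hc0 0
  have hxs : x ∈ sph n := c00 ▸ hs 0
  refine ⟨fun s => homExt u (c s), fun s => ⟨c s, hs s, hom_sph u (hs s)⟩, ?_, ?_, ?_⟩
  · simp only [c00]; exact hom_sph u hxs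
  · exact continuous_iff_continuousAt.2 fun s => (hf s).continuousAt
  · have e : deriv (fun s => homExt u (c s)) = fun s => ⟪gradient (homExt u) (c s), c' s⟫ := by
      funext s; exact (hf s).deriv
    rw [e]
    have h1 : HasDerivAt (fun s => gradient (homExt u) (c s)) (hessOp u x v) 0 := by
      have := HasFDerivAt.comp_hasDerivAt (f := c) 0 (by rw [c00]; exact hasHess h hx0) (hd 0)
      rw [c0'] at this
      exact this
    have h2 := h1.inner ℝ hd'
    convert! h2 using 1
    rw [c00, c0', inner_neg_right, euler h hx0, hom_sph u hxs, real_inner_comm]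
    ring

lemma snd_le {f : ℝ → ℝ} {L : ℝ} (hc : Continuous f) (h : HasDerivAt (deriv f) L 0)
    (hm : IsLocalMax f 0) : L ≤ 0 := by
  by_contra! hL
  have h1 : IsLocalMin f 0 :=
    isLocalMin_of_deriv_deriv_pos (by rw [h.deriv]; exact hL) hm.deriv_eq_zero hc.continuousAt
  have h2 : f =ᶠ[𝓝 0] fun _ => f 0 := by
    filter_upwards [h1, hm] with a ha hb using le_antisymm hb ha
  have h3 : deriv f =ᶠ[𝓝 0] fun _ => 0 := by
    have := h2.deriv
    simpa using this
  have := h3.deriv_eq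
  rw [h.deriv] at this
  simp at this
  linarith

lemma hess_max {n : ℕ} {u : Eu n → ℝ} (h : SmoothOnSphere u) {x v : Eu n} (hx : ‖x‖ = 1)
    (hv : ‖v‖ = 1) (hxv : ⟪x, v⟫ = 0) (hm : ∀ z ∈ sph n, u z ≤ u x) :
    ⟪v, hessOp u x v⟫ ≤ u x := by
  obtain ⟨f, hf, f0, fc, fd⟩ := circ h hx hv hxv
  have := snd_le fc fd (Eventually.of_forall fun s => by
    obtain ⟨z, hz, e⟩ := hf s
    rw [f0, e]; exact hm z hz)
  linarith

lemma hess_min {n : ℕ} {u : Eu n → ℝ} (h : SmoothOnSphere u) {x v : Eu n} (hx : ‖x‖ = 1)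
    (hv : ‖v‖ = 1) (hxv : ⟪x, v⟫ = 0) (hm : ∀ z ∈ sph n, u x ≤ u z) :
    u x ≤ ⟪v, hessOp u x v⟫ := by
  obtain ⟨f, hf, f0, fc, fd⟩ := circ h hx hv hxv
  have e : deriv (-f) = - deriv f := by funext s; exact deriv.neg
  have := snd_le (f := -f) fc.neg (by rw [e]; exact fd.neg) (Eventually.of_forall fun s => by
    obtain ⟨z, hz, e⟩ := hf s
    simp only [Pi.neg_apply]
    rw [f0, e]; exact neg_le_neg (hm z hz))
  linarith

lemma spec {n k : ℕ} (hkn : k ≤ n) {u : Eu n → ℝ} (h : SmoothOnSphere u) (hc : UnifConvex u)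
    {x : Eu n} (hx : ‖x‖ = 1) :
    ∃ (l : Fin (n + 1) → ℝ) (i : Fin (n + 1)),
      (∀ j, j ≠ i → ∃ v : Eu n, ‖v‖ = 1 ∧ ⟪x, v⟫ = 0 ∧ l j = ⟪v, hessOp u x v⟫) ∧
      sigmaK n k u x = ∑ s ∈ (Finset.univ.erase i).powersetCard k, ∏ j ∈ s, l j := by
  have hx0 : x ≠ 0 := fun e => by simp [e] at hx
  have hxs : x ∈ sph n := by simp [sph, hx]
  have hT : (hessOp u x).toLinearMap.IsSymmetric := fun v w => hess_symm h hx0 v w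
  have hn : Module.finrank ℝ (Eu n) = n + 1 := by simp
  set b := hT.eigenvectorBasis hn with hb
  set l := hT.eigenvalues hn with hl
  have hbl : ∀ j, hessOp u x (b j) = l j • b j := fun j => hT.apply_eigenvectorBasis hn j
  have hlx : ∀ j, l j * ⟪x, b j⟫ = 0 := by
    intro j
    rw [← inner_smul_right, ← hbl, ← hess_symm h hx0, hess_radial h hx0, inner_zero_left]
  obtain ⟨i, hi⟩ : ∃ i, ⟪x, b i⟫ ≠ 0 := by
    by_contra! hh
    apply hx0
    rw [← b.sum_repr' x]
    refine Finset.sum_eq_zero fun i _ => ?_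
    rw [real_inner_comm, hh i, zero_smul]
  have hli : l i = 0 := by
    rcases mul_eq_zero.1 (hlx i) with h1 | h1
    · exact h1
    · exact absurd h1 hi
  have hbi : b i = ⟪x, b i⟫ • x := by
    by_contra hne
    have hne' : b i - ⟪x, b i⟫ • x ≠ 0 := sub_ne_zero.2 hne
    have h2 := hc x hxs _ (by
      rw [inner_sub_right, inner_smul_right, real_inner_self_eq_norm_sq, hx]; ring) hne'
    rw [map_sub, map_smul, hess_radial h hx0, hbl, hli] at h2
    simp at h2
  refine ⟨l, i, ?_, ?_⟩
  · intro j hj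
    refine ⟨b j, b.norm_eq_one j, ?_, ?_⟩
    · have h3 : ⟪b i, b j⟫ = 0 := b.inner_eq_zero (Ne.symm hj)
      rw [hbi, inner_smul_left] at h3
      rcases mul_eq_zero.1 h3 with h4 | h4
      · exact absurd (by simpa using h4) hi
      · exact h4
    · rw [hbl, inner_smul_right, real_inner_self_eq_norm_sq, b.norm_eq_one j]; ring
  · unfold sigmaK esymmOp
    have h5 : (LinearMap.charpoly (hessOp u x).toLinearMap).coeff (n + 1 - k)
        = (-1) ^ k * ∑ s ∈ (Finset.univ : Finset (Fin (n+1))).powersetCard k, ∏ j ∈ s, l j := by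
      rw [hT.charpoly_eq hn]
      have := Multiset.prod_X_sub_C_coeff ((Finset.univ : Finset (Fin (n+1))).val.map l)
        (k := n + 1 - k) (by simp)
      rw [Finset.esymm_map_val] at this
      simp only [Multiset.map_map, Multiset.card_map, Finset.card_val, Finset.card_univ,
        Fintype.card_fin, Nat.sub_sub_self (by omega : k ≤ n + 1)] at this
      exact this
    rw [h5, ← mul_assoc, ← mul_pow]
    simp only [mul_neg, mul_one, neg_neg, one_pow, one_mul]
    symm
    apply Finset.sum_subset
    · exact Finset.powersetCard_mono (Finset.erase_subset _ _)
    · intro s hs hs'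
      rw [Finset.mem_powersetCard] at hs hs'
      have : i ∈ s := by
        by_contra hi'
        exact hs' ⟨fun a ha => Finset.mem_erase.2 ⟨fun e => hi' (e ▸ ha), Finset.mem_univ _⟩, hs.2⟩
      exact Finset.prod_eq_zero this hli

lemma sigma_nonneg {n k : ℕ} (hkn : k ≤ n) {u : Eu n → ℝ} (h : SmoothOnSphere u)
    (hc : UnifConvex u) {x : Eu n} (hx : ‖x‖ = 1) : 0 ≤ sigmaK n k u x := by
  obtain ⟨l, i, hl, e⟩ := spec hkn h hc hx
  rw [e]
  refine Finset.sum_nonneg fun s hs => Finset.prod_nonneg fun j hj => ?_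
  obtain ⟨v, hv, hxv, e⟩ := hl j (Finset.ne_of_mem_erase ((Finset.mem_powersetCard.1 hs).1 hj))
  rw [e]
  exact (hc x (by simp [sph, hx]) v hxv (fun e => by simp [e] at hv)).le

lemma sigma_max {n k : ℕ} (hkn : k ≤ n) {u : Eu n → ℝ} (h : SmoothOnSphere u)
    (hc : UnifConvex u) {x : Eu n} (hx : ‖x‖ = 1) (hm : ∀ z ∈ sph n, u z ≤ u x) :
    sigmaK n k u x ≤ n.choose k * u x ^ k := by
  obtain ⟨l, i, hl, e⟩ := spec hkn h hc hx
  have hl2 : ∀ j ≠ i, 0 ≤ l j ∧ l j ≤ u x := by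
    intro j hj
    obtain ⟨v, hv, hxv, e⟩ := hl j hj
    rw [e]
    exact ⟨(hc x (by simp [sph, hx]) v hxv (fun e => by simp [e] at hv)).le, hess_max h hx hv hxv hm⟩
  rw [e]
  calc _ ≤ ∑ s ∈ (Finset.univ.erase i).powersetCard k, u x ^ k := by
        refine Finset.sum_le_sum fun s hs => ?_
        rw [Finset.mem_powersetCard] at hs
        rw [← hs.2, ← Finset.prod_const]
        exact Finset.prod_le_prod (fun j hj => (hl2 j (Finset.ne_of_mem_erase (hs.1 hj))).1)
          (fun j hj => (hl2 j (Finset.ne_of_mem_erase (hs.1 hj))).2)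
    _ = _ := by simp

lemma sigma_min {n k : ℕ} (hkn : k ≤ n) {u : Eu n → ℝ} (h : SmoothOnSphere u)
    (hc : UnifConvex u) {x : Eu n} (hx : ‖x‖ = 1) (hp : 0 ≤ u x) (hm : ∀ z ∈ sph n, u x ≤ u z) :
    n.choose k * u x ^ k ≤ sigmaK n k u x := by
  obtain ⟨l, i, hl, e⟩ := spec hkn h hc hx
  have hl2 : ∀ j ≠ i, u x ≤ l j := by
    intro j hj
    obtain ⟨v, hv, hxv, e⟩ := hl j hj
    rw [e]
    exact hess_min h hx hv hxv hm
  rw [e]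
  calc _ = ∑ s ∈ (Finset.univ.erase i).powersetCard k, u x ^ k := by simp
    _ ≤ _ := by
        refine Finset.sum_le_sum fun s hs => ?_
        rw [Finset.mem_powersetCard] at hs
        rw [← hs.2, ← Finset.prod_const]
        exact Finset.prod_le_prod (fun j hj => hp)
          (fun j hj => (hl2 j (Finset.ne_of_mem_erase (hs.1 hj))))

/-- speed comparison -/
lemma speed_max {n k : ℕ} {a β c s : ℝ} (hc : 1 ≤ c) (hβ : 0 < β) (ha : a ≤ 1 - k * β)
    (hs0 : 0 ≤ s) (hs : s ≤ n.choose k * c ^ k) :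
    c ^ a * s ^ β - (n.choose k : ℝ) ^ β * c ≤ 0 := by
  have c0 : 0 < c := by linarith
  have h1 : s ^ β ≤ (n.choose k : ℝ) ^ β * c ^ (k * β) := by
    calc s ^ β ≤ (n.choose k * c ^ k) ^ β := Real.rpow_le_rpow hs0 hs hβ.le
      _ = _ := by
        rw [Real.mul_rpow (by positivity) (by positivity), ← Real.rpow_natCast, ← Real.rpow_mul c0.le]
  have h2 : c ^ a * c ^ (k * β) ≤ c := by
    rw [← Real.rpow_add c0]
    calc _ ≤ c ^ (1:ℝ) := Real.rpow_le_rpow_of_exponent_le hc (by linarith)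
      _ = c := Real.rpow_one c
  have h3 : c ^ a * s ^ β ≤ c ^ a * ((n.choose k : ℝ) ^ β * c ^ (k * β)) := by gcongr
  have h4 : (n.choose k : ℝ) ^ β * (c ^ a * c ^ (k * β)) ≤ (n.choose k : ℝ) ^ β * c := by gcongr
  linarith

lemma speed_min {n k : ℕ} {a β c s : ℝ} (c0 : 0 < c) (hc : c ≤ 1) (hβ : 0 < β)
    (ha : a ≤ 1 - k * β) (hs : n.choose k * c ^ k ≤ s) :
    0 ≤ c ^ a * s ^ β - (n.choose k : ℝ) ^ β * c := by
  have h1 : (n.choose k : ℝ) ^ β * c ^ (k * β) ≤ s ^ β := by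
    calc _ = (n.choose k * c ^ k) ^ β := by
          rw [Real.mul_rpow (by positivity) (by positivity), ← Real.rpow_natCast,
            ← Real.rpow_mul c0.le]
      _ ≤ _ := Real.rpow_le_rpow (by positivity) hs hβ.le
  have h2 : c ≤ c ^ a * c ^ (k * β) := by
    rw [← Real.rpow_add c0]
    calc c = c ^ (1:ℝ) := (Real.rpow_one c).symm
      _ ≤ _ := Real.rpow_le_rpow_of_exponent_ge c0 hc (by linarith)
  have h3 : c ^ a * ((n.choose k : ℝ) ^ β * c ^ (k * β)) ≤ c ^ a * s ^ β := by gcongr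
  have h4 : (n.choose k : ℝ) ^ β * c ≤ (n.choose k : ℝ) ^ β * (c ^ a * c ^ (k * β)) := by gcongr
  linarith

lemma touch {E : Type*} [TopologicalSpace E] {K : Set E} (hK : IsCompact K) {T : ℝ}
    {g g' : ℝ → E → ℝ}
    (hg : ContinuousOn (Function.uncurry g) (Set.Ico 0 T ×ˢ K))
    (h0 : ∀ x ∈ K, g 0 x < 0)
    (hd : ∀ x ∈ K, ∀ t ∈ Set.Ico 0 T,
      HasDerivWithinAt (fun r => g r x) (g' t x) (Set.Ico 0 T) t)
    (ht : ∀ x ∈ K, ∀ t ∈ Set.Ico 0 T, g t x = 0 → (∀ z ∈ K, g t z ≤ 0) → g' t x < 0) :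
    ∀ t ∈ Set.Ico 0 T, ∀ x ∈ K, g t x < 0 := by
  intro t1 ht1 x1 hx1
  by_contra! hc
  have hsub : Set.Icc 0 t1 ×ˢ K ⊆ Set.Ico 0 T ×ˢ K :=
    Set.prod_mono (fun s hs => ⟨hs.1, hs.2.trans_lt ht1.2⟩) subset_rfl
  have hcomp : IsCompact (Set.Icc 0 t1 ×ˢ K) := isCompact_Icc.prod hK
  have hch : ∃ p ∈ Set.Icc 0 t1 ×ˢ K, 0 ≤ Function.uncurry g p ∧
      ∀ q ∈ Set.Icc 0 t1 ×ˢ K, 0 ≤ Function.uncurry g q → p.1 ≤ q.1 := by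
    have hS : IsCompact {p : ↥(Set.Icc 0 t1 ×ˢ K) | 0 ≤ Function.uncurry g p.1} := by
      haveI := isCompact_iff_compactSpace.1 hcomp
      apply IsClosed.isCompact
      exact isClosed_le continuous_const (continuousOn_iff_continuous_restrict.1 (hg.mono hsub))
    obtain ⟨p, hp, hpm⟩ := hS.exists_isMinOn
      ⟨⟨(t1, x1), ⟨⟨ht1.1, le_rfl⟩, hx1⟩⟩, hc⟩
      (f := fun p => p.1.1) (by fun_prop)
    exact ⟨p.1, p.2, hp, fun q hq hq' => hpm (a := ⟨q, hq⟩) hq'⟩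
  obtain ⟨⟨t0, x0⟩, ⟨ht0, hx0⟩, hp, hmin⟩ := hch
  simp only [Function.uncurry] at hp ht0 hx0 hmin
  have ht0' : t0 ∈ Set.Ico 0 T := ⟨ht0.1, ht0.2.trans_lt ht1.2⟩
  have ht0p : 0 < t0 := by
    rcases ht0.1.eq_or_lt with e | e
    · rw [← e] at hp; exact absurd hp (not_le.2 (h0 x0 hx0))
    · exact e
  have hneg : ∀ s ∈ Set.Ioo 0 t0, ∀ z ∈ K, g s z < 0 := by
    intro s hs z hz
    by_contra! hh
    exact absurd (hmin (s, z) ⟨⟨hs.1.le, hs.2.le.trans ht0.2⟩, hz⟩ hh) (not_le.2 hs.2)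
  have hda : ∀ z ∈ K, HasDerivAt (fun r => g r z) (g' t0 z) t0 := fun z hz =>
    (hd z hz t0 ht0').hasDerivAt (Ico_mem_nhds ht0p ht0'.2)
  have hle : ∀ z ∈ K, g t0 z ≤ 0 := by
    intro z hz
    refine le_of_tendsto ((hda z hz).continuousAt.tendsto.mono_left
      (nhdsWithin_le_nhds (s := Set.Iio t0))) ?_
    filter_upwards [Ioo_mem_nhdsLT ht0p] with s hs using (hneg s hs z hz).le
  have heq : g t0 x0 = 0 := le_antisymm (hle x0 hx0) hp
  have h1 := ht x0 hx0 t0 ht0' heq hle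
  have h2 : 0 ≤ g' t0 x0 := by
    have h3 := (hasDerivAt_iff_tendsto_slope.1 (hda x0 hx0)).mono_left
      (nhdsWithin_mono t0 (s := Set.Iio t0) (fun s hs => ne_of_lt hs))
    refine ge_of_tendsto h3 ?_
    filter_upwards [Ioo_mem_nhdsLT ht0p] with s hs
    rw [slope_def_field, heq]
    exact div_nonneg_of_nonpos (by linarith [hneg s hs x0 hx0]) (by linarith [hs.2])
  linarith

lemma joint {E : Type*} [TopologicalSpace E] {K : Set E} {T : ℝ} {h : ℝ → E → ℝ}
    (hx : ∀ t ∈ Set.Ico 0 T, ContinuousOn (h t) K)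
    (ht : ∀ x ∈ K, ContinuousOn (fun t => h t x) (Set.Ico 0 T))
    (hm : ∀ x ∈ K, MonotoneOn (fun t => h t x) (Set.Ico 0 T)) :
    ContinuousOn (Function.uncurry h) (Set.Ico 0 T ×ˢ K) := by
  rintro ⟨t0, x0⟩ ⟨ht0, hx0⟩
  simp only at ht0 hx0
  unfold ContinuousWithinAt
  rw [nhdsWithin_prod_eq]
  have hc : ContinuousWithinAt (fun t => h t x0) (Set.Ico 0 T) t0 := ht x0 hx0 t0 ht0
  refine tendsto_order.2 ⟨fun a ha => ?_, fun a ha => ?_⟩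
  · simp only [Function.uncurry] at ha
    have hev := hc.eventually (lt_mem_nhds ha)
    obtain ⟨t1, ht1, hat1, hev1⟩ : ∃ t1 ∈ Set.Ico 0 T, a < h t1 x0 ∧
        ∀ᶠ t in 𝓝[Set.Ico 0 T] t0, t ∈ Set.Ico 0 T ∧ t1 ≤ t := by
      rcases ht0.1.eq_or_lt with e | e
      · refine ⟨t0, ht0, ha, ?_⟩
        filter_upwards [self_mem_nhdsWithin] with t ht
        exact ⟨ht, e ▸ ht.1⟩
      · rw [nhdsWithin_eq_nhds.2 (Ico_mem_nhds e ht0.2)] at hev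
        obtain ⟨t1, h1, h2⟩ := ((hev.filter_mono nhdsWithin_le_nhds).and
          (Ioo_mem_nhdsLT e)).exists
        refine ⟨t1, ⟨h2.1.le, h2.2.trans ht0.2⟩, h1, ?_⟩
        filter_upwards [self_mem_nhdsWithin, nhdsWithin_le_nhds (lt_mem_nhds h2.2)] with t ht ht'
        exact ⟨ht, le_of_lt ht'⟩
    have hev2 : ∀ᶠ x in 𝓝[K] x0, x ∈ K ∧ a < h t1 x :=
      (eventually_mem_nhdsWithin).and ((hx t1 ht1 x0 hx0).eventually (lt_mem_nhds hat1))
    filter_upwards [hev1.prod_mk hev2] with p hp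
    exact hp.2.2.trans_le (hm p.2 hp.2.1 ht1 hp.1.1 hp.1.2)
  · simp only [Function.uncurry] at ha
    have hev := hc.eventually (gt_mem_nhds ha)
    obtain ⟨t1, ht1, hat1, hev1⟩ : ∃ t1 ∈ Set.Ico 0 T, h t1 x0 < a ∧
        ∀ᶠ t in 𝓝[Set.Ico 0 T] t0, t ∈ Set.Ico 0 T ∧ t ≤ t1 := by
      have h4 : Set.Ioo t0 T ⊆ Set.Ico 0 T := fun s hs => ⟨ht0.1.trans hs.1.le, hs.2⟩
      have hev' := hev.filter_mono (nhdsWithin_mono t0 h4)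
      rw [nhdsWithin_Ioo_eq_nhdsGT ht0.2] at hev'
      obtain ⟨t1, h1, h2⟩ := (hev'.and (Ioo_mem_nhdsGT ht0.2)).exists
      refine ⟨t1, h4 h2, h1, ?_⟩
      filter_upwards [self_mem_nhdsWithin, nhdsWithin_le_nhds (gt_mem_nhds h2.1)] with t ht ht'
      exact ⟨ht, le_of_lt ht'⟩
    have hev2 : ∀ᶠ x in 𝓝[K] x0, x ∈ K ∧ h t1 x < a :=
      (eventually_mem_nhdsWithin).and ((hx t1 ht1 x0 hx0).eventually (gt_mem_nhds hat1))
    filter_upwards [hev1.prod_mk hev2] with p hp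
    exact (hm p.2 hp.2.1 hp.1.1 ht1 hp.1.2).trans_lt hp.2.2

lemma mono_exp {T γ : ℝ} {f f' : ℝ → ℝ}
    (hd : ∀ t ∈ Set.Ico 0 T, HasDerivWithinAt f (f' t) (Set.Ico 0 T) t)
    (hf : ∀ t ∈ Set.Ico 0 T, -γ * f t ≤ f' t) :
    MonotoneOn (fun t => Real.exp (γ * t) * f t) (Set.Ico 0 T) := by
  have hD : ∀ t ∈ Set.Ico 0 T, HasDerivWithinAt (fun t => Real.exp (γ * t) * f t)
      (Real.exp (γ * t) * γ * f t + Real.exp (γ * t) * f' t) (Set.Ico 0 T) t := by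
    intro t ht
    have h1 : HasDerivAt (fun t => Real.exp (γ * t)) (Real.exp (γ * t) * γ) t := by
      simpa using ((hasDerivAt_id t).const_mul γ).exp
    exact h1.hasDerivWithinAt.mul (hd t ht)
  apply monotoneOn_of_deriv_nonneg (convex_Ico 0 T)
  · exact fun t ht => (hD t ht).continuousWithinAt
  · exact fun t ht => ((hD t (interior_subset ht)).mono interior_subset).differentiableWithinAt
  · intro t ht
    have ht' := interior_subset ht
    rw [((hD t ht').hasDerivAt (mem_interior_iff_mem_nhds.1 ht)).deriv]
    have := mul_nonneg (Real.exp_pos (γ * t)).le (by linarith [hf t ht'] : 0 ≤ γ * f t + f' t)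
    linarith

end Aux

/-- Lemma 3.1: `C⁰` estimate for the normalised flow `∂_t u = u^α σ_k^β − γu`:
`min{1, min u(·,0)} ≤ u ≤ max{1, max u(·,0)}`. -/
theorem stmt7 (n k : ℕ) (hn : 2 ≤ n) (hk1 : 1 ≤ k) (hkn : k ≤ n)
    (α β T : ℝ) (hβ : 1 / (k : ℝ) < β) (hα : α ≤ 1 - k * β)
    (u : ℝ → Eu n → ℝ) (hu : IsoNormFlow n k α β (Set.Ico 0 T) u) :
    ∀ t ∈ Set.Ico (0 : ℝ) T, ∀ x ∈ sph n,
      min 1 (sInf (u 0 '' sph n)) ≤ u t x ∧ u t x ≤ max 1 (sSup (u 0 '' sph n)) := by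
  intro t ht x hx
  obtain ⟨hgood, hder⟩ := hu
  have hk0 : (0:ℝ) < k := by exact_mod_cast hk1
  have hβ0 : 0 < β := lt_trans (by positivity) hβ
  set γ : ℝ := (n.choose k : ℝ) ^ β with hγ
  have hK : IsCompact (sph n) := isCompact_sphere 0 1
  have hnorm : ∀ z ∈ sph n, ‖z‖ = 1 := fun z hz => by simpa [sph] using hz
  have hcx : ∀ s ∈ Set.Ico 0 T, ContinuousOn (u s) (sph n) := by
    intro s hs
    have h1 : ContinuousOn (homExt (u s)) (sph n) := (hgood s hs).1.continuousOn.mono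
      (fun z hz e => by have := hnorm z hz; rw [Set.mem_singleton_iff.1 e] at this; simp at this)
    exact h1.congr fun z hz => (Aux.hom_sph (u s) hz).symm
  have hjoint : ContinuousOn (Function.uncurry u) (Set.Ico 0 T ×ˢ sph n) := by
    have hct : ∀ z ∈ sph n, ContinuousOn (fun s => u s z) (Set.Ico 0 T) :=
      fun z hz s hs => (hder z hz s hs).continuousWithinAt
    have h1 := Aux.joint (h := fun s z => Real.exp (γ * s) * u s z) (K := sph n) (T := T)
      (fun s hs => continuousOn_const.mul (hcx s hs))
      (fun z hz => (by fun_prop : Continuous fun s => Real.exp (γ * s)).continuousOn.mul (hct z hz))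
      (fun z hz => Aux.mono_exp (hder z hz) (fun s hs => by
        have := Aux.sigma_nonneg (k := k) hkn (hgood s hs).1 (hgood s hs).2.2 (hnorm z hz)
        have h2 := (hgood s hs).2.1 z hz
        have : 0 ≤ u s z ^ α * sigmaK n k (u s) z ^ β := by positivity
        linarith))
    have h2 : ContinuousOn (fun p : ℝ × Eu n => Real.exp (-(γ * p.1)) *
        Function.uncurry (fun s z => Real.exp (γ * s) * u s z) p) (Set.Ico 0 T ×ˢ sph n) :=
      (by fun_prop : Continuous fun p : ℝ × Eu n => Real.exp (-(γ * p.1))).continuousOn.mul h1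
    refine h2.congr fun p _ => ?_
    simp only [Function.uncurry]
    rw [← mul_assoc, ← Real.exp_add]
    simp
  have h0T : (0:ℝ) ∈ Set.Ico 0 T := ⟨le_rfl, ht.1.trans_lt ht.2⟩
  have himg : IsCompact (u 0 '' sph n) := hK.image_of_continuousOn (hcx 0 h0T)
  have hT0 : ∀ s ∈ Set.Ico 0 T, 0 ≤ s := fun s hs => hs.1
  constructor
  · set m := min 1 (sInf (u 0 '' sph n)) with hm
    apply le_of_forall_pos_lt_add
    intro ε hε
    set δ := ε / (1 + t) with hδ
    have h1t : 0 < 1 + t := by linarith [ht.1]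
    have hδ0 : 0 < δ := by positivity
    have := Aux.touch hK (T := T) (g := fun s z => (m - δ * (1 + s)) - u s z)
      (g' := fun s z => - δ - (u s z ^ α * sigmaK n k (u s) z ^ β - γ * u s z))
      (by
        have e : Function.uncurry (fun s z => (m - δ * (1 + s)) - u s z) =
          fun p : ℝ × Eu n => (m - δ * (1 + p.1)) - Function.uncurry u p := rfl
        rw [e]
        exact (by fun_prop : Continuous fun p : ℝ × Eu n => (m - δ * (1 + p.1))).continuousOn.sub
          hjoint)
      (by
        intro z hz
        have h1 : sInf (u 0 '' sph n) ≤ u 0 z := csInf_le himg.bddBelow ⟨z, hz, rfl⟩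
        have h2 : m ≤ sInf (u 0 '' sph n) := min_le_right _ _
        show m - δ * (1 + 0) - u 0 z < 0
        linarith)
      (by
        intro z hz s hs
        have h1 : HasDerivAt (fun s : ℝ => m - δ * (1 + s)) (-δ) s := by
          simpa using (((hasDerivAt_id s).const_add 1).const_mul δ).const_sub m
        exact h1.hasDerivWithinAt.sub (hder z hz s hs))
      (by
        intro z hz s hs hzero hmax
        have hp := (hgood s hs).2.1 z hz
        have h1 : m ≤ 1 := min_le_left _ _
        have h2 : 0 ≤ δ * (1 + s) := mul_nonneg hδ0.le (by linarith [hs.1])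
        have h3 := Aux.sigma_min (k := k) hkn (hgood s hs).1 (hgood s hs).2.2 (hnorm z hz) hp.le
          (fun w hw => by have := hmax w hw; linarith)
        have h4 := Aux.speed_min hp (by linarith) hβ0 hα h3
        linarith)
      t ht x hx
    have e : δ * (1 + t) = ε := by rw [hδ]; field_simp
    linarith
  · set m := max 1 (sSup (u 0 '' sph n)) with hm
    apply le_of_forall_pos_lt_add
    intro ε hε
    set δ := ε / (1 + t) with hδ
    have h1t : 0 < 1 + t := by linarith [ht.1]
    have hδ0 : 0 < δ := by positivity
    have := Aux.touch hK (T := T) (g := fun s z => u s z - (m + δ * (1 + s)))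
      (g' := fun s z => (u s z ^ α * sigmaK n k (u s) z ^ β - γ * u s z) - δ)
      (by
        have e : Function.uncurry (fun s z => u s z - (m + δ * (1 + s))) =
          fun p : ℝ × Eu n => Function.uncurry u p - (m + δ * (1 + p.1)) := rfl
        rw [e]
        exact hjoint.sub
          (by fun_prop : Continuous fun p : ℝ × Eu n => (m + δ * (1 + p.1))).continuousOn)
      (by
        intro z hz
        have h1 : u 0 z ≤ sSup (u 0 '' sph n) := le_csSup himg.bddAbove ⟨z, hz, rfl⟩
        have h2 : sSup (u 0 '' sph n) ≤ m := le_max_right _ _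
        show u 0 z - (m + δ * (1 + 0)) < 0
        linarith)
      (by
        intro z hz s hs
        have h1 : HasDerivAt (fun s : ℝ => m + δ * (1 + s)) δ s := by
          simpa using (((hasDerivAt_id s).const_add 1).const_mul δ).const_add m
        exact (hder z hz s hs).sub h1.hasDerivWithinAt)
      (by
        intro z hz s hs hzero hmax
        have h1 : 1 ≤ m := le_max_left _ _
        have h2 : 0 ≤ δ * (1 + s) := mul_nonneg hδ0.le (by linarith [hs.1])
        have h5 := Aux.sigma_nonneg (k := k) hkn (hgood s hs).1 (hgood s hs).2.2 (hnorm z hz)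
        have h3 := Aux.sigma_max (k := k) hkn (hgood s hs).1 (hgood s hs).2.2 (hnorm z hz)
          (fun w hw => by have := hmax w hw; linarith)
        have h4 := Aux.speed_max (by linarith) hβ0 hα h5 h3
        linarith)
      t ht x hx
    have e : δ * (1 + t) = ε := by rw [hδ]; field_simp
    linarith
end
end
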